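/- Let n ≥ 1, l ∈ ℕ, 0 < α < n, 1 < q ≤ p < ∞, and let s, t satisfy 1/s = 1/p − α/n > 0 and p/q = s/t. Let a_1 ∈ VMO(ℝ^n) and a_2, …, a_l ∈ BMO(ℝ^n). Then the multilinear commutator [a_{{1,…,l}}, I_α] is a compact operator from M^p_q(ℝ^n) to M^s_t(ℝ^n): the image under [a_{{1,…,l}}, I_α] of every bounded subset of M^p_q(ℝ^n) is totally bounded with respect to the M^s_t norm. -/

import Mathlib

open MeasureTheory Metric ENNReal

noncomputable section

/-- Euclidean space ℝⁿ. -/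
abbrev Eucl (n : ℕ) := EuclideanSpace ℝ (Fin n)

/-- The Morrey norm ‖f‖_{M^p_q}. -/
noncomputable def morreyNorm (n : ℕ) (p q : ℝ) (f : Eucl n → ℝ) : ℝ≥0∞ :=
  ⨆ (x : Eucl n) (r : ℝ) (_ : 0 < r),
    (volume (ball x r)) ^ (1 / p - 1 / q) *
      (∫⁻ y in ball x r, ENNReal.ofReal (|f y| ^ q)) ^ (1 / q)

/-- Membership in the Morrey space M^p_q(ℝⁿ). -/
def MemMorrey (n : ℕ) (p q : ℝ) (f : Eucl n → ℝ) : Prop :=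
  Measurable f ∧ morreyNorm n p q f < ⊤

/-- Average of `b` over the ball `B(x,r)`. -/
noncomputable def ballAvg (n : ℕ) (b : Eucl n → ℝ) (x : Eucl n) (r : ℝ) : ℝ :=
  ⨍ y in ball x r, b y

/-- The BMO norm ‖b‖_*. -/
noncomputable def bmoNorm (n : ℕ) (b : Eucl n → ℝ) : ℝ≥0∞ :=
  ⨆ (x : Eucl n) (r : ℝ) (_ : 0 < r),
    (volume (ball x r))⁻¹ *
      ∫⁻ y in ball x r, ENNReal.ofReal |b y - ballAvg n b x r|

/-- Membership in BMO(ℝⁿ). -/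
def MemBMO (n : ℕ) (b : Eucl n → ℝ) : Prop :=
  LocallyIntegrable b volume ∧ bmoNorm n b < ⊤

/-- Smooth compactly supported functions (the class C_c^∞). -/
def IsCcSmooth (n : ℕ) (φ : Eucl n → ℝ) : Prop :=
  ContDiff ℝ (⊤ : ℕ∞) φ ∧ HasCompactSupport φ

/-- VMO(ℝⁿ): the closure of C_c^∞ in the BMO norm. -/
def MemVMO (n : ℕ) (b : Eucl n → ℝ) : Prop :=
  MemBMO n b ∧ ∀ ε : ℝ, 0 < ε → ∃ φ : Eucl n → ℝ, IsCcSmooth n φ ∧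
    bmoNorm n (fun x => b x - φ x) < ENNReal.ofReal ε

/-- The tilde subspace: closure of C_c^∞ in the Morrey norm. -/
def MemTildeMorrey (n : ℕ) (p q : ℝ) (f : Eucl n → ℝ) : Prop :=
  MemMorrey n p q f ∧ ∀ ε : ℝ, 0 < ε → ∃ φ : Eucl n → ℝ, IsCcSmooth n φ ∧
    morreyNorm n p q (fun x => f x - φ x) < ENNReal.ofReal ε

/-- The bar subspace: closure of L^∞ ∩ M^p_q in the Morrey norm. -/
def MemBarMorrey (n : ℕ) (p q : ℝ) (f : Eucl n → ℝ) : Prop :=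
  MemMorrey n p q f ∧ ∀ ε : ℝ, 0 < ε → ∃ g : Eucl n → ℝ, MemMorrey n p q g ∧
    (∃ C : ℝ, ∀ᵐ x ∂(volume : Measure (Eucl n)), |g x| ≤ C) ∧
    morreyNorm n p q (fun x => f x - g x) < ENNReal.ofReal ε

/-- The star subspace: closure of the compactly supported members of M^p_q. -/
def MemStarMorrey (n : ℕ) (p q : ℝ) (f : Eucl n → ℝ) : Prop :=
  MemMorrey n p q f ∧ ∀ ε : ℝ, 0 < ε → ∃ g : Eucl n → ℝ, MemMorrey n p q g ∧
    HasCompactSupport g ∧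
    morreyNorm n p q (fun x => f x - g x) < ENNReal.ofReal ε

/-- The fractional integral operator I_α. -/
noncomputable def fracInt (n : ℕ) (α : ℝ) (f : Eucl n → ℝ) (x : Eucl n) : ℝ :=
  ∫ y, f y * dist x y ^ (α - (n : ℝ))

/-- The multilinear commutator [a_{{1,…,l}}, I_α]. -/
noncomputable def mlCommutator (n l : ℕ) (α : ℝ) (a : Fin l → Eucl n → ℝ)
    (f : Eucl n → ℝ) (x : Eucl n) : ℝ :=
  ∫ y, (∏ j, (a j x - a j y)) * f y * dist x y ^ (α - (n : ℝ))

end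

open Filter Topology

/-- The volume of the unit ball, as a real number. -/
noncomputable def unitVol (n : ℕ) : ℝ := (volume (ball (0 : Eucl n) 1)).toReal

lemma unitVol_pos (n : ℕ) : 0 < unitVol n :=
  ENNReal.toReal_pos (measure_ball_pos _ _ one_pos).ne' measure_ball_lt_top.ne

lemma volume_ball_eq {n : ℕ} (x : Eucl n) {r : ℝ} (hr : 0 < r) :
    volume (ball x r) = ENNReal.ofReal (unitVol n * r ^ n) := by
  rw [Measure.addHaar_ball_of_pos _ _ hr, finrank_euclideanSpace_fin, mul_comm,
    ENNReal.ofReal_mul (unitVol_pos n).le, unitVol, ENNReal.ofReal_toReal measure_ball_lt_top.ne]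

lemma volume_ball_mul {n : ℕ} (x y : Eucl n) {r c : ℝ} (hr : 0 < r) (hc : 0 < c) :
    volume (ball x (c * r)) = ENNReal.ofReal (c ^ n) * volume (ball y r) := by
  rw [volume_ball_eq x (mul_pos hc hr), volume_ball_eq y hr, ← ENNReal.ofReal_mul (by positivity)]
  congr 1; ring

lemma volume_ball_ne_zero {n : ℕ} (x : Eucl n) {r : ℝ} (hr : 0 < r) : volume (ball x r) ≠ 0 :=
  (measure_ball_pos _ _ hr).ne'

lemma restrict_closedBall_eq {n : ℕ} (x : Eucl n) {r : ℝ} (hr : 0 < r) :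
    (volume : Measure (Eucl n)).restrict (closedBall x r) = volume.restrict (ball x r) := by
  refine (Measure.restrict_congr_set ?_).symm
  refine ae_eq_of_subset_of_measure_ge ball_subset_closedBall ?_
    measurableSet_ball.nullMeasurableSet measure_closedBall_lt_top.ne
  rw [Measure.addHaar_closedBall _ _ hr.le, Measure.addHaar_ball_of_pos _ _ hr]

lemma measureReal_ball_pos' {n : ℕ} (x : Eucl n) {r : ℝ} (hr : 0 < r) :
    0 < volume.real (ball x r) :=
  ENNReal.toReal_pos (volume_ball_ne_zero x hr) measure_ball_lt_top.ne

lemma integrableOn_ball {n : ℕ} {a : Eucl n → ℝ} (ha : LocallyIntegrable a) (x : Eucl n) (r : ℝ) :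
    IntegrableOn a (ball x r) :=
  (ha.integrableOn_isCompact (isCompact_closedBall x r)).mono_set ball_subset_closedBall

lemma enorm_ballAvg_sub_le {n : ℕ} {a : Eucl n → ℝ} (ha : LocallyIntegrable a) (x : Eucl n)
    {r : ℝ} (hr : 0 < r) (c : ℝ) :
    ‖ballAvg n a x r - c‖ₑ * volume (ball x r) ≤ ∫⁻ y in ball x r, ‖a y - c‖ₑ := by
  have hi := integrableOn_ball ha x r
  have hv : 0 < volume.real (ball x r) := measureReal_ball_pos' x hr
  have h1 : ∫ y in ball x r, (a y - c) = (ballAvg n a x r - c) * volume.real (ball x r) := by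
    rw [integral_sub hi (integrableOn_const measure_ball_lt_top.ne), ballAvg, setAverage_eq]
    simp
    field_simp
  calc ‖ballAvg n a x r - c‖ₑ * volume (ball x r)
      = ‖∫ y in ball x r, (a y - c)‖ₑ := by
        rw [h1, enorm_mul, Real.enorm_of_nonneg hv.le, ofReal_measureReal measure_ball_lt_top.ne]
    _ ≤ _ := enorm_integral_le_lintegral_enorm _

lemma exists_small_ball_average_gt {n : ℕ} {a : Eucl n → ℝ} (ha : LocallyIntegrable a) (c : ℝ) {K : ℝ}
    (hK0 : 0 ≤ K) {R : ℝ} (hR : 0 < R) :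
    ∀ᵐ x, K < |a x - c| → ∃ j : ℕ, ENNReal.ofReal K * volume (ball x (R / 5 ^ j)) <
      ∫⁻ y in ball x (R / 5 ^ j), ‖a y - c‖ₑ := by
  have hu : LocallyIntegrable (fun y => |a y - c|) (volume : Measure (Eucl n)) :=
    fun x => IntegrableAtFilter.norm ((ha.sub (locallyIntegrable_const c)) x)
  filter_upwards [IsUnifLocDoublingMeasure.ae_tendsto_average volume hu 1] with x hx hK
  have hlim : Tendsto (fun j : ℕ => R / 5 ^ j) atTop (𝓝[>] 0) := by
    rw [tendsto_nhdsWithin_iff]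
    refine ⟨?_, Eventually.of_forall fun j => by simp; positivity⟩
    have := (tendsto_pow_atTop_nhds_zero_of_lt_one (r := (1/5 : ℝ)) (by norm_num) (by norm_num)).const_mul R
    simpa [div_eq_mul_inv] using this
  have h := hx (fun _ => x) _ hlim (Eventually.of_forall fun j => by
    simp only [mem_closedBall, dist_self, one_mul]; positivity)
  obtain ⟨j, hj⟩ := (h.eventually (lt_mem_nhds hK)).exists
  refine ⟨j, ?_⟩
  have hr : 0 < R / 5 ^ j := by positivity
  rw [average_eq, restrict_closedBall_eq x hr] at hj
  have hv : 0 < volume.real (ball x (R / 5 ^ j)) := measureReal_ball_pos' x hr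
  have hi : IntegrableOn (fun y => |a y - c|) (ball x (R / 5 ^ j)) := integrableOn_ball hu _ _
  have h2 : K * volume.real (ball x (R / 5 ^ j)) < ∫ y in ball x (R / 5 ^ j), |a y - c| := by
    simp only [measureReal_restrict_apply_univ, smul_eq_mul] at hj
    rwa [← div_eq_inv_mul, lt_div_iff₀ hv] at hj
  have h3 : ∫⁻ y in ball x (R / 5 ^ j), ‖a y - c‖ₑ
      = ENNReal.ofReal (∫ y in ball x (R / 5 ^ j), |a y - c|) := by
    rw [ofReal_integral_eq_lintegral_ofReal hi (Eventually.of_forall fun y => abs_nonneg _)]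
    simp_rw [← Real.norm_eq_abs, ofReal_norm]
  rw [h3, ← ofReal_measureReal measure_ball_lt_top.ne]
  rw [← ENNReal.ofReal_mul' measureReal_nonneg]
  exact (ENNReal.ofReal_lt_ofReal_iff_of_nonneg (by positivity)).2 h2

/-- `a` is locally integrable with mean oscillation at most `N` on every ball. -/
def HasOscLE (n : ℕ) (a : Eucl n → ℝ) (N : ℝ) : Prop :=
  LocallyIntegrable a ∧ ∀ (x : Eucl n) (r : ℝ), 0 < r →
    ∫⁻ y in ball x r, ‖a y - ballAvg n a x r‖ₑ ≤ ENNReal.ofReal N * volume (ball x r)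

lemma HasOscLE.of_bmoNorm_le {n : ℕ} {a : Eucl n → ℝ} {N : ℝ} (ha : LocallyIntegrable a)
    (h : bmoNorm n a ≤ ENNReal.ofReal N) : HasOscLE n a N := by
  refine ⟨ha, fun x r hr => ?_⟩
  have h1 : (volume (ball x r))⁻¹ * ∫⁻ y in ball x r, ENNReal.ofReal |a y - ballAvg n a x r|
      ≤ ENNReal.ofReal N :=
    le_trans (le_iSup_of_le x (le_iSup_of_le r (by rw [iSup_pos hr]))) h
  simp_rw [← Real.norm_eq_abs, ofReal_norm] at h1
  rw [mul_comm, ← div_eq_mul_inv, ENNReal.div_le_iff (volume_ball_ne_zero x hr)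
    measure_ball_lt_top.ne] at h1
  exact h1

/-- Increment of the level in the exponential decay of the distribution of oscillations. -/
noncomputable def jnStep (n : ℕ) (N : ℝ) : ℝ := 2 * 5 ^ n * ((1 + 2 ^ n) * 2 ^ n * N)

lemma HasOscLE.lintegral_double_le {n : ℕ} {a : Eucl n → ℝ} {N : ℝ}
    (ha : HasOscLE n a N) (x : Eucl n) {r : ℝ} (hr : 0 < r) :
    ∫⁻ y in ball x (2 * r), ‖a y - ballAvg n a x r‖ₑ ≤
      ENNReal.ofReal ((1 + 2 ^ n) * 2 ^ n * N) * volume (ball x r) := by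
  set c := ballAvg n a x r
  set c2 := ballAvg n a x (2 * r)
  have hV : volume (ball x (2 * r)) = ENNReal.ofReal (2 ^ n) * volume (ball x r) :=
    volume_ball_mul x x hr two_pos
  have h0 : ∫⁻ y in ball x (2 * r), ‖a y - c2‖ₑ
      ≤ ENNReal.ofReal N * (ENNReal.ofReal (2 ^ n) * volume (ball x r)) := by
    rw [← hV]; exact ha.2 x (2 * r) (by positivity)
  have h1 : ‖c2 - c‖ₑ * volume (ball x r)
      ≤ ENNReal.ofReal N * (ENNReal.ofReal (2 ^ n) * volume (ball x r)) := by
    rw [enorm_sub_rev]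
    refine (enorm_ballAvg_sub_le ha.1 x hr c2).trans (le_trans ?_ h0)
    exact lintegral_mono_set (ball_subset_ball (by linarith))
  calc ∫⁻ y in ball x (2 * r), ‖a y - c‖ₑ
      ≤ ∫⁻ y in ball x (2 * r), (‖a y - c2‖ₑ + ‖c2 - c‖ₑ) := by
        refine lintegral_mono fun y => ?_
        rw [← sub_add_sub_cancel (a y) c2 c]
        exact enorm_add_le _ _
    _ = (∫⁻ y in ball x (2 * r), ‖a y - c2‖ₑ)
          + ENNReal.ofReal (2 ^ n) * (‖c2 - c‖ₑ * volume (ball x r)) := by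
        rw [lintegral_add_right _ measurable_const, setLIntegral_const, hV]; ring
    _ ≤ ENNReal.ofReal N * (ENNReal.ofReal (2 ^ n) * volume (ball x r)) + ENNReal.ofReal (2 ^ n) *
          (ENNReal.ofReal N * (ENNReal.ofReal (2 ^ n) * volume (ball x r))) := by gcongr
    _ = _ := by
        rw [ENNReal.ofReal_mul (by positivity), ENNReal.ofReal_mul (by positivity),
          ENNReal.ofReal_add (by positivity) (by positivity), ENNReal.ofReal_one]
        ring

lemma HasOscLE.measure_step {n : ℕ} {a : Eucl n → ℝ} {N : ℝ} (hN : 0 < N)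
    (ha : HasOscLE n a N) {θ : ℝ≥0∞} {t : ℝ} (ht : 0 ≤ t)
    (h : ∀ (x : Eucl n) (r : ℝ), 0 < r →
      volume {y ∈ ball x r | t < |a y - ballAvg n a x r|} ≤ θ * volume (ball x r))
    (x₀ : Eucl n) {R : ℝ} (hR : 0 < R) :
    volume {y ∈ ball x₀ R | t + jnStep n N < |a y - ballAvg n a x₀ R|}
      ≤ θ / 2 * volume (ball x₀ R) := by
  set c := ballAvg n a x₀ R with hc
  set K := jnStep n N with hK
  set D : ℝ := (1 + 2 ^ n) * 2 ^ n * N with hD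
  have hD0 : 0 < D := by rw [hD]; positivity
  have hKD : K = 2 * 5 ^ n * D := rfl
  have hK0 : 0 < K := by rw [hKD]; exact mul_pos (by positivity) hD0
  have hKD' : D ≤ K := by
    rw [hKD]
    have : (1 : ℝ) ≤ 5 ^ n := one_le_pow₀ (by norm_num)
    nlinarith
  have hdouble := ha.lintegral_double_le x₀ hR
  rw [← hc, ← hD] at hdouble
  -- points with a stopping radius
  let T : Set (Eucl n) := {y ∈ ball x₀ R | t + K < |a y - c| ∧
    ∃ j : ℕ, ENNReal.ofReal K * volume (ball y (R / 5 ^ j)) <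
      ∫⁻ z in ball y (R / 5 ^ j), ‖a z - c‖ₑ}
  have hT : volume {y ∈ ball x₀ R | t + K < |a y - c|} ≤ volume T := by
    refine measure_mono_ae ?_
    filter_upwards [exists_small_ball_average_gt ha.1 c hK0.le hR] with y hy hy2
    exact ⟨hy2.1, hy2.2, hy (by have := hy2.2; linarith)⟩
  have hsub : ∀ y ∈ ball x₀ R, ∀ ρ ≤ R, ball y ρ ⊆ ball x₀ (2 * R) := fun y hy ρ hρ =>
    ball_subset_ball' (by rw [mem_ball] at hy; linarith)
  have hrad : ∀ y ∈ T, ∃ ρ : ℝ, 0 < ρ ∧ ρ ≤ R ∧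
      ENNReal.ofReal K * volume (ball y ρ) ≤ ∫⁻ z in ball y ρ, ‖a z - c‖ₑ ∧
      ∫⁻ z in ball y (5 * ρ), ‖a z - c‖ₑ ≤ ENNReal.ofReal K * volume (ball y (5 * ρ)) := by
    classical
    rintro y ⟨hy, -, hj⟩
    have h1 := Nat.find_spec hj
    have h2 := fun m => Nat.find_min hj (m := m)
    set j := Nat.find hj
    have hj0 : j ≠ 0 := by
      intro h0
      rw [h0] at h1
      simp only [pow_zero, div_one] at h1
      refine absurd h1 (not_lt.2 ?_)
      refine (lintegral_mono_set (hsub y hy R le_rfl)).trans (hdouble.trans ?_)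
      rw [volume_ball_eq y hR, volume_ball_eq x₀ hR]
      gcongr
    obtain ⟨i, hi⟩ := Nat.exists_eq_succ_of_ne_zero hj0
    refine ⟨R / 5 ^ j, by positivity, div_le_self hR.le (one_le_pow₀ (by norm_num)), h1.le, ?_⟩
    have h3 := h2 i (by omega)
    have h5 : 5 * (R / 5 ^ j) = R / 5 ^ i := by rw [hi, pow_succ]; field_simp
    rw [h5]
    exact not_lt.1 h3
  choose! ρ hρ0 hρR hρ1 hρ2 using hrad
  obtain ⟨u, huT, hdisj, hcov⟩ := Vitali.exists_disjoint_subfamily_covering_enlargement_ball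
    T id ρ R hρR 5 (by norm_num)
  have hucount : u.Countable := hdisj.countable_of_isOpen (fun _ _ => isOpen_ball)
    fun y hy => ⟨y, mem_ball_self (hρ0 y (huT hy))⟩
  have hcover : T ⊆ ⋃ b ∈ u, {y ∈ ball b (5 * ρ b) | t < |a y - ballAvg n a b (5 * ρ b)|} := by
    intro y hy
    obtain ⟨b, hb, hyb⟩ := hcov y hy
    have hρb := hρ0 b (huT hb)
    refine Set.mem_iUnion₂.2 ⟨b, hb, hyb (mem_ball_self (hρ0 y hy)), ?_⟩
    have h1 : ‖ballAvg n a b (5 * ρ b) - c‖ₑ ≤ ENNReal.ofReal K := by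
      have h2 := (enorm_ballAvg_sub_le ha.1 b (r := 5 * ρ b) (by positivity) c).trans
        (hρ2 b (huT hb))
      exact (ENNReal.mul_le_mul_iff_left (volume_ball_ne_zero b (by positivity))
        measure_ball_lt_top.ne).1 h2
    rw [← ofReal_norm, ENNReal.ofReal_le_ofReal_iff hK0.le, Real.norm_eq_abs] at h1
    have h3 := abs_sub_le (a y) (ballAvg n a b (5 * ρ b)) c
    have h4 := hy.2.1
    linarith
  have hKe : ENNReal.ofReal K ≠ 0 := by simpa using hK0
  have hsum : ENNReal.ofReal K * ∑' b : u, volume (ball (b : Eucl n) (ρ b))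
      ≤ ENNReal.ofReal D * volume (ball x₀ R) := by
    have : Countable u := hucount.to_subtype
    calc ENNReal.ofReal K * ∑' b : u, volume (ball (b : Eucl n) (ρ b))
        = ∑' b : u, ENNReal.ofReal K * volume (ball (b : Eucl n) (ρ b)) := ENNReal.tsum_mul_left.symm
      _ ≤ ∑' b : u, ∫⁻ z in ball (b : Eucl n) (ρ b), ‖a z - c‖ₑ :=
        ENNReal.tsum_le_tsum fun b => hρ1 b (huT b.2)
      _ = ∫⁻ z in ⋃ b ∈ u, ball b (ρ b), ‖a z - c‖ₑ :=
        (lintegral_biUnion hucount (fun _ _ => measurableSet_ball) hdisj _).symm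
      _ ≤ ∫⁻ z in ball x₀ (2 * R), ‖a z - c‖ₑ :=
        lintegral_mono_set (Set.iUnion₂_subset fun b hb => hsub b (huT hb).1 _ (hρR b (huT hb)))
      _ ≤ _ := hdouble
  have : Countable u := hucount.to_subtype
  calc volume {y ∈ ball x₀ R | t + K < |a y - c|} ≤ volume T := hT
    _ ≤ volume (⋃ b ∈ u, {y ∈ ball b (5 * ρ b) | t < |a y - ballAvg n a b (5 * ρ b)|}) :=
      measure_mono hcover
    _ ≤ ∑' b : u, volume {y ∈ ball (b : Eucl n) (5 * ρ b) |
          t < |a y - ballAvg n a b (5 * ρ b)|} := measure_biUnion_le _ hucount _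
    _ ≤ ∑' b : u, θ * (ENNReal.ofReal (5 ^ n) * volume (ball (b : Eucl n) (ρ b))) := by
      refine ENNReal.tsum_le_tsum fun b => ?_
      have hρb := hρ0 b (huT b.2)
      rw [← volume_ball_mul (b : Eucl n) b hρb (by norm_num)]
      exact h b _ (by positivity)
    _ = θ * ENNReal.ofReal (5 ^ n) * ∑' b : u, volume (ball (b : Eucl n) (ρ b)) := by
      rw [← ENNReal.tsum_mul_left]; simp_rw [mul_assoc]
    _ ≤ θ * ENNReal.ofReal (5 ^ n) *
          ((ENNReal.ofReal K)⁻¹ * (ENNReal.ofReal D * volume (ball x₀ R))) := by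
      gcongr
      rw [mul_comm _⁻¹, ← div_eq_mul_inv, ENNReal.le_div_iff_mul_le (Or.inl hKe) (Or.inl ofReal_ne_top), mul_comm]
      exact hsum
    _ = θ / 2 * volume (ball x₀ R) := by
      rw [← ENNReal.ofReal_inv_of_pos hK0]
      have : ENNReal.ofReal (5 ^ n) * (ENNReal.ofReal K⁻¹ * ENNReal.ofReal D) = 2⁻¹ := by
        rw [← ENNReal.ofReal_mul (by positivity), ← ENNReal.ofReal_mul (by positivity)]
        have : (5 : ℝ) ^ n * (K⁻¹ * D) = 2⁻¹ := by rw [hKD]; field_simp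
        rw [this, ENNReal.ofReal_inv_of_pos two_pos]; simp
      rw [div_eq_mul_inv, ← this]; ring

lemma HasOscLE.measure_gt_le {n : ℕ} {a : Eucl n → ℝ} {N : ℝ} (hN : 0 < N)
    (ha : HasOscLE n a N) (j : ℕ) (x : Eucl n) {r : ℝ} (hr : 0 < r) :
    volume {y ∈ ball x r | j * jnStep n N < |a y - ballAvg n a x r|}
      ≤ 2⁻¹ ^ j * volume (ball x r) := by
  induction j generalizing x r with
  | zero => rw [pow_zero, one_mul]; exact measure_mono (Set.sep_subset _ _)
  | succ j ih =>
    have hK : 0 ≤ jnStep n N := by unfold jnStep; positivity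
    have := ha.measure_step hN (t := j * jnStep n N) (by positivity) (fun x r hr => ih x hr) x hr
    have e : ((j + 1 : ℕ) : ℝ) * jnStep n N = j * jnStep n N + jnStep n N := by push_cast; ring
    rw [pow_succ, ← div_eq_mul_inv, e]
    exact this

/-- **John–Nirenberg**: all moments of the oscillation are controlled by the mean oscillation. -/
lemma exists_lintegral_osc_pow_le (n L : ℕ) (hL : L ≠ 0) : ∃ C : ℝ, 0 < C ∧ ∀ (a : Eucl n → ℝ) (N : ℝ),
    0 < N → HasOscLE n a N → ∀ (x : Eucl n) (r : ℝ), 0 < r →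
      ∫⁻ y in ball x r, ‖a y - ballAvg n a x r‖ₑ ^ L ≤
        ENNReal.ofReal (C * N ^ L) * volume (ball x r) := by
  have hs : Summable fun j : ℕ => ((j : ℝ) + 1) ^ L * (2⁻¹) ^ j := by
    have h := (summable_nat_add_iff 1).2
      (summable_pow_mul_geometric_of_norm_lt_one (R := ℝ) L (r := 2⁻¹) (by norm_num))
    refine (h.mul_left 2).congr fun j => ?_
    push_cast; rw [pow_succ (2⁻¹ : ℝ)]; ring
  set A := ∑' j : ℕ, ((j : ℝ) + 1) ^ L * (2⁻¹) ^ j with hA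
  have hA0 : 0 ≤ A := tsum_nonneg fun j => by positivity
  have hs1 : 0 < jnStep n 1 := by unfold jnStep; positivity
  refine ⟨jnStep n 1 ^ L * (A + 1), by positivity, fun a N hN ha x r hr => ?_⟩
  set K := jnStep n N with hK
  have hK1 : K = jnStep n 1 * N := by simp only [hK, jnStep]; ring
  have hK0 : 0 < K := by rw [hK1]; positivity
  set c := ballAvg n a x r
  have hm : AEMeasurable (fun y => |a y - c|) (volume : Measure (Eucl n)) :=
    (ha.1.aestronglyMeasurable.aemeasurable.sub_const c).norm
  have hpt : ∀ y, ‖a y - c‖ₑ ^ L ≤ ∑' j : ℕ, {y | j * K < |a y - c|}.indicator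
      (fun _ => ENNReal.ofReal (((j + 1) * K) ^ L)) y := by
    intro y
    rcases eq_or_ne (a y - c) 0 with h0 | h0
    · simp [h0, hL]
    have hpos : 0 < |a y - c| := abs_pos.2 h0
    obtain ⟨i, hi⟩ : ∃ i : ℕ, ⌈|a y - c| / K⌉₊ = i + 1 :=
      Nat.exists_eq_succ_of_ne_zero (Nat.ceil_pos.2 (by positivity)).ne'
    have h1 : (i : ℝ) * K < |a y - c| := by
      rw [← lt_div_iff₀ hK0]; exact Nat.lt_ceil.1 (by omega)
    have h2 : |a y - c| ≤ (i + 1) * K := by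
      rw [← div_le_iff₀ hK0]
      have := Nat.le_ceil (|a y - c| / K)
      rw [hi] at this; exact_mod_cast this
    refine le_trans ?_ (ENNReal.le_tsum i)
    rw [Set.indicator_of_mem (by exact h1), ← ofReal_norm, ← ENNReal.ofReal_pow (norm_nonneg _),
      Real.norm_eq_abs]
    gcongr
  calc ∫⁻ y in ball x r, ‖a y - c‖ₑ ^ L
      ≤ ∫⁻ y in ball x r, ∑' j : ℕ, {y | j * K < |a y - c|}.indicator
          (fun _ => ENNReal.ofReal (((j + 1) * K) ^ L)) y := lintegral_mono hpt
    _ = ∑' j : ℕ, ∫⁻ y in ball x r, {y | j * K < |a y - c|}.indicator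
          (fun _ => ENNReal.ofReal (((j + 1) * K) ^ L)) y := by
        refine lintegral_tsum fun j => ?_
        have := nullMeasurableSet_lt (aemeasurable_const (b := (j * K : ℝ))) hm
        exact (aemeasurable_const.indicator₀ this).restrict
    _ ≤ ∑' j : ℕ, ENNReal.ofReal (((j + 1) * K) ^ L) * (2⁻¹ ^ j * volume (ball x r)) := by
        refine ENNReal.tsum_le_tsum fun j => ?_
        have := nullMeasurableSet_lt (aemeasurable_const (b := (j * K : ℝ))) hm
        rw [lintegral_indicator₀ (this.mono_ac Measure.restrict_le_self.absolutelyContinuous), setLIntegral_const]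
        gcongr
        refine le_trans (le_of_eq ?_) (ha.measure_gt_le hN j x hr)
        rw [Measure.restrict_apply' measurableSet_ball]
        congr 1; ext y; exact and_comm
    _ = ENNReal.ofReal (K ^ L * A) * volume (ball x r) := by
        have : ∀ j : ℕ, ENNReal.ofReal (((j + 1) * K) ^ L) * (2⁻¹ ^ j * volume (ball x r)) =
            ENNReal.ofReal (K ^ L * (((j : ℝ) + 1) ^ L * (2⁻¹) ^ j)) * volume (ball x r) := by
          intro j
          rw [← mul_assoc]; congr 1
          rw [show (2⁻¹ : ℝ≥0∞) ^ j = ENNReal.ofReal (2⁻¹ ^ j) by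
            rw [ENNReal.ofReal_pow (by norm_num), ENNReal.ofReal_inv_of_pos two_pos]; simp,
            ← ENNReal.ofReal_mul (by positivity)]
          congr 1; rw [mul_pow]; ring
        simp_rw [this]
        rw [ENNReal.tsum_mul_right, ← ENNReal.ofReal_tsum_of_nonneg (fun j => by positivity)
          (hs.mul_left _), tsum_mul_left]
    _ ≤ _ := by
        rw [hK1]
        refine mul_le_mul_left (ENNReal.ofReal_le_ofReal ?_) _
        rw [mul_pow]
        nlinarith [mul_pos (pow_pos hs1 L) (pow_pos hN L)]

/-! ### Elementary power integrals -/

lemma lintegral_Ioo_rpow {b Y : ℝ} (hb : 0 < b) (hY : 0 ≤ Y) :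
    ∫⁻ t in Set.Ioo 0 Y, ENNReal.ofReal (t ^ (b - 1)) = ENNReal.ofReal (Y ^ b / b) := by
  have hi : IntervalIntegrable (fun t : ℝ => t ^ (b - 1)) volume 0 Y :=
    intervalIntegral.intervalIntegrable_rpow' (by linarith)
  rw [intervalIntegrable_iff_integrableOn_Ioo_of_le hY] at hi
  rw [← ofReal_integral_eq_lintegral_ofReal hi, ← integral_Ioc_eq_integral_Ioo,
    ← intervalIntegral.integral_of_le hY, integral_rpow (Or.inl (by linarith))]
  · simp [Real.zero_rpow hb.ne']
  · filter_upwards [ae_restrict_mem measurableSet_Ioo] with t ht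
    exact Real.rpow_nonneg ht.1.le _

lemma lintegral_Ioi_rpow {b c : ℝ} (hb : 0 < b) (hc : 0 < c) :
    ∫⁻ t in Set.Ioi c, ENNReal.ofReal (t ^ (-b - 1)) = ENNReal.ofReal (c ^ (-b) / b) := by
  have hi := integrableOn_Ioi_rpow_of_lt (a := -b - 1) (by linarith) hc
  rw [← ofReal_integral_eq_lintegral_ofReal hi, integral_Ioi_rpow_of_lt (by linarith) hc]
  · congr 1
    rw [sub_add_cancel, neg_div_neg_eq]
  · filter_upwards [ae_restrict_mem measurableSet_Ioi] with t ht
    exact Real.rpow_nonneg (hc.trans ht).le _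

lemma lintegral_rpow_indicator_lt {b : ℝ} (hb : 0 < b) (y : ℝ≥0∞) :
    ∫⁻ t in Set.Ioi (0 : ℝ), {t : ℝ | ENNReal.ofReal t < y}.indicator
      (fun t => ENNReal.ofReal (t ^ (b - 1))) t = y ^ b / ENNReal.ofReal b := by
  have key : ∀ Y : ℝ, 0 ≤ Y → ∫⁻ t in Set.Ioi (0 : ℝ),
      {t : ℝ | ENNReal.ofReal t < ENNReal.ofReal Y}.indicator
        (fun t => ENNReal.ofReal (t ^ (b - 1))) t = ENNReal.ofReal Y ^ b / ENNReal.ofReal b := by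
    intro Y hY
    have h1 : ∀ t ∈ Set.Ioi (0 : ℝ), {t : ℝ | ENNReal.ofReal t < ENNReal.ofReal Y}.indicator
        (fun t => ENNReal.ofReal (t ^ (b - 1))) t
        = (Set.Ioo 0 Y).indicator (fun t => ENNReal.ofReal (t ^ (b - 1))) t := by
      intro t ht
      have : t ∈ {t : ℝ | ENNReal.ofReal t < ENNReal.ofReal Y} ↔ t ∈ Set.Ioo 0 Y := by
        simp only [Set.mem_ofPred_eq, Set.mem_Ioo]
        rw [ENNReal.ofReal_lt_ofReal_iff_of_nonneg (le_of_lt ht)]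
        exact ⟨fun h => ⟨ht, h⟩, fun h => h.2⟩
      by_cases h : t ∈ Set.Ioo 0 Y
      · rw [Set.indicator_of_mem h, Set.indicator_of_mem (this.2 h)]
      · rw [Set.indicator_of_notMem h, Set.indicator_of_notMem (fun h' => h (this.1 h'))]
    rw [setLIntegral_congr_fun measurableSet_Ioi h1, lintegral_indicator measurableSet_Ioo,
      Measure.restrict_restrict measurableSet_Ioo, Set.inter_eq_left.2 Set.Ioo_subset_Ioi_self,
      lintegral_Ioo_rpow hb hY, ENNReal.ofReal_div_of_pos hb, ENNReal.ofReal_rpow_of_nonneg hY hb.le]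
  rcases eq_or_ne y ⊤ with rfl | hy
  · rw [ENNReal.top_rpow_of_pos hb, ENNReal.top_div_of_ne_top ofReal_ne_top, eq_top_iff]
    refine le_of_tendsto' (f := fun m : ℕ => ENNReal.ofReal (m : ℝ) ^ b / ENNReal.ofReal b)
      (x := atTop) ?_ fun m => ?_
    · have h1 : Tendsto (fun m : ℕ => ENNReal.ofReal (m : ℝ)) atTop (𝓝 ⊤) :=
        ENNReal.tendsto_ofReal_atTop.comp tendsto_natCast_atTop_atTop
      have h2 := (ENNReal.continuous_rpow_const (y := b)).tendsto ⊤ |>.comp h1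
      rw [ENNReal.top_rpow_of_pos hb] at h2
      have h3 := ENNReal.Tendsto.div_const (b := ENNReal.ofReal b) h2 (Or.inl (by simp))
      rwa [ENNReal.top_div_of_ne_top ofReal_ne_top] at h3
    · rw [← key m (by positivity)]
      refine lintegral_mono fun t => Set.indicator_le_indicator_of_subset ?_ (fun _ => zero_le) t
      intro t _
      exact ofReal_lt_top
  · have := key y.toReal toReal_nonneg
    rwa [ENNReal.ofReal_toReal hy] at this

/-! ### The Hardy–Littlewood maximal function -/

/-- The Hardy–Littlewood maximal function over centred balls of dyadic radius. -/
noncomputable def maxFn {n : ℕ} (g : Eucl n → ℝ≥0∞) (x : Eucl n) : ℝ≥0∞ :=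
  ⨆ k : ℤ, (volume (ball x (2 ^ k)))⁻¹ * ∫⁻ y in ball x (2 ^ k), g y

lemma measurable_lintegral_ball {n : ℕ} {g : Eucl n → ℝ≥0∞} (hg : Measurable g) (r : ℝ) :
    Measurable fun x => ∫⁻ y in ball x r, g y := by
  have hS : MeasurableSet {z : Eucl n × Eucl n | dist z.2 z.1 < r} :=
    measurableSet_lt (by fun_prop) (by fun_prop)
  have h := ((hg.comp measurable_snd).indicator hS).lintegral_prod_right' (ν := volume)
  convert h using 2 with x
  rw [← lintegral_indicator measurableSet_ball]
  rfl

lemma measurable_maxFn {n : ℕ} {g : Eucl n → ℝ≥0∞} (hg : Measurable g) : Measurable (maxFn g) := by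
  refine Measurable.iSup fun k => ?_
  have : ∀ x : Eucl n, volume (ball x ((2 : ℝ) ^ k)) = volume (ball (0 : Eucl n) (2 ^ k)) := fun x => by
    rw [volume_ball_eq x (by positivity), volume_ball_eq 0 (by positivity)]
  simp_rw [this]
  exact (measurable_lintegral_ball hg _).const_mul _

lemma lintegral_ball_le_maxFn {n : ℕ} (g : Eucl n → ℝ≥0∞) (x : Eucl n) {r : ℝ} (hr : 0 < r) :
    ∫⁻ y in ball x r, g y ≤ ENNReal.ofReal (2 ^ n) * volume (ball x r) * maxFn g x := by
  obtain ⟨k, hk1, hk2⟩ := exists_mem_Ico_zpow hr one_lt_two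
  have h2 : (0 : ℝ) < 2 ^ (k + 1) := by positivity
  have h1 : (volume (ball x (2 ^ (k + 1))))⁻¹ * ∫⁻ y in ball x (2 ^ (k + 1)), g y ≤ maxFn g x :=
    le_iSup (fun k : ℤ => (volume (ball x (2 ^ k)))⁻¹ * ∫⁻ y in ball x (2 ^ k), g y) (k + 1)
  rw [mul_comm, ← div_eq_mul_inv, ENNReal.div_le_iff (volume_ball_ne_zero x h2)
    measure_ball_lt_top.ne] at h1
  calc ∫⁻ y in ball x r, g y ≤ ∫⁻ y in ball x (2 ^ (k + 1)), g y :=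
        lintegral_mono_set (ball_subset_ball hk2.le)
    _ ≤ maxFn g x * volume (ball x (2 ^ (k + 1))) := h1
    _ ≤ maxFn g x * volume (ball x (2 * r)) := by
        gcongr
        rw [zpow_add_one₀ two_ne_zero, mul_comm]; gcongr
    _ = _ := by rw [volume_ball_mul x x hr two_pos, mul_comm]

lemma maxFn_weak {n : ℕ} (g : Eucl n → ℝ≥0∞) (t : ℝ≥0∞) :
    t * volume {x | t < maxFn g x} ≤ ENNReal.ofReal (5 ^ n) * ∫⁻ y, g y := by
  let S : ℕ → Set (Eucl n) := fun m => {x | ∃ k : ℤ, k ≤ m ∧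
    t < (volume (ball x (2 ^ k)))⁻¹ * ∫⁻ y in ball x (2 ^ k), g y}
  have hS : {x | t < maxFn g x} = ⋃ m, S m := by
    ext x
    simp only [Set.mem_ofPred_eq, maxFn, lt_iSup_iff, Set.mem_iUnion, S]
    constructor
    · rintro ⟨k, hk⟩
      exact ⟨k.toNat, k, Int.self_le_toNat k, hk⟩
    · rintro ⟨m, k, -, hk⟩
      exact ⟨k, hk⟩
  have hmono : Monotone S := by
    rintro i j hij x ⟨k, hk, h⟩
    exact ⟨k, hk.trans (by exact_mod_cast hij), h⟩
  rw [hS, hmono.measure_iUnion, ENNReal.mul_iSup]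
  refine iSup_le fun m => ?_
  have hex : ∀ x ∈ S m, ∃ r : ℝ, 0 < r ∧ r ≤ 2 ^ m ∧
      t * volume (ball x r) ≤ ∫⁻ y in ball x r, g y := by
    rintro x ⟨k, hk, h⟩
    refine ⟨2 ^ k, by positivity, ?_, ?_⟩
    · rw [← zpow_natCast]; exact zpow_le_zpow_right₀ one_le_two hk
    · rw [mul_comm _⁻¹, ← div_eq_mul_inv] at h
      exact (ENNReal.le_div_iff_mul_le (Or.inl (volume_ball_ne_zero x (by positivity)))
        (Or.inl measure_ball_lt_top.ne)).1 h.le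
  choose! r hr0 hrR hr using hex
  obtain ⟨u, huT, hdisj, hcov⟩ := Vitali.exists_disjoint_subfamily_covering_enlargement_ball
    (S m) id r (2 ^ m) hrR 5 (by norm_num)
  have hucount : u.Countable := hdisj.countable_of_isOpen (fun _ _ => isOpen_ball)
    fun y hy => ⟨y, mem_ball_self (hr0 y (huT hy))⟩
  have : Countable u := hucount.to_subtype
  calc t * volume (S m) ≤ t * volume (⋃ b ∈ u, ball b (5 * r b)) := by
        gcongr
        intro y hy
        obtain ⟨b, hb, hyb⟩ := hcov y hy
        exact Set.mem_iUnion₂.2 ⟨b, hb, hyb (mem_ball_self (hr0 y hy))⟩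
    _ ≤ t * ∑' b : u, volume (ball (b : Eucl n) (5 * r b)) := by
        gcongr; exact measure_biUnion_le _ hucount _
    _ = ENNReal.ofReal (5 ^ n) * ∑' b : u, t * volume (ball (b : Eucl n) (r b)) := by
        rw [← ENNReal.tsum_mul_left, ← ENNReal.tsum_mul_left]
        refine tsum_congr fun b => ?_
        rw [volume_ball_mul (b : Eucl n) b (hr0 b (huT b.2)) (by norm_num)]; ring
    _ ≤ ENNReal.ofReal (5 ^ n) * ∑' b : u, ∫⁻ y in ball (b : Eucl n) (r b), g y := by
        gcongr with b; exact hr b (huT b.2)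
    _ = ENNReal.ofReal (5 ^ n) * ∫⁻ y in ⋃ b ∈ u, ball b (r b), g y := by
        exact congrArg _ (lintegral_biUnion hucount (fun _ _ => measurableSet_ball) hdisj _).symm
    _ ≤ _ := by gcongr; exact Measure.restrict_le_self

lemma maxFn_le_add {n : ℕ} (g : Eucl n → ℝ≥0∞) (s : ℝ≥0∞) (x : Eucl n) :
    maxFn g x ≤ maxFn ({y | s < g y}.indicator g) x + s := by
  refine iSup_le fun k => ?_
  have hk : (0 : ℝ) < 2 ^ k := by positivity
  calc (volume (ball x (2 ^ k)))⁻¹ * ∫⁻ y in ball x (2 ^ k), g y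
      ≤ (volume (ball x (2 ^ k)))⁻¹ *
          ∫⁻ y in ball x (2 ^ k), ({y | s < g y}.indicator g y + s) := by
        gcongr with y
        by_cases h : s < g y
        · rw [Set.indicator_of_mem (by exact h)]; exact le_self_add
        · exact (not_lt.1 h).trans le_add_self
    _ = (volume (ball x (2 ^ k)))⁻¹ * (∫⁻ y in ball x (2 ^ k), {y | s < g y}.indicator g y) + s := by
        rw [lintegral_add_right _ measurable_const, setLIntegral_const, mul_add, mul_comm s,
          ← mul_assoc, ENNReal.inv_mul_cancel (volume_ball_ne_zero x hk) measure_ball_lt_top.ne,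
          one_mul]
    _ ≤ _ := by
        gcongr
        exact le_iSup (fun k : ℤ => (volume (ball x (2 ^ k)))⁻¹ *
          ∫⁻ y in ball x (2 ^ k), {y | s < g y}.indicator g y) k

/-- The **Hardy–Littlewood maximal inequality** in `L^p`, `p > 1`. -/
lemma exists_lintegral_maxFn_rpow_le (n : ℕ) {p : ℝ} (hp : 1 < p) : ∃ C : ℝ, 0 < C ∧
    ∀ g : Eucl n → ℝ≥0∞, Measurable g →
      ∫⁻ x, maxFn g x ^ p ≤ ENNReal.ofReal C * ∫⁻ x, g x ^ p := by
  refine ⟨p * (2 * 5 ^ n) * 2 ^ (p - 1) / (p - 1), ?_, fun g hg => ?_⟩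
  · have : 0 < p - 1 := by linarith
    positivity
  have hp0 : 0 < p := by linarith
  have hp1 : 0 < p - 1 := by linarith
  have hpe : ENNReal.ofReal p ≠ 0 := by simpa using hp0
  have hm := measurable_maxFn hg
  have hmeas1 : Measurable fun z : Eucl n × ℝ => {t : ℝ | ENNReal.ofReal t < maxFn g z.1}.indicator
      (fun t => ENNReal.ofReal (t ^ (p - 1))) z.2 := by
    have : MeasurableSet {z : Eucl n × ℝ | ENNReal.ofReal z.2 < maxFn g z.1} :=
      measurableSet_lt (by fun_prop) (hm.comp measurable_fst)
    exact (show Measurable fun z : Eucl n × ℝ => ENNReal.ofReal (z.2 ^ (p - 1)) by fun_prop).indicator this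
  have hmeas2 : Measurable fun z : ℝ × Eucl n => {t : ℝ | ENNReal.ofReal t < 2 * g z.2}.indicator
      (fun t => ENNReal.ofReal (t ^ (p - 1 - 1))) z.1 := by
    have : MeasurableSet {z : ℝ × Eucl n | ENNReal.ofReal z.1 < 2 * g z.2} :=
      measurableSet_lt (by fun_prop) (by fun_prop)
    exact (show Measurable fun z : ℝ × Eucl n => ENNReal.ofReal (z.1 ^ (p - 1 - 1)) by fun_prop).indicator this
  have hlevel : ∀ t ∈ Set.Ioi (0 : ℝ), ENNReal.ofReal (t ^ (p - 1)) *
      volume {x | ENNReal.ofReal t < maxFn g x} ≤ ENNReal.ofReal (2 * 5 ^ n) *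
        ∫⁻ x, g x * {t : ℝ | ENNReal.ofReal t < 2 * g x}.indicator
          (fun t => ENNReal.ofReal (t ^ (p - 1 - 1))) t := by
    intro t ht
    have ht : 0 < t := ht
    set s := ENNReal.ofReal (t / 2) with hs
    have hst : ENNReal.ofReal t = 2 * s := by
      rw [hs, ← ENNReal.ofReal_ofNat, ← ENNReal.ofReal_mul (by norm_num)]; congr 1; ring
    have hsub : {x | ENNReal.ofReal t < maxFn g x} ⊆
        {x | s < maxFn ({y | s < g y}.indicator g) x} := by
      intro x hx
      have h1 := lt_of_lt_of_le (show ENNReal.ofReal t < maxFn g x from hx) (maxFn_le_add g s x)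
      rw [hst, two_mul] at h1
      exact lt_of_add_lt_add_right h1
    have hw := maxFn_weak ({y | s < g y}.indicator g) s
    have hiff : ∀ x, ENNReal.ofReal t < 2 * g x ↔ s < g x := fun x => by
      rw [hst, ENNReal.mul_lt_mul_iff_right two_ne_zero ofNat_ne_top]
    calc ENNReal.ofReal (t ^ (p - 1)) * volume {x | ENNReal.ofReal t < maxFn g x}
        ≤ ENNReal.ofReal (t ^ (p - 1)) * volume {x | s < maxFn ({y | s < g y}.indicator g) x} := by
          gcongr
      _ = ENNReal.ofReal (2 * t ^ (p - 1 - 1)) *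
            (s * volume {x | s < maxFn ({y | s < g y}.indicator g) x}) := by
          rw [← mul_assoc, hs, ← ENNReal.ofReal_mul (by positivity)]
          congr 2
          rw [Real.rpow_sub_one ht.ne' (p - 1)]; field_simp
      _ ≤ ENNReal.ofReal (2 * t ^ (p - 1 - 1)) *
            (ENNReal.ofReal (5 ^ n) * ∫⁻ y, {y | s < g y}.indicator g y) := by gcongr
      _ = ENNReal.ofReal (2 * 5 ^ n) * (ENNReal.ofReal (t ^ (p - 1 - 1)) *
            ∫⁻ y, {y | s < g y}.indicator g y) := by
          rw [← mul_assoc, ← mul_assoc, ← ENNReal.ofReal_mul (by positivity),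
            ← ENNReal.ofReal_mul (by positivity)]
          congr 2; ring
      _ = _ := by
          rw [← lintegral_const_mul _ (hg.indicator (measurableSet_lt measurable_const hg))]
          congr 1
          refine lintegral_congr fun x => ?_
          by_cases h : s < g x
          · rw [Set.indicator_of_mem (by exact h), Set.indicator_of_mem (by exact (hiff x).2 h),
              mul_comm]
          · rw [Set.indicator_of_notMem (by exact h),
              Set.indicator_of_notMem (by exact fun h' => h ((hiff x).1 h'))]; simp
  calc ∫⁻ x, maxFn g x ^ p
      = ∫⁻ x, ENNReal.ofReal p * ∫⁻ t in Set.Ioi (0 : ℝ),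
          {t : ℝ | ENNReal.ofReal t < maxFn g x}.indicator
            (fun t => ENNReal.ofReal (t ^ (p - 1))) t := by
        refine lintegral_congr fun x => ?_
        rw [lintegral_rpow_indicator_lt hp0, ENNReal.mul_div_cancel hpe ofReal_ne_top]
    _ = ENNReal.ofReal p * ∫⁻ t in Set.Ioi (0 : ℝ), ∫⁻ x,
          {t : ℝ | ENNReal.ofReal t < maxFn g x}.indicator
            (fun t => ENNReal.ofReal (t ^ (p - 1))) t := by
        rw [lintegral_const_mul _ (hmeas1.lintegral_prod_right' (ν := volume.restrict (Set.Ioi 0))),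
          lintegral_lintegral_swap hmeas1.aemeasurable]
    _ = ENNReal.ofReal p * ∫⁻ t in Set.Ioi (0 : ℝ), ENNReal.ofReal (t ^ (p - 1)) *
          volume {x | ENNReal.ofReal t < maxFn g x} := by
        congr 1
        refine lintegral_congr fun t => ?_
        rw [← lintegral_indicator_const (measurableSet_lt measurable_const hm)]
        rfl
    _ ≤ ENNReal.ofReal p * ∫⁻ t in Set.Ioi (0 : ℝ), ENNReal.ofReal (2 * 5 ^ n) *
        ∫⁻ x, g x * {t : ℝ | ENNReal.ofReal t < 2 * g x}.indicator
          (fun t => ENNReal.ofReal (t ^ (p - 1 - 1))) t := by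
        gcongr 1
        exact setLIntegral_mono' measurableSet_Ioi hlevel
    _ = ENNReal.ofReal p * (ENNReal.ofReal (2 * 5 ^ n) * ∫⁻ x, g x * ∫⁻ t in Set.Ioi (0 : ℝ),
        {t : ℝ | ENNReal.ofReal t < 2 * g x}.indicator
          (fun t => ENNReal.ofReal (t ^ (p - 1 - 1))) t) := by
        have hm3 : Measurable fun z : ℝ × Eucl n => g z.2 *
            {t : ℝ | ENNReal.ofReal t < 2 * g z.2}.indicator
              (fun t => ENNReal.ofReal (t ^ (p - 1 - 1))) z.1 :=
          (hg.comp measurable_snd).mul hmeas2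
        rw [lintegral_const_mul _ (hm3.lintegral_prod_right' (ν := volume))]
        rw [lintegral_lintegral_swap hm3.aemeasurable]
        congr 2
        refine lintegral_congr fun x => ?_
        have hmx : Measurable fun t : ℝ => {t : ℝ | ENNReal.ofReal t < 2 * g x}.indicator
            (fun t => ENNReal.ofReal (t ^ (p - 1 - 1))) t :=
          hmeas2.comp (measurable_prodMk_right (y := x))
        exact lintegral_const_mul (g x) hmx
    _ = ENNReal.ofReal p * (ENNReal.ofReal (2 * 5 ^ n) *
          ∫⁻ x, ENNReal.ofReal (2 ^ (p - 1) / (p - 1)) * g x ^ p) := by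
        congr 2
        refine lintegral_congr fun x => ?_
        rw [lintegral_rpow_indicator_lt hp1, ENNReal.mul_rpow_of_nonneg _ _ hp1.le,
          ENNReal.ofReal_div_of_pos hp1, ← ENNReal.ofReal_rpow_of_pos two_pos, ENNReal.ofReal_ofNat]
        have : g x ^ p = g x * g x ^ (p - 1) := by
          conv_lhs => rw [show p = 1 + (p - 1) by ring,
            ENNReal.rpow_add_of_nonneg _ _ zero_le_one hp1.le, ENNReal.rpow_one]
        rw [this]; simp only [div_eq_mul_inv]; ring
    _ = _ := by
        rw [lintegral_const_mul _ (hg.pow_const p), ← mul_assoc, ← mul_assoc,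
          ← ENNReal.ofReal_mul (by positivity), ← ENNReal.ofReal_mul (by positivity)]
        congr 2; ring

/-! ### A bilinear form bound for fractional integrals with weights -/

lemma ofReal_rpow_mul_rpow {ρ : ℝ} (hρ : 0 < ρ) (a b : ℝ) :
    ENNReal.ofReal ρ ^ a * ENNReal.ofReal ρ ^ b = ENNReal.ofReal ρ ^ (a + b) :=
  (ENNReal.rpow_add _ _ (by simpa using hρ) ofReal_ne_top).symm

lemma volume_ball_rpow {n : ℕ} (x : Eucl n) {r : ℝ} (hr : 0 < r) (c : ℝ) :
    volume (ball x r) ^ c = ENNReal.ofReal (unitVol n) ^ c * ENNReal.ofReal r ^ (n * c) := by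
  rw [volume_ball_eq x hr, ENNReal.ofReal_mul (unitVol_pos n).le,
    ENNReal.mul_rpow_of_ne_top ofReal_ne_top ofReal_ne_top, ENNReal.rpow_mul,
    ENNReal.rpow_natCast, ← ENNReal.ofReal_pow hr.le]

/-- The set of pairs of points and balls such that the ball contains both points. -/
def pairInBall (n : ℕ) : Set ((Eucl n × Eucl n) × (ℝ × Eucl n)) :=
  {q | dist q.1.1 q.2.2 < q.2.1 ∧ dist q.1.2 q.2.2 < q.2.1}

lemma measurableSet_pairInBall (n : ℕ) : MeasurableSet (pairInBall n) :=
  MeasurableSet.inter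
    (measurableSet_lt (f := fun q : (Eucl n × Eucl n) × (ℝ × Eucl n) => dist q.1.1 q.2.2)
      (g := fun q => q.2.1) (by fun_prop) (by fun_prop))
    (measurableSet_lt (f := fun q : (Eucl n × Eucl n) × (ℝ × Eucl n) => dist q.1.2 q.2.2)
      (g := fun q => q.2.1) (by fun_prop) (by fun_prop))

lemma exists_kernel_le (n : ℕ) {α : ℝ} (hαn : α < n) : ∃ C : ℝ≥0∞, C ≠ ⊤ ∧
    ∀ x y : Eucl n, ENNReal.ofReal (dist x y ^ (α - n)) ≤
      C * ∫⁻ w, ENNReal.ofReal (w.1 ^ (α - 2 * n - 1)) * (pairInBall n).indicator (fun _ => (1 : ℝ≥0∞)) ((x, y), w)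
        ∂((volume.restrict (Set.Ioi (0 : ℝ))).prod (volume : Measure (Eucl n))) := by
  have hb : 0 < (n : ℝ) - α := by linarith
  set c : ℝ := unitVol n * (1 / 2) ^ n * (2 ^ (-(n - α)) / (n - α)) with hc
  have hc0 : 0 < c := by have := unitVol_pos n; positivity
  refine ⟨(ENNReal.ofReal c)⁻¹, by simpa using hc0, fun x y => ?_⟩
  rcases eq_or_ne x y with rfl | hxy
  · rw [dist_self, Real.zero_rpow (by linarith)]; simp
  have hd : 0 < dist x y := dist_pos.2 hxy
  set d := dist x y
  rw [← ENNReal.div_eq_inv_mul, ENNReal.le_div_iff_mul_le (Or.inl (by simpa using hc0))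
    (Or.inl ofReal_ne_top)]
  have hmeas : Measurable fun w : ℝ × Eucl n => ENNReal.ofReal (w.1 ^ (α - 2 * n - 1)) *
      (pairInBall n).indicator (fun _ => (1 : ℝ≥0∞)) ((x, y), w) :=
    (by fun_prop : Measurable fun w : ℝ × Eucl n => ENNReal.ofReal (w.1 ^ (α - 2 * n - 1))).mul
      ((measurable_const.indicator (measurableSet_pairInBall n)).comp measurable_prodMk_left)
  rw [lintegral_prod _ hmeas.aemeasurable]
  calc ENNReal.ofReal (d ^ (α - n)) * ENNReal.ofReal c
      = ENNReal.ofReal (unitVol n * (1 / 2) ^ n) *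
          ∫⁻ ρ in Set.Ioi (2 * d), ENNReal.ofReal (ρ ^ (-(n - α) - 1)) := by
        rw [lintegral_Ioi_rpow hb (by positivity), ← ENNReal.ofReal_mul (by positivity),
          ← ENNReal.ofReal_mul (by have := unitVol_pos n; positivity)]
        congr 1
        rw [hc, Real.mul_rpow two_pos.le hd.le, neg_sub]; ring
    _ = ∫⁻ ρ in Set.Ioi (2 * d), ENNReal.ofReal (unitVol n * (1 / 2) ^ n) *
          ENNReal.ofReal (ρ ^ (-(n - α) - 1)) := by
        rw [lintegral_const_mul _ (by fun_prop)]
    _ ≤ ∫⁻ ρ in Set.Ioi (2 * d), ∫⁻ z, ENNReal.ofReal (ρ ^ (α - 2 * n - 1)) *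
          (pairInBall n).indicator (fun _ => (1 : ℝ≥0∞)) ((x, y), (ρ, z)) := by
        refine setLIntegral_mono' measurableSet_Ioi fun ρ hρ => ?_
        have hρ' : 2 * d < ρ := hρ
        have hρ0 : 0 < ρ := by linarith
        calc ENNReal.ofReal (unitVol n * (1 / 2) ^ n) * ENNReal.ofReal (ρ ^ (-(n - α) - 1))
            = ∫⁻ z in ball x (ρ / 2), ENNReal.ofReal (ρ ^ (α - 2 * n - 1)) := by
              rw [setLIntegral_const, volume_ball_eq x (by positivity),
                ← ENNReal.ofReal_mul (by have := unitVol_pos n; positivity),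
                ← ENNReal.ofReal_mul (by positivity)]
              congr 1
              rw [show α - 2 * n - 1 = -(n - α) - 1 - n by ring, Real.rpow_sub hρ0 _ n,
                Real.rpow_natCast, div_pow, div_pow]
              field_simp
              simp
          _ = ∫⁻ z, (ball x (ρ / 2)).indicator
                (fun _ => ENNReal.ofReal (ρ ^ (α - 2 * n - 1))) z := by
              rw [lintegral_indicator measurableSet_ball]
          _ ≤ _ := by
              refine lintegral_mono fun z => ?_
              by_cases hz : z ∈ ball x (ρ / 2)
              · have h1 : dist x z < ρ / 2 := by rwa [dist_comm]
                have : ((x, y), (ρ, z)) ∈ pairInBall n := by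
                  refine ⟨show dist x z < ρ by linarith, show dist y z < ρ from ?_⟩
                  have := dist_triangle y x z
                  rw [dist_comm y x] at this
                  change dist y z ≤ d + _ at this
                  linarith
                rw [Set.indicator_of_mem hz, Set.indicator_of_mem this]; simp
              · rw [Set.indicator_of_notMem hz]; exact zero_le
    _ ≤ _ := lintegral_mono_set (Set.Ioi_subset_Ioi (by positivity))

lemma exists_lintegral_mul_kernel_le (n : ℕ) {α : ℝ} (hαn : α < n) : ∃ C : ℝ≥0∞, C ≠ ⊤ ∧
    ∀ g : Eucl n × Eucl n → ℝ≥0∞, Measurable g →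
      ∫⁻ x, ∫⁻ y, g (x, y) * ENNReal.ofReal (dist x y ^ (α - n)) ≤
        C * ∫⁻ ρ in Set.Ioi (0 : ℝ), ∫⁻ z : Eucl n, ENNReal.ofReal (ρ ^ (α - 2 * n - 1)) *
          ∫⁻ x in ball z ρ, ∫⁻ y in ball z ρ, g (x, y) := by
  obtain ⟨C, hC, hk⟩ := exists_kernel_le n hαn
  refine ⟨C, hC, fun g hg => ?_⟩
  set ν := (volume.restrict (Set.Ioi (0 : ℝ))).prod (volume : Measure (Eucl n))
  have hE : Measurable ((pairInBall n).indicator (fun _ => (1 : ℝ≥0∞))) :=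
    measurable_const.indicator (measurableSet_pairInBall n)
  have hm : Measurable fun q : (Eucl n × Eucl n) × (ℝ × Eucl n) => g q.1 *
      (ENNReal.ofReal (q.2.1 ^ (α - 2 * n - 1)) * (pairInBall n).indicator (fun _ => (1 : ℝ≥0∞)) q) :=
    (hg.comp measurable_fst).mul
      ((by fun_prop : Measurable fun q : (Eucl n × Eucl n) × (ℝ × Eucl n) =>
        ENNReal.ofReal (q.2.1 ^ (α - 2 * n - 1))).mul hE)
  have hm2 : Measurable fun u : Eucl n × Eucl n =>
      g u * ENNReal.ofReal (dist u.1 u.2 ^ (α - n)) := by fun_prop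
  have hm4 := hm.lintegral_prod_left' (μ := (volume : Measure (Eucl n × Eucl n)))
  calc ∫⁻ x, ∫⁻ y, g (x, y) * ENNReal.ofReal (dist x y ^ (α - n))
      = ∫⁻ u : Eucl n × Eucl n, g u * ENNReal.ofReal (dist u.1 u.2 ^ (α - n)) := by
        rw [Measure.volume_eq_prod, lintegral_prod _ hm2.aemeasurable]
    _ ≤ ∫⁻ u : Eucl n × Eucl n, C * ∫⁻ w, g u * (ENNReal.ofReal (w.1 ^ (α - 2 * n - 1)) *
          (pairInBall n).indicator (fun _ => (1 : ℝ≥0∞)) (u, w)) ∂ν := by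
        refine lintegral_mono fun u => ?_
        have hmu : Measurable fun w : ℝ × Eucl n => ENNReal.ofReal (w.1 ^ (α - 2 * n - 1)) *
            (pairInBall n).indicator (fun _ => (1 : ℝ≥0∞)) (u, w) :=
          (by fun_prop : Measurable fun w : ℝ × Eucl n =>
            ENNReal.ofReal (w.1 ^ (α - 2 * n - 1))).mul (hE.comp measurable_prodMk_left)
        rw [lintegral_const_mul _ hmu]
        calc _ ≤ g u * (C * _) := mul_le_mul_right (hk u.1 u.2) _
          _ = _ := by ring
    _ = C * ∫⁻ w, (∫⁻ u : Eucl n × Eucl n, g u * (ENNReal.ofReal (w.1 ^ (α - 2 * n - 1)) *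
          (pairInBall n).indicator (fun _ => (1 : ℝ≥0∞)) (u, w))) ∂ν := by
        rw [lintegral_const_mul _ (hm.lintegral_prod_right' (ν := ν)),
          lintegral_lintegral_swap hm.aemeasurable]
    _ = C * ∫⁻ ρ in Set.Ioi (0 : ℝ), ∫⁻ z : Eucl n, ∫⁻ u : Eucl n × Eucl n,
          g u * (ENNReal.ofReal (ρ ^ (α - 2 * n - 1)) *
            (pairInBall n).indicator (fun _ => (1 : ℝ≥0∞)) (u, (ρ, z))) := by
        rw [lintegral_prod _ hm4.aemeasurable]
    _ = _ := by
        congr 1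
        refine lintegral_congr fun ρ => lintegral_congr fun z => ?_
        have hind : ∀ u : Eucl n × Eucl n, g u * (ENNReal.ofReal (ρ ^ (α - 2 * n - 1)) *
            (pairInBall n).indicator (fun _ => (1 : ℝ≥0∞)) (u, (ρ, z))) = ENNReal.ofReal (ρ ^ (α - 2 * n - 1)) *
            (ball z ρ ×ˢ ball z ρ).indicator g u := by
          intro u
          by_cases hu : (u, (ρ, z)) ∈ pairInBall n
          · rw [Set.indicator_of_mem hu, Set.indicator_of_mem (show u ∈ ball z ρ ×ˢ ball z ρ from hu),
              mul_one, mul_comm]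
          · rw [Set.indicator_of_notMem hu,
              Set.indicator_of_notMem (show u ∉ ball z ρ ×ˢ ball z ρ from hu)]; simp
        simp_rw [hind]
        rw [lintegral_const_mul _ (hg.indicator (measurableSet_ball.prod measurableSet_ball)),
          lintegral_indicator (measurableSet_ball.prod measurableSet_ball), Measure.volume_eq_prod,
          ← Measure.prod_restrict, lintegral_prod _ hg.aemeasurable]

/-- The Morrey norm of a nonnegative extended function. -/
noncomputable def morreyE (n : ℕ) (p q : ℝ) (g : Eucl n → ℝ≥0∞) : ℝ≥0∞ :=
  ⨆ (x : Eucl n) (r : ℝ) (_ : 0 < r),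
    (volume (ball x r)) ^ (1 / p - 1 / q) * (∫⁻ y in ball x r, g y ^ q) ^ (1 / q)

/-- The `L^q` norm over a ball. -/
noncomputable def ballNorm {n : ℕ} (q : ℝ) (g : Eucl n → ℝ≥0∞) (x : Eucl n) (r : ℝ) : ℝ≥0∞ :=
  (∫⁻ y in ball x r, g y ^ q) ^ (1 / q)

lemma ballNorm_congr {n : ℕ} {q : ℝ} {f g : Eucl n → ℝ≥0∞} {x : Eucl n} {r : ℝ}
    (h : ∀ y ∈ ball x r, f y = g y) : ballNorm q f x r = ballNorm q g x r := by
  unfold ballNorm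
  congr 1
  exact setLIntegral_congr_fun measurableSet_ball fun y hy => by rw [h y hy]

lemma ballNorm_le_of_le {n : ℕ} {r q : ℝ} (hr : 0 < r) (hrq : r ≤ q) {g : Eucl n → ℝ≥0∞}
    (hg : Measurable g) (x : Eucl n) (ρ : ℝ) :
    ballNorm r g x ρ ≤ volume (ball x ρ) ^ (1 / r - 1 / q) * ballNorm q g x ρ := by
  have := eLpNorm'_le_eLpNorm'_mul_rpow_measure_univ (μ := volume.restrict (ball x ρ)) hr hrq
    hg.aestronglyMeasurable
  rw [Measure.restrict_apply_univ, mul_comm] at this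
  exact this

lemma ballNorm_le_of_morreyE_le {n : ℕ} {p q : ℝ} {g : Eucl n → ℝ≥0∞} {m : ℝ≥0∞}
    (hg : morreyE n p q g ≤ m) (x : Eucl n) {ρ : ℝ} (hρ : 0 < ρ) :
    ballNorm q g x ρ ≤ volume (ball x ρ) ^ (1 / q - 1 / p) * m := by
  have h1 : volume (ball x ρ) ^ (1 / p - 1 / q) * ballNorm q g x ρ ≤ m :=
    le_trans (le_iSup₂_of_le x ρ (le_iSup (fun _ : 0 < ρ => _) hρ)) hg
  calc ballNorm q g x ρ = volume (ball x ρ) ^ (1 / q - 1 / p) *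
        (volume (ball x ρ) ^ (1 / p - 1 / q) * ballNorm q g x ρ) := by
        rw [← mul_assoc, ← ENNReal.rpow_add _ _ (volume_ball_ne_zero x hρ) measure_ball_lt_top.ne]
        simp
    _ ≤ _ := by gcongr

lemma morreyE_le_iff {n : ℕ} {p q : ℝ} {g : Eucl n → ℝ≥0∞} {m : ℝ≥0∞} :
    morreyE n p q g ≤ m ↔ ∀ x, ∀ ρ > 0, ballNorm q g x ρ ≤ volume (ball x ρ) ^ (1 / q - 1 / p) * m := by
  refine ⟨fun h x ρ hρ => ballNorm_le_of_morreyE_le h x hρ, fun h => iSup₂_le fun x ρ =>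
    iSup_le fun hρ => ?_⟩
  calc _ ≤ volume (ball x ρ) ^ (1 / p - 1 / q) * (volume (ball x ρ) ^ (1 / q - 1 / p) * m) := by
        gcongr; exact h x ρ hρ
    _ = m := by
        rw [← mul_assoc, ← ENNReal.rpow_add _ _ (volume_ball_ne_zero x hρ) measure_ball_lt_top.ne]
        simp

lemma ballNorm_le_maxFn {n : ℕ} {r : ℝ} (hr : 0 < r) (g : Eucl n → ℝ≥0∞) (x : Eucl n) {ρ : ℝ}
    (hρ : 0 < ρ) : ballNorm r g x ρ ≤ ENNReal.ofReal (2 ^ n * unitVol n) ^ (1 / r) *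
      ENNReal.ofReal ρ ^ (n / r) * maxFn (fun y => g y ^ r) x ^ (1 / r) := by
  have h := lintegral_ball_le_maxFn (fun y => g y ^ r) x hρ
  have hr' : 0 ≤ 1 / r := by positivity
  calc ballNorm r g x ρ ≤ _ := ENNReal.rpow_le_rpow h hr'
    _ = _ := by
      rw [ENNReal.mul_rpow_of_nonneg _ _ hr', ENNReal.mul_rpow_of_nonneg _ _ hr',
        volume_ball_rpow x hρ, ENNReal.ofReal_mul (by positivity),
        ENNReal.mul_rpow_of_nonneg _ _ hr', mul_one_div]
      ring

lemma lintegral_ball_ball_mul_le {n : ℕ} {L r : ℝ} (hLr : L.HolderConjugate r)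
    {w : Eucl n → Eucl n → ℝ≥0∞} (hw : Measurable (Function.uncurry w)) {h f : Eucl n → ℝ≥0∞}
    (hh : Measurable h) (hf : Measurable f) (z : Eucl n) (ρ : ℝ) :
    ∫⁻ x in ball z ρ, ∫⁻ y in ball z ρ, w x y * (h x * f y) ≤
      (∫⁻ x in ball z ρ, ∫⁻ y in ball z ρ, w x y ^ L) ^ (1 / L) *
        (ballNorm r h z ρ * ballNorm r f z ρ) := by
  set μ := (volume : Measure (Eucl n)).restrict (ball z ρ)
  have hhf : Measurable fun u : Eucl n × Eucl n => h u.1 * f u.2 := by fun_prop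
  have hr : 0 ≤ 1 / r := by have := hLr.symm.pos; positivity
  have key := ENNReal.lintegral_mul_le_Lp_mul_Lq (μ.prod μ) hLr hw.aemeasurable hhf.aemeasurable
  rw [lintegral_prod _ (hw.mul hhf).aemeasurable, lintegral_prod _ (hw.pow_const L).aemeasurable,
    lintegral_prod _ (hhf.pow_const r).aemeasurable] at key
  refine key.trans (le_of_eq ?_)
  congr 1
  unfold ballNorm
  rw [← ENNReal.mul_rpow_of_nonneg _ _ hr]
  congr 1
  simp_rw [ENNReal.mul_rpow_of_nonneg _ _ hLr.symm.nonneg]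
  rw [← lintegral_mul_const _ (hh.pow_const r)]
  exact lintegral_congr fun x => lintegral_const_mul _ (hf.pow_const r)

/-- A bilinear estimate for kernels `w(x,y)|x-y|^{α-n}` whose weight `w` has uniformly bounded
`L^L` averages over products of balls. -/
lemma exists_bilinear_le (n : ℕ) {α L r : ℝ} (hαn : α < n) (hLr : L.HolderConjugate r) :
    ∃ C : ℝ≥0∞, C ≠ ⊤ ∧ ∀ (w : Eucl n → Eucl n → ℝ≥0∞) (K : ℝ≥0∞),
      Measurable (Function.uncurry w) → K ≠ ⊤ →
      (∀ z, ∀ ρ > 0, (∫⁻ x in ball z ρ, ∫⁻ y in ball z ρ, w x y ^ L) ^ (1 / L) ≤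
        K * volume (ball z ρ) ^ (2 / L)) →
      ∀ h f : Eucl n → ℝ≥0∞, Measurable h → Measurable f →
        ∫⁻ x, h x * ∫⁻ y, w x y * f y * ENNReal.ofReal (dist x y ^ (α - n)) ≤
        C * K * ∫⁻ ρ in Set.Ioi (0 : ℝ), ∫⁻ z, ENNReal.ofReal ρ ^ (α - 1 - 2 * n / r) *
          (ballNorm r h z ρ * ballNorm r f z ρ) := by
  obtain ⟨C, hC, hk⟩ := exists_lintegral_mul_kernel_le n hαn
  have hL0 : 0 < L := hLr.pos
  have hr0 : 0 < r := hLr.symm.pos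
  have hU : ENNReal.ofReal (unitVol n) ^ (2 / L) ≠ ⊤ := by finiteness
  refine ⟨C * ENNReal.ofReal (unitVol n) ^ (2 / L), by finiteness, fun w K hw hK' hK h f hh hf => ?_⟩
  have hw' : Measurable fun u : Eucl n × Eucl n => w u.1 u.2 := hw
  have hmeas : Measurable fun u : Eucl n × Eucl n => w u.1 u.2 * (h u.1 * f u.2) := by fun_prop
  calc ∫⁻ x, h x * ∫⁻ y, w x y * f y * ENNReal.ofReal (dist x y ^ (α - n))
      = ∫⁻ x, ∫⁻ y, w x y * (h x * f y) * ENNReal.ofReal (dist x y ^ (α - n)) := by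
        refine lintegral_congr fun x => ?_
        have hwx : Measurable (w x) := hw.comp measurable_prodMk_left
        rw [← lintegral_const_mul _ (by fun_prop)]
        exact lintegral_congr fun y => by ring
    _ ≤ C * ∫⁻ ρ in Set.Ioi (0 : ℝ), ∫⁻ z : Eucl n, ENNReal.ofReal (ρ ^ (α - 2 * n - 1)) *
          ∫⁻ x in ball z ρ, ∫⁻ y in ball z ρ, w x y * (h x * f y) := hk _ hmeas
    _ ≤ C * ∫⁻ ρ in Set.Ioi (0 : ℝ), ∫⁻ z : Eucl n, ENNReal.ofReal (unitVol n) ^ (2 / L) * K *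
          (ENNReal.ofReal ρ ^ (α - 1 - 2 * n / r) * (ballNorm r h z ρ * ballNorm r f z ρ)) := by
        gcongr 1
        refine setLIntegral_mono' measurableSet_Ioi fun ρ hρ => lintegral_mono fun z => ?_
        have hρ0 : 0 < ρ := hρ
        have hrL : 1 / L + 1 / r = 1 := by
          have := hLr.inv_add_inv_eq_one; simpa [one_div] using this
        calc _ ≤ ENNReal.ofReal ρ ^ (α - 2 * n - 1) * (K * volume (ball z ρ) ^ (2 / L) *
              (ballNorm r h z ρ * ballNorm r f z ρ)) := by
              rw [ENNReal.ofReal_rpow_of_pos hρ0]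
              gcongr
              exact (lintegral_ball_ball_mul_le hLr hw hh hf z ρ).trans
                (mul_le_mul_left (hK z ρ hρ0) _)
          _ = _ := by
              rw [volume_ball_rpow z hρ0, show α - 1 - 2 * n / r = (α - 2 * n - 1) + n * (2 / L) by
                linear_combination (-2 * (n : ℝ)) * hrL, ← ofReal_rpow_mul_rpow hρ0]
              ring
    _ = _ := by
        have hUK : ENNReal.ofReal (unitVol n) ^ (2 / L) * K ≠ ⊤ := by finiteness
        simp_rw [lintegral_const_mul' _ _ hUK]
        ring

/-- Hedberg's inequality for the radial integral. -/
lemma lintegral_min_rpow_le {n α p s : ℝ} (hn : 0 < n) (hα : 0 < α) (hp : 0 < p) (hs : 0 < s)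
    (hps : 1 / s = 1 / p - α / n) {m : ℝ≥0∞} (hm0 : m ≠ 0) (hm : m ≠ ⊤) (A : ℝ≥0∞) :
    ∫⁻ ρ in Set.Ioi (0 : ℝ), ENNReal.ofReal ρ ^ (α - 1) * min A (ENNReal.ofReal ρ ^ (-(n / p)) * m)
      ≤ ENNReal.ofReal (1 / α + s / n) * (A ^ (p / s) * m ^ (1 - p / s)) := by
  have hps0 : 0 < p / s := by positivity
  have hC : ENNReal.ofReal (1 / α + s / n) ≠ 0 := by
    rw [ne_eq, ENNReal.ofReal_eq_zero, not_le]; positivity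
  rcases eq_or_ne A 0 with rfl | hA0
  · simp
  rcases eq_or_ne A ⊤ with rfl | hA
  · rw [ENNReal.top_rpow_of_pos hps0, ENNReal.top_mul (by
      rw [ne_eq, ENNReal.rpow_eq_zero_iff]; simp [hm0, hm]), ENNReal.mul_top hC]
    exact le_top
  obtain ⟨a, ha, rfl⟩ : ∃ a : ℝ, 0 < a ∧ A = ENNReal.ofReal a :=
    ⟨A.toReal, ENNReal.toReal_pos hA0 hA, (ENNReal.ofReal_toReal hA).symm⟩
  obtain ⟨b, hb, rfl⟩ : ∃ b : ℝ, 0 < b ∧ m = ENNReal.ofReal b :=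
    ⟨m.toReal, ENNReal.toReal_pos hm0 hm, (ENNReal.ofReal_toReal hm).symm⟩
  set c : ℝ := (b / a) ^ (p / n) with hc
  have hc0 : 0 < c := by positivity
  have hns : 0 < n / s := by positivity
  have hanp : α - n / p = -(n / s) := by
    have : n * (1 / s) = n * (1 / p) - α := by rw [hps]; field_simp
    linear_combination this
  have h1 : ∫⁻ ρ in Set.Ioo (0 : ℝ) c, ENNReal.ofReal ρ ^ (α - 1) *
      min (ENNReal.ofReal a) (ENNReal.ofReal ρ ^ (-(n / p)) * ENNReal.ofReal b) ≤
      ENNReal.ofReal (c ^ α / α * a) := by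
    calc _ ≤ ∫⁻ ρ in Set.Ioo (0 : ℝ) c, ENNReal.ofReal (ρ ^ (α - 1)) * ENNReal.ofReal a := by
          refine setLIntegral_mono' measurableSet_Ioo fun ρ hρ => ?_
          rw [ENNReal.ofReal_rpow_of_pos hρ.1]
          gcongr
          exact min_le_left _ _
      _ = _ := by
          rw [lintegral_mul_const _ (by fun_prop), lintegral_Ioo_rpow hα hc0.le,
            ENNReal.ofReal_mul (by positivity)]
  have h2 : ∫⁻ ρ in Set.Ioi c, ENNReal.ofReal ρ ^ (α - 1) *
      min (ENNReal.ofReal a) (ENNReal.ofReal ρ ^ (-(n / p)) * ENNReal.ofReal b) ≤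
      ENNReal.ofReal (c ^ (-(n / s)) / (n / s) * b) := by
    calc _ ≤ ∫⁻ ρ in Set.Ioi c, ENNReal.ofReal (ρ ^ (-(n / s) - 1)) * ENNReal.ofReal b := by
          refine setLIntegral_mono' measurableSet_Ioi fun ρ hρ => ?_
          have hρ0 : 0 < ρ := hc0.trans hρ
          rw [← ENNReal.ofReal_rpow_of_pos hρ0, show -(n / s) - 1 = (α - 1) + -(n / p) by
            linear_combination -hanp, ← ofReal_rpow_mul_rpow hρ0, mul_assoc]
          gcongr
          exact min_le_right _ _
      _ = _ := by
          rw [lintegral_mul_const _ (by fun_prop), lintegral_Ioi_rpow hns hc0,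
            ENNReal.ofReal_mul (by positivity)]
  have hpα : p / n * α = 1 - p / s := by
    have : p * (1 / s) = p * (1 / p) - p * (α / n) := by rw [hps]; ring
    rw [mul_one_div_cancel hp.ne'] at this
    linear_combination this
  have hcα : c ^ α * a = a ^ (p / s) * b ^ (1 - p / s) := by
    rw [hc, ← Real.rpow_mul (by positivity), hpα, Real.div_rpow hb.le ha.le, div_mul_eq_mul_div,
      div_eq_iff (by positivity), mul_right_comm, ← Real.rpow_add ha]
    simp [mul_comm]
  have hcs : c ^ (-(n / s)) * b = a ^ (p / s) * b ^ (1 - p / s) := by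
    rw [hc, ← Real.rpow_mul (by positivity), show p / n * -(n / s) = -(p / s) by field_simp,
      Real.rpow_neg (by positivity), Real.div_rpow hb.le ha.le, inv_div, Real.rpow_sub hb,
      Real.rpow_one]
    ring
  rw [← Set.Ioc_union_Ioi_eq_Ioi hc0.le]
  refine (lintegral_union_le _ _ _).trans ?_
  rw [← restrict_Ioo_eq_restrict_Ioc]
  refine (add_le_add h1 h2).trans (le_of_eq ?_)
  rw [ENNReal.ofReal_rpow_of_pos ha, ENNReal.ofReal_rpow_of_pos hb,
    ← ENNReal.ofReal_mul (by positivity), ← ENNReal.ofReal_mul (by positivity),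
    ← ENNReal.ofReal_add (by positivity) (by positivity)]
  congr 1
  rw [← hcα]
  have : c ^ (-(n / s)) / (n / s) * b = s / n * (c ^ α * a) := by
    rw [hcα, ← hcs]; field_simp
  rw [this]
  ring

/-- A converse to Hölder's inequality. -/
lemma rpow_lintegral_le_of_forall_lintegral_mul_le {n : ℕ} {t t' : ℝ} (ht : t.HolderConjugate t')
    {g : Eucl n → ℝ≥0∞} (hg : Measurable g) {B : Set (Eucl n)} (hB : MeasurableSet B)
    (hBf : volume B ≠ ⊤) {D : ℝ≥0∞} (h : ∀ φ : Eucl n → ℝ≥0∞, Measurable φ → (∀ x ∉ B, φ x = 0) →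
      ∫⁻ x, φ x * g x ≤ D * (∫⁻ x, φ x ^ t') ^ (1 / t')) :
    (∫⁻ x in B, g x ^ t) ^ (1 / t) ≤ D := by
  have ht0 := ht.pos
  have ht1 : 0 < t - 1 := by linarith [ht.lt]
  have ht'0 := ht.symm.pos
  have hN : ∀ N : ℕ, ∫⁻ x in B, min (g x) N ^ t ≤ D ^ t := by
    intro N
    set I := ∫⁻ x in B, min (g x) N ^ t with hI
    have hIf : I ≠ ⊤ := by
      refine ne_top_of_le_ne_top (b := (N : ℝ≥0∞) ^ t * volume B) (by finiteness) ?_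
      rw [← setLIntegral_const]
      exact lintegral_mono fun x => by gcongr; exact min_le_right _ _
    rcases eq_or_ne I 0 with h0 | h0
    · rw [h0]; exact zero_le
    have hφ : Measurable fun x => min (g x) N ^ (t - 1) := (hg.min measurable_const).pow_const _
    have h1 := h (B.indicator fun x => min (g x) N ^ (t - 1)) (hφ.indicator hB)
      fun x hx => Set.indicator_of_notMem hx _
    have h2 : I ≤ ∫⁻ x, B.indicator (fun x => min (g x) N ^ (t - 1)) x * g x := by
      rw [hI, ← lintegral_indicator hB]
      refine lintegral_mono fun x => ?_
      by_cases hx : x ∈ B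
      · rw [Set.indicator_of_mem hx, Set.indicator_of_mem hx]
        calc min (g x) (N : ℝ≥0∞) ^ t = min (g x) N ^ (t - 1) * min (g x) N := by
              conv_rhs => rw [← ENNReal.rpow_one (min (g x) (N : ℝ≥0∞)), ← ENNReal.rpow_mul,
                mul_comm (1 : ℝ), mul_one, ← ENNReal.rpow_add_of_nonneg _ _ ht1.le zero_le_one,
                sub_add_cancel]
          _ ≤ _ := by gcongr; exact min_le_left _ _
      · rw [Set.indicator_of_notMem hx]; exact zero_le
    have h3 : ∫⁻ x, B.indicator (fun x => min (g x) N ^ (t - 1)) x ^ t' = I := by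
      rw [hI, ← lintegral_indicator hB]
      refine lintegral_congr fun x => ?_
      by_cases hx : x ∈ B
      · rw [Set.indicator_of_mem hx, Set.indicator_of_mem hx, ← ENNReal.rpow_mul]
        rw [ht.sub_one_mul_conj]
      · rw [Set.indicator_of_notMem hx, Set.indicator_of_notMem hx, ENNReal.zero_rpow_of_pos ht'0]
    rw [h3] at h1
    have h4 : I ^ (1 / t) * I ^ (1 / t') ≤ D * I ^ (1 / t') := by
      rw [← ENNReal.rpow_add _ _ h0 hIf, one_div, one_div, ht.inv_add_inv_eq_one, ENNReal.rpow_one]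
      rw [← one_div]
      exact h2.trans h1
    have h5 : I ^ (1 / t) ≤ D := by
      refine (ENNReal.mul_le_mul_iff_left ?_ ?_).1 h4
      · rw [ne_eq, ENNReal.rpow_eq_zero_iff]; simp [h0, hIf]
      · finiteness
    calc I = (I ^ (1 / t)) ^ t := by
          rw [← ENNReal.rpow_mul, one_div_mul_cancel ht0.ne', ENNReal.rpow_one]
      _ ≤ D ^ t := by gcongr
  have hlim : ∫⁻ x in B, g x ^ t = ⨆ N : ℕ, ∫⁻ x in B, min (g x) N ^ t := by
    rw [← lintegral_iSup (fun N => (hg.min measurable_const).pow_const _)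
      (fun i j hij x => by dsimp only; gcongr)]
    refine lintegral_congr fun x => ?_
    refine le_antisymm ?_ (iSup_le fun N => by gcongr; exact min_le_left _ _)
    have hT : Tendsto (fun N : ℕ => min (g x) (N : ℝ≥0∞) ^ t) atTop (𝓝 (g x ^ t)) := by
      have h1 : Tendsto (fun N : ℕ => min (g x) (N : ℝ≥0∞)) atTop (𝓝 (min (g x) ⊤)) :=
        tendsto_const_nhds.min ENNReal.tendsto_nat_nhds_top
      rw [min_top_right] at h1
      exact (ENNReal.continuous_rpow_const.tendsto _).comp h1
    exact le_of_tendsto' hT fun N => le_iSup (fun N : ℕ => min (g x) (N : ℝ≥0∞) ^ t) N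
  calc (∫⁻ x in B, g x ^ t) ^ (1 / t) ≤ (D ^ t) ^ (1 / t) := by
        rw [hlim]
        exact ENNReal.rpow_le_rpow (iSup_le hN) (by positivity)
    _ = D := by rw [← ENNReal.rpow_mul, mul_one_div_cancel ht0.ne', ENNReal.rpow_one]

lemma lintegral_maxFn_rpow_rpow_le {n : ℕ} {r q : ℝ} (hr : 0 < r) {C : ℝ}
    (hC : ∀ g : Eucl n → ℝ≥0∞, Measurable g →
      ∫⁻ x, maxFn g x ^ (q / r) ≤ ENNReal.ofReal C * ∫⁻ x, g x ^ (q / r))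
    {g : Eucl n → ℝ≥0∞} (hg : Measurable g) :
    ∫⁻ x, (maxFn (fun y => g y ^ r) x ^ (1 / r)) ^ q ≤ ENNReal.ofReal C * ∫⁻ x, g x ^ q := by
  have h := hC (fun y => g y ^ r) (hg.pow_const r)
  simp_rw [← ENNReal.rpow_mul] at h ⊢
  rw [mul_div_cancel₀ _ hr.ne'] at h
  rwa [one_div_mul_eq_div]

lemma exists_lintegral_small_radius_le {n : ℕ} (hn : 0 < n) {α p q s t t' r : ℝ} (hα : 0 < α)
    (hq : 0 < q) (hqp : q ≤ p) (hs0 : 0 < s) (hs : 1 / s = 1 / p - α / n) (hst : p / q = s / t)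
    (ht : t.HolderConjugate t') (hr : 0 < r) (hrq : r < q) (hrt : r < t') :
    ∃ C : ℝ≥0∞, C ≠ ⊤ ∧ ∀ h f : Eucl n → ℝ≥0∞, Measurable h → Measurable f →
      ∀ m : ℝ≥0∞, m ≠ 0 → m ≠ ⊤ → morreyE n p q f ≤ m → ∀ (x₀ : Eucl n) (r₀ : ℝ), 0 < r₀ →
      (∀ x ∉ ball x₀ r₀, h x = 0) →
      ∫⁻ ρ in Set.Ioc 0 r₀, ∫⁻ z, ENNReal.ofReal ρ ^ (α - 1 - 2 * n / r) *
          (ballNorm r h z ρ * ballNorm r f z ρ) ≤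
        C * (m * ENNReal.ofReal r₀ ^ (n * (1 / t - 1 / s))) * (∫⁻ x, h x ^ t') ^ (1 / t') := by
  have hp : 0 < p := hq.trans_le hqp
  have ht0 : 0 < t := ht.pos
  have ht'0 : 0 < t' := ht.symm.pos
  have hn' : (0 : ℝ) < n := by exact_mod_cast hn
  have hps0 : 0 < p / s := by positivity
  have hqt : q / t = p / s := by
    rw [div_eq_div_iff hq.ne' ht0.ne'] at hst
    rw [div_eq_div_iff ht0.ne' hs0.ne']; linear_combination -hst
  have hpq0 : 0 ≤ 1 / q - 1 / p := sub_nonneg.2 (one_div_le_one_div_of_le hq hqp)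
  obtain ⟨C₁, hC₁0, hC₁⟩ := exists_lintegral_maxFn_rpow_le n (p := t' / r) ((one_lt_div hr).2 hrt)
  obtain ⟨C₂, hC₂0, hC₂⟩ := exists_lintegral_maxFn_rpow_le n (p := q / r) ((one_lt_div hr).2 hrq)
  set U := ENNReal.ofReal (unitVol n) with hU
  have hU0 : U ≠ 0 := by simpa [hU] using unitVol_pos n
  have hUt : U ≠ ⊤ := ofReal_ne_top
  set c₀ := ENNReal.ofReal (2 ^ n * unitVol n) ^ (1 / r) with hc₀
  have hc₀t : c₀ ≠ ⊤ := by finiteness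
  set c₁ := max c₀ (U ^ (1 / r - 1 / p)) with hc₁
  have hc₁t : c₁ ≠ ⊤ := by
    rw [hc₁, ne_eq, max_eq_top, not_or]
    exact ⟨hc₀t, ENNReal.rpow_ne_top_of_ne_zero hU0 hUt⟩
  set cH := ENNReal.ofReal (1 / α + s / n) with hcH
  set c₂ := (U ^ (1 / q - 1 / p) * ENNReal.ofReal 3 ^ (n * (1 / q - 1 / p))) ^ (p / s) with hc₂
  have hc₂t : c₂ ≠ ⊤ := by
    refine ENNReal.rpow_ne_top_of_nonneg hps0.le (ENNReal.mul_ne_top ?_ ?_)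
    · exact ENNReal.rpow_ne_top_of_nonneg hpq0 hUt
    · exact ENNReal.rpow_ne_top_of_nonneg (by positivity) ofReal_ne_top
  refine ⟨c₀ * c₁ * cH * ENNReal.ofReal C₁ ^ (1 / t') * ENNReal.ofReal C₂ ^ (1 / t) * c₂, ?_, ?_⟩
  · have h1 : ENNReal.ofReal C₁ ^ (1 / t') ≠ ⊤ :=
      ENNReal.rpow_ne_top_of_nonneg (by positivity) ofReal_ne_top
    have h2 : ENNReal.ofReal C₂ ^ (1 / t) ≠ ⊤ :=
      ENNReal.rpow_ne_top_of_nonneg (by positivity) ofReal_ne_top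
    finiteness
  intro h f hh hf m hm0 hm hfm x₀ r₀ hr₀ hsupp
  set f₁ := (ball x₀ (3 * r₀)).indicator f with hf₁
  have hf₁m : Measurable f₁ := hf.indicator measurableSet_ball
  set Mh : Eucl n → ℝ≥0∞ := fun z => maxFn (fun y => h y ^ r) z ^ (1 / r)
  set A : Eucl n → ℝ≥0∞ := fun z => maxFn (fun y => f₁ y ^ r) z ^ (1 / r)
  have hMh : Measurable Mh := (measurable_maxFn (hh.pow_const r)).pow_const _
  have hA : Measurable A := (measurable_maxFn (hf₁m.pow_const r)).pow_const _
  have hlocal : ∀ ρ ∈ Set.Ioc 0 r₀, ∀ z, ballNorm r h z ρ * ballNorm r f z ρ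
      = ballNorm r h z ρ * ballNorm r f₁ z ρ := by
    intro ρ hρ z
    by_cases hz : z ∈ ball x₀ (2 * r₀)
    · congr 1
      refine ballNorm_congr fun y hy => (Set.indicator_of_mem ?_ f).symm
      have := dist_triangle y z x₀
      rw [mem_ball] at *
      linarith [hρ.2]
    · have h0 : ballNorm r h z ρ = 0 := by
        have : ballNorm r h z ρ = ballNorm r (fun _ => 0) z ρ := by
          refine ballNorm_congr fun y hy => hsupp y fun hy' => hz ?_
          have := dist_triangle_left z x₀ y
          rw [mem_ball] at *
          linarith [hρ.2]
        rw [this]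
        simp [ballNorm, hr]
      rw [h0, zero_mul, zero_mul]
  have hf₁le : ∀ ρ : ℝ, 0 < ρ → ∀ z, ballNorm r f₁ z ρ ≤
      c₁ * (ENNReal.ofReal ρ ^ (n / r) * min (A z) (ENNReal.ofReal ρ ^ (-(n / p)) * m)) := by
    intro ρ hρ z
    rw [mul_min, mul_min, le_min_iff]
    constructor
    · refine (ballNorm_le_maxFn hr f₁ z hρ).trans ?_
      rw [mul_assoc]
      gcongr
      exact le_max_left _ _
    · calc ballNorm r f₁ z ρ ≤ ballNorm r f z ρ := by
            unfold ballNorm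
            gcongr with y
            exact Set.indicator_le_self _ _ _
        _ ≤ volume (ball z ρ) ^ (1 / r - 1 / q) * (volume (ball z ρ) ^ (1 / q - 1 / p) * m) :=
            (ballNorm_le_of_le hr hrq.le hf z ρ).trans
              (mul_le_mul_right (ballNorm_le_of_morreyE_le hfm z hρ) _)
        _ = U ^ (1 / r - 1 / p) * (ENNReal.ofReal ρ ^ (n / r) *
              (ENNReal.ofReal ρ ^ (-(n / p)) * m)) := by
            rw [← mul_assoc, ← ENNReal.rpow_add _ _ (volume_ball_ne_zero z hρ)
              measure_ball_lt_top.ne, sub_add_sub_cancel, volume_ball_rpow z hρ,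
              ← mul_assoc (ENNReal.ofReal ρ ^ (n / r)), ofReal_rpow_mul_rpow hρ, ← mul_assoc]
            congr 3
            ring
        _ ≤ _ := by gcongr; exact le_max_right _ _
  have hpt : ∀ ρ ∈ Set.Ioc 0 r₀, ∀ z, ENNReal.ofReal ρ ^ (α - 1 - 2 * n / r) *
      (ballNorm r h z ρ * ballNorm r f z ρ) ≤ c₀ * c₁ * (Mh z * (ENNReal.ofReal ρ ^ (α - 1) *
        min (A z) (ENNReal.ofReal ρ ^ (-(n / p)) * m))) := by
    intro ρ hρ z
    rw [hlocal ρ hρ z]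
    calc _ ≤ ENNReal.ofReal ρ ^ (α - 1 - 2 * n / r) * ((c₀ * ENNReal.ofReal ρ ^ (n / r) * Mh z) *
          (c₁ * (ENNReal.ofReal ρ ^ (n / r) * min (A z) (ENNReal.ofReal ρ ^ (-(n / p)) * m)))) := by
          gcongr
          · exact ballNorm_le_maxFn hr h z hρ.1
          · exact hf₁le ρ hρ.1 z
      _ = _ := by
          rw [show α - 1 = α - 1 - 2 * n / r + n / r + n / r by ring,
            ← ofReal_rpow_mul_rpow hρ.1 _ (n / r), ← ofReal_rpow_mul_rpow hρ.1 _ (n / r)]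
          rw [show α - 1 - 2 * n / r + n / r + n / r - 2 * n / r = α - 1 - 2 * n / r by ring]
          ring
  have hmeas : Measurable fun u : ℝ × Eucl n => Mh u.2 * (ENNReal.ofReal u.1 ^ (α - 1) *
        min (A u.2) (ENNReal.ofReal u.1 ^ (-(n / p)) * m)) := by fun_prop
  have hc01 : c₀ * c₁ ≠ ⊤ := by finiteness
  calc _ ≤ ∫⁻ ρ in Set.Ioc 0 r₀, ∫⁻ z, c₀ * c₁ * (Mh z * (ENNReal.ofReal ρ ^ (α - 1) *
        min (A z) (ENNReal.ofReal ρ ^ (-(n / p)) * m))) :=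
        setLIntegral_mono' measurableSet_Ioc fun ρ hρ => lintegral_mono fun z => hpt ρ hρ z
    _ ≤ ∫⁻ ρ in Set.Ioi 0, ∫⁻ z, c₀ * c₁ * (Mh z * (ENNReal.ofReal ρ ^ (α - 1) *
        min (A z) (ENNReal.ofReal ρ ^ (-(n / p)) * m))) :=
        lintegral_mono_set Set.Ioc_subset_Ioi_self
    _ = c₀ * c₁ * ∫⁻ z, Mh z * ∫⁻ ρ in Set.Ioi 0, (ENNReal.ofReal ρ ^ (α - 1) *
        min (A z) (ENNReal.ofReal ρ ^ (-(n / p)) * m)) := by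
        simp_rw [lintegral_const_mul' _ _ hc01]
        rw [lintegral_lintegral_swap hmeas.aemeasurable]
        congr 1
        exact lintegral_congr fun z => lintegral_const_mul _ (by fun_prop)
    _ ≤ c₀ * c₁ * ∫⁻ z, Mh z * (cH * (A z ^ (p / s) * m ^ (1 - p / s))) := by
        gcongr with z
        exact lintegral_min_rpow_le hn' hα hp hs0 hs hm0 hm (A z)
    _ = c₀ * c₁ * (cH * m ^ (1 - p / s)) * ∫⁻ z, Mh z * A z ^ (p / s) := by
        rw [← lintegral_const_mul _ (by fun_prop), ← lintegral_const_mul _ (by fun_prop)]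
        exact lintegral_congr fun z => by ring
    _ ≤ c₀ * c₁ * (cH * m ^ (1 - p / s)) * ((∫⁻ z, Mh z ^ t') ^ (1 / t') *
          (∫⁻ z, (A z ^ (p / s)) ^ t) ^ (1 / t)) := by
        gcongr
        exact ENNReal.lintegral_mul_le_Lp_mul_Lq volume ht.symm hMh.aemeasurable
          (hA.pow_const _).aemeasurable
    _ ≤ c₀ * c₁ * (cH * m ^ (1 - p / s)) *
          ((ENNReal.ofReal C₁ * ∫⁻ z, h z ^ t') ^ (1 / t') *
          (ENNReal.ofReal C₂ * (volume (ball x₀ (3 * r₀)) ^ (1 / q - 1 / p) * m) ^ q) ^ (1 / t)) := by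
        gcongr
        · exact lintegral_maxFn_rpow_rpow_le hr hC₁ hh
        · simp_rw [← ENNReal.rpow_mul, ← hqt, div_mul_cancel₀ q ht0.ne']
          refine (lintegral_maxFn_rpow_rpow_le hr hC₂ hf₁m).trans ?_
          gcongr
          have h1 : ∫⁻ x, f₁ x ^ q = ∫⁻ x in ball x₀ (3 * r₀), f x ^ q := by
            rw [← lintegral_indicator measurableSet_ball]
            refine lintegral_congr fun x => ?_
            by_cases hx : x ∈ ball x₀ (3 * r₀)
            · rw [hf₁, Set.indicator_of_mem hx, Set.indicator_of_mem hx]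
            · rw [hf₁, Set.indicator_of_notMem hx, Set.indicator_of_notMem hx,
                ENNReal.zero_rpow_of_pos hq]
          have h2 : ∫⁻ x in ball x₀ (3 * r₀), f x ^ q = ballNorm q f x₀ (3 * r₀) ^ q := by
            rw [ballNorm, ← ENNReal.rpow_mul, one_div_mul_cancel hq.ne', ENNReal.rpow_one]
          rw [h1, h2]
          gcongr
          exact ballNorm_le_of_morreyE_le hfm x₀ (by positivity)
    _ = _ := by
        rw [ENNReal.mul_rpow_of_nonneg _ _ (by positivity : 0 ≤ 1 / t'),
          ENNReal.mul_rpow_of_nonneg _ _ (by positivity : 0 ≤ 1 / t), ← ENNReal.rpow_mul, mul_one_div,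
          hqt, volume_ball_rpow x₀ (by positivity : 0 < 3 * r₀), ENNReal.ofReal_mul (by norm_num),
          ENNReal.mul_rpow_of_nonneg _ _ (by positivity : 0 ≤ n * (1 / q - 1 / p)),
          ENNReal.mul_rpow_of_nonneg _ _ hps0.le]
        rw [show U ^ (1 / q - 1 / p) * (ENNReal.ofReal 3 ^ (n * (1 / q - 1 / p)) *
            ENNReal.ofReal r₀ ^ (n * (1 / q - 1 / p))) = U ^ (1 / q - 1 / p) *
            ENNReal.ofReal 3 ^ (n * (1 / q - 1 / p)) * ENNReal.ofReal r₀ ^ (n * (1 / q - 1 / p)) by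
          ring, ENNReal.mul_rpow_of_nonneg _ _ hps0.le, ← hc₂, ← ENNReal.rpow_mul]
        have he : n * (1 / q - 1 / p) * (p / s) = n * (1 / t - 1 / s) := by
          have h1 : 1 / q * (p / s) = 1 / t := by rw [← hqt]; field_simp
          have h2 : 1 / p * (p / s) = 1 / s := by field_simp
          linear_combination (n : ℝ) * h1 - (n : ℝ) * h2
        have hmm : m ^ (1 - p / s) * m ^ (p / s) = m := by
          rw [← ENNReal.rpow_add _ _ hm0 hm, sub_add_cancel, ENNReal.rpow_one]
        rw [he]
        calc _ = c₀ * c₁ * cH * ENNReal.ofReal C₁ ^ (1 / t') * ENNReal.ofReal C₂ ^ (1 / t) * c₂ *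
              ((m ^ (1 - p / s) * m ^ (p / s)) * ENNReal.ofReal r₀ ^ (n * (1 / t - 1 / s))) *
              (∫⁻ x, h x ^ t') ^ (1 / t') := by ring
          _ = _ := by rw [hmm]

lemma exists_lintegral_large_radius_le {n : ℕ} (hn : 0 < n) {α p q s t t' r L : ℝ}
    (hs0 : 0 < s) (hs : 1 / s = 1 / p - α / n)
    (ht : t.HolderConjugate t') (hLr : L.HolderConjugate r) (hrq : r < q) (hrt : r < t')
    (hLs : s < L) :
    ∃ C : ℝ≥0∞, C ≠ ⊤ ∧ ∀ h f : Eucl n → ℝ≥0∞, Measurable h → Measurable f →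
      ∀ m : ℝ≥0∞, morreyE n p q f ≤ m → ∀ (x₀ : Eucl n) (r₀ : ℝ), 0 < r₀ →
      (∀ x ∉ ball x₀ r₀, h x = 0) →
      ∫⁻ ρ in Set.Ioi r₀, ∫⁻ z, ENNReal.ofReal ρ ^ (α - 1 - 2 * n / r) *
          (ballNorm r h z ρ * ballNorm r f z ρ) ≤
        C * (m * ENNReal.ofReal r₀ ^ (n * (1 / t - 1 / s))) * (∫⁻ x, h x ^ t') ^ (1 / t') := by
  have ht0 : 0 < t := ht.pos
  have ht'0 : 0 < t' := ht.symm.pos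
  have hr : 0 < r := hLr.symm.pos
  have hn' : (0 : ℝ) < n := by exact_mod_cast hn
  set U := ENNReal.ofReal (unitVol n) with hU
  have hU0 : U ≠ 0 := by simpa [hU] using unitVol_pos n
  have hUt : U ≠ ⊤ := ofReal_ne_top
  set e : ℝ := n * (1 / s - 1 / L) with he
  have he0 : 0 < e := mul_pos hn' (sub_pos.2 (one_div_lt_one_div_of_lt hs0 hLs))
  have hLr1 : 1 / L + 1 / r = 1 := by simpa [one_div] using hLr.inv_add_inv_eq_one
  have htt1 : 1 / t + 1 / t' = 1 := by simpa [one_div] using ht.inv_add_inv_eq_one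
  have hnα : (n : ℝ) * (1 / s) = n * (1 / p) - α := by rw [hs]; field_simp
  set c : ℝ≥0∞ := ENNReal.ofReal (2 ^ n) * U * U ^ (1 / r - 1 / t') * U ^ (1 / r - 1 / p) with hc
  have hct : c ≠ ⊤ := by
    have h1 := ENNReal.rpow_ne_top_of_ne_zero (y := 1 / r - 1 / t') hU0 hUt
    have h2 := ENNReal.rpow_ne_top_of_ne_zero (y := 1 / r - 1 / p) hU0 hUt
    finiteness
  refine ⟨c * ENNReal.ofReal (1 / e), by finiteness, ?_⟩
  intro h f hh hf m hfm x₀ r₀ hr₀ hsupp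
  set E := (∫⁻ x, h x ^ t') ^ (1 / t') with hE
  have hhle : ∀ z ρ, ballNorm r h z ρ ≤
      U ^ (1 / r - 1 / t') * ENNReal.ofReal r₀ ^ (n * (1 / r - 1 / t')) * E := by
    intro z ρ
    calc ballNorm r h z ρ ≤ ballNorm r h x₀ r₀ := by
          refine ENNReal.rpow_le_rpow ?_ (by positivity)
          rw [← lintegral_indicator measurableSet_ball, ← lintegral_indicator measurableSet_ball]
          refine lintegral_mono fun y => ?_
          by_cases hy : y ∈ ball x₀ r₀
          · rw [Set.indicator_of_mem hy]
            exact Set.indicator_le_self _ _ _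
          · refine (Set.indicator_le_self _ _ _).trans ?_
            rw [hsupp y hy, ENNReal.zero_rpow_of_pos hr]
            exact zero_le
      _ ≤ volume (ball x₀ r₀) ^ (1 / r - 1 / t') * ballNorm t' h x₀ r₀ :=
          ballNorm_le_of_le hr hrt.le hh _ _
      _ ≤ _ := by
          rw [volume_ball_rpow x₀ hr₀]
          gcongr
          exact ENNReal.rpow_le_rpow (setLIntegral_le_lintegral _ _) (by positivity)
  have hfle : ∀ z, ∀ ρ : ℝ, 0 < ρ → ballNorm r f z ρ ≤
      U ^ (1 / r - 1 / p) * ENNReal.ofReal ρ ^ (n * (1 / r - 1 / p)) * m := by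
    intro z ρ hρ
    calc _ ≤ volume (ball z ρ) ^ (1 / r - 1 / q) * (volume (ball z ρ) ^ (1 / q - 1 / p) * m) :=
            (ballNorm_le_of_le hr hrq.le hf z ρ).trans
              (mul_le_mul_right (ballNorm_le_of_morreyE_le hfm z hρ) _)
      _ = _ := by
            rw [← mul_assoc, ← ENNReal.rpow_add _ _ (volume_ball_ne_zero z hρ)
              measure_ball_lt_top.ne, sub_add_sub_cancel, volume_ball_rpow z hρ]
  have hzero : ∀ ρ ∈ Set.Ioi r₀, ∀ z ∉ ball x₀ (2 * ρ), ballNorm r h z ρ = 0 := by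
    intro ρ hρ z hz
    have : ballNorm r h z ρ = ballNorm r (fun _ => 0) z ρ := by
      refine ballNorm_congr fun y hy => hsupp y fun hy' => hz ?_
      have := dist_triangle_left z x₀ y
      rw [mem_ball] at *
      have : r₀ < ρ := hρ
      linarith
    rw [this]
    simp [ballNorm, hr]
  set K := U ^ (1 / r - 1 / t') * ENNReal.ofReal r₀ ^ (n * (1 / r - 1 / t')) * E *
    (U ^ (1 / r - 1 / p) * m) with hK
  have hinner : ∀ ρ ∈ Set.Ioi r₀, ∫⁻ z, ENNReal.ofReal ρ ^ (α - 1 - 2 * n / r) *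
      (ballNorm r h z ρ * ballNorm r f z ρ) ≤
      ENNReal.ofReal (ρ ^ (-e - 1)) * (ENNReal.ofReal (2 ^ n) * U * K) := by
    intro ρ hρ
    have hρ0 : 0 < ρ := hr₀.trans hρ
    calc _ ≤ ∫⁻ z, (ball x₀ (2 * ρ)).indicator (fun _ => ENNReal.ofReal ρ ^ (α - 1 - 2 * n / r) *
          (ENNReal.ofReal ρ ^ (n * (1 / r - 1 / p)) * K)) z := by
          refine lintegral_mono fun z => ?_
          by_cases hz : z ∈ ball x₀ (2 * ρ)
          · rw [Set.indicator_of_mem hz]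
            dsimp only
            calc _ ≤ ENNReal.ofReal ρ ^ (α - 1 - 2 * n / r) *
                  ((U ^ (1 / r - 1 / t') * ENNReal.ofReal r₀ ^ (n * (1 / r - 1 / t')) * E) *
                  (U ^ (1 / r - 1 / p) * ENNReal.ofReal ρ ^ (n * (1 / r - 1 / p)) * m)) := by
                  gcongr
                  · exact hhle z ρ
                  · exact hfle z ρ hρ0
              _ = _ := by rw [hK]; ring
          · rw [Set.indicator_of_notMem hz, hzero ρ hρ z hz]; simp
      _ = _ := by
          rw [lintegral_indicator measurableSet_ball, setLIntegral_const,
            volume_ball_mul x₀ x₀ hρ0 two_pos, volume_ball_eq x₀ hρ0,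
            ENNReal.ofReal_mul (unitVol_pos n).le, ← Real.rpow_natCast ρ n,
            ← ENNReal.ofReal_rpow_of_pos hρ0, ← ENNReal.ofReal_rpow_of_pos hρ0,
            show -e - 1 = (α - 1 - 2 * n / r) + n * (1 / r - 1 / p) + n by
              linear_combination (-1 : ℝ) * he - hnα + (n : ℝ) * hLr1,
            ← ofReal_rpow_mul_rpow hρ0 _ n, ← ofReal_rpow_mul_rpow hρ0 (α - 1 - 2 * n / r)]
          ring
  calc _ ≤ ∫⁻ ρ in Set.Ioi r₀, ENNReal.ofReal (ρ ^ (-e - 1)) * (ENNReal.ofReal (2 ^ n) * U * K) :=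
        setLIntegral_mono' measurableSet_Ioi hinner
    _ = ENNReal.ofReal r₀ ^ (-e) * ENNReal.ofReal (1 / e) * (ENNReal.ofReal (2 ^ n) * U * K) := by
        rw [lintegral_mul_const _ (by fun_prop), lintegral_Ioi_rpow he0 hr₀, div_eq_mul_one_div,
          ENNReal.ofReal_mul (by positivity), ENNReal.ofReal_rpow_of_pos hr₀]
    _ = _ := by
        rw [hK, hc, show n * (1 / t - 1 / s) = -e + n * (1 / r - 1 / t') by
          linear_combination he + (n : ℝ) * htt1 - (n : ℝ) * hLr1, ← ofReal_rpow_mul_rpow hr₀ (-e)]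
        ring

/-- The positive operator dominating a multilinear commutator. -/
noncomputable def posOp {ι : Type*} (n : ℕ) (α : ℝ) (J : Finset ι) (b : ι → Eucl n → ℝ)
    (f : Eucl n → ℝ≥0∞) (x : Eucl n) : ℝ≥0∞ :=
  ∫⁻ y, (∏ j ∈ J, ‖b j x - b j y‖ₑ) * f y * ENNReal.ofReal (dist x y ^ (α - n))

lemma measurable_prod_enorm_sub {ι : Type*} {n : ℕ} {J : Finset ι} {b : ι → Eucl n → ℝ}
    (hb : ∀ j ∈ J, Measurable (b j)) :
    Measurable fun u : Eucl n × Eucl n => ∏ j ∈ J, ‖b j u.1 - b j u.2‖ₑ :=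
  Finset.measurable_fun_prod _ fun j hj => by
    have := hb j hj
    fun_prop

lemma measurable_posOp {ι : Type*} {n : ℕ} {α : ℝ} {J : Finset ι} {b : ι → Eucl n → ℝ}
    (hb : ∀ j ∈ J, Measurable (b j)) {f : Eucl n → ℝ≥0∞} (hf : Measurable f) :
    Measurable (posOp n α J b f) := by
  have h := measurable_prod_enorm_sub hb
  have : Measurable fun u : Eucl n × Eucl n => (∏ j ∈ J, ‖b j u.1 - b j u.2‖ₑ) * f u.2 *
      ENNReal.ofReal (dist u.1 u.2 ^ (α - n)) := by fun_prop
  exact this.lintegral_prod_right' (ν := volume)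

lemma exists_lintegral_osc_double_le (n M : ℕ) (hM : M ≠ 0) : ∃ C : ℝ, 0 < C ∧
    ∀ (a : Eucl n → ℝ) (N : ℝ), Measurable a → 0 < N → HasOscLE n a N → ∀ z, ∀ ρ > 0,
      ∫⁻ u, ‖a u.1 - a u.2‖ₑ ^ M ∂((volume.restrict (ball z ρ)).prod (volume.restrict (ball z ρ))) ≤
        ENNReal.ofReal (C * N ^ M) * volume (ball z ρ) ^ 2 := by
  obtain ⟨C, hC, h⟩ := exists_lintegral_osc_pow_le n M hM
  refine ⟨2 ^ (M + 1) * C, by positivity, fun a N ha hN hosc z ρ hρ => ?_⟩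
  set μ := volume.restrict (ball z ρ)
  set c := ballAvg n a z ρ
  have hm : Measurable fun y => ‖a y - c‖ₑ ^ M := by fun_prop
  have hB := h a N hN hosc z ρ hρ
  have hμ : μ Set.univ = volume (ball z ρ) := Measure.restrict_apply_univ _
  calc ∫⁻ u, ‖a u.1 - a u.2‖ₑ ^ M ∂(μ.prod μ)
      ≤ ∫⁻ u, 2 ^ M * (‖a u.1 - c‖ₑ ^ M + ‖a u.2 - c‖ₑ ^ M) ∂(μ.prod μ) := by
        refine lintegral_mono fun u => ?_
        have h1 : ‖a u.1 - a u.2‖ₑ ≤ ‖a u.1 - c‖ₑ + ‖a u.2 - c‖ₑ := by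
          rw [show a u.1 - a u.2 = (a u.1 - c) - (a u.2 - c) by ring]
          exact enorm_sub_le
        calc ‖a u.1 - a u.2‖ₑ ^ M ≤ (2 * max ‖a u.1 - c‖ₑ ‖a u.2 - c‖ₑ) ^ M := by
              gcongr
              refine h1.trans ?_
              rw [two_mul]
              exact add_le_add (le_max_left _ _) (le_max_right _ _)
          _ ≤ _ := by
              rw [mul_pow]
              gcongr
              rcases max_cases ‖a u.1 - c‖ₑ ‖a u.2 - c‖ₑ with h | h <;> rw [h.1]
              · exact le_self_add
              · exact le_add_self
    _ = 2 ^ M * ((∫⁻ y, ‖a y - c‖ₑ ^ M ∂μ) * volume (ball z ρ) +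
          (∫⁻ y, ‖a y - c‖ₑ ^ M ∂μ) * volume (ball z ρ)) := by
        rw [lintegral_const_mul _ (by fun_prop), lintegral_add_left (by fun_prop)]
        congr 2
        · rw [lintegral_prod _ (by fun_prop)]
          simp only [lintegral_const, hμ]
          rw [lintegral_mul_const _ hm]
        · rw [lintegral_prod _ (by fun_prop)]
          simp only [lintegral_const, hμ]
    _ ≤ 2 ^ M * (ENNReal.ofReal (C * N ^ M) * volume (ball z ρ) * volume (ball z ρ) +
          ENNReal.ofReal (C * N ^ M) * volume (ball z ρ) * volume (ball z ρ)) := by gcongr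
    _ = _ := by
        have h2 : ENNReal.ofReal (2 ^ (M + 1) * C * N ^ M) =
            2 ^ (M + 1) * ENNReal.ofReal (C * N ^ M) := by
          rw [mul_assoc, ENNReal.ofReal_mul (by positivity), ENNReal.ofReal_pow zero_le_two,
            ENNReal.ofReal_ofNat]
        rw [h2]
        ring

lemma exists_weight_le {ι : Type*} (n L : ℕ) (hL : L ≠ 0) (J : Finset ι) : ∃ C : ℝ≥0∞, C ≠ ⊤ ∧
    ∀ (b : ι → Eucl n → ℝ) (N : ι → ℝ),
      (∀ j ∈ J, Measurable (b j) ∧ 0 < N j ∧ HasOscLE n (b j) (N j)) → ∀ z, ∀ ρ > 0,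
        (∫⁻ x in ball z ρ, ∫⁻ y in ball z ρ, (∏ j ∈ J, ‖b j x - b j y‖ₑ) ^ (L : ℝ)) ^ (1 / (L : ℝ)) ≤
          C * (∏ j ∈ J, ENNReal.ofReal (N j)) * volume (ball z ρ) ^ (2 / (L : ℝ)) := by
  have hL0 : (0 : ℝ) < L := by positivity
  rcases J.eq_empty_or_nonempty with rfl | hJ
  · refine ⟨1, by simp, fun b N _ z ρ hρ => ?_⟩
    simp only [Finset.prod_empty, ENNReal.one_rpow, lintegral_const, one_mul, mul_one,
      Measure.restrict_apply_univ]
    rw [← sq, ← ENNReal.rpow_natCast, ← ENNReal.rpow_mul, mul_one_div]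
    simp
  have hk : J.card ≠ 0 := by simpa using hJ.ne_empty
  have hk0 : (0 : ℝ) < J.card := by positivity
  obtain ⟨C, hC, h⟩ := exists_lintegral_osc_double_le n (L * J.card) (by positivity)
  refine ⟨ENNReal.ofReal C ^ (1 / (L : ℝ)), by finiteness, fun b N hb z ρ hρ => ?_⟩
  set μ := volume.restrict (ball z ρ)
  have hm := measurable_prod_enorm_sub fun j hj => (hb j hj).1
  set V := volume (ball z ρ)
  have key : ∫⁻ x in ball z ρ, ∫⁻ y in ball z ρ, (∏ j ∈ J, ‖b j x - b j y‖ₑ) ^ (L : ℝ) ≤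
      ENNReal.ofReal C * (∏ j ∈ J, ENNReal.ofReal (N j)) ^ (L : ℝ) * V ^ 2 := by
    calc ∫⁻ x in ball z ρ, ∫⁻ y in ball z ρ, (∏ j ∈ J, ‖b j x - b j y‖ₑ) ^ (L : ℝ)
        = ∫⁻ u, (∏ j ∈ J, ‖b j u.1 - b j u.2‖ₑ) ^ (L : ℝ) ∂(μ.prod μ) := by
          rw [lintegral_prod _ (hm.pow_const _).aemeasurable]
      _ = ∫⁻ u, ∏ j ∈ J, (‖b j u.1 - b j u.2‖ₑ ^ (L * J.card)) ^ (1 / (J.card : ℝ))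
            ∂(μ.prod μ) := by
          refine lintegral_congr fun u => ?_
          rw [← ENNReal.prod_rpow_of_nonneg hL0.le]
          refine Finset.prod_congr rfl fun j _ => ?_
          rw [← ENNReal.rpow_natCast _ (L * J.card), ← ENNReal.rpow_mul]
          congr 1
          push_cast
          field_simp
      _ ≤ ∏ j ∈ J, (∫⁻ u, ‖b j u.1 - b j u.2‖ₑ ^ (L * J.card) ∂(μ.prod μ)) ^ (1 / (J.card : ℝ)) := by
          refine ENNReal.lintegral_prod_norm_pow_le J (fun j hj => ?_) ?_ fun _ _ => by positivity
          · have := (hb j hj).1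
            fun_prop
          · rw [Finset.sum_const, nsmul_eq_mul, mul_one_div_cancel hk0.ne']
      _ ≤ ∏ j ∈ J, (ENNReal.ofReal (C * N j ^ (L * J.card)) * V ^ 2) ^ (1 / (J.card : ℝ)) := by
          refine Finset.prod_le_prod' fun j hj => ?_
          gcongr
          exact h (b j) (N j) (hb j hj).1 (hb j hj).2.1 (hb j hj).2.2 z ρ hρ
      _ = ∏ j ∈ J, ((ENNReal.ofReal C * V ^ 2) ^ (1 / (J.card : ℝ)) *
            ENNReal.ofReal (N j) ^ (L : ℝ)) := by
          refine Finset.prod_congr rfl fun j hj => ?_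
          rw [ENNReal.ofReal_mul hC.le, mul_right_comm, ENNReal.mul_rpow_of_nonneg _ _ (by positivity)]
          congr 1
          rw [ENNReal.ofReal_pow (hb j hj).2.1.le, ← ENNReal.rpow_natCast, ← ENNReal.rpow_mul]
          congr 1
          push_cast
          field_simp
      _ = _ := by
          rw [Finset.prod_mul_distrib, Finset.prod_const, ← ENNReal.rpow_natCast,
            ← ENNReal.rpow_mul, one_div_mul_cancel hk0.ne', ENNReal.rpow_one,
            ENNReal.prod_rpow_of_nonneg hL0.le]
          ring
  calc _ ≤ (ENNReal.ofReal C * (∏ j ∈ J, ENNReal.ofReal (N j)) ^ (L : ℝ) * V ^ 2) ^ (1 / (L : ℝ)) := by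
        gcongr
    _ = _ := by
        rw [ENNReal.mul_rpow_of_nonneg _ _ (by positivity), ENNReal.mul_rpow_of_nonneg _ _ (by positivity),
          ← ENNReal.rpow_mul, mul_one_div_cancel hL0.ne', ENNReal.rpow_one, ← ENNReal.rpow_natCast V 2,
          ← ENNReal.rpow_mul, mul_one_div]
        norm_num

/-- Boundedness of the dominating operator from `M^p_q` to `M^s_t`. -/
theorem exists_morreyE_posOp_le {ι : Type*} {n : ℕ} (hn : 0 < n) {α p q s t : ℝ} (hα : 0 < α)
    (hαn : α < n) (hq : 1 < q) (hqp : q ≤ p) (hs : 1 / s = 1 / p - α / n) (hs0 : 0 < 1 / s)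
    (hst : p / q = s / t) (J : Finset ι) : ∃ C : ℝ≥0∞, C ≠ ⊤ ∧
    ∀ (b : ι → Eucl n → ℝ) (N : ι → ℝ),
      (∀ j ∈ J, Measurable (b j) ∧ 0 < N j ∧ HasOscLE n (b j) (N j)) →
      ∀ f : Eucl n → ℝ≥0∞, Measurable f → ∀ m : ℝ≥0∞, m ≠ 0 → m ≠ ⊤ → morreyE n p q f ≤ m →
        morreyE n s t (posOp n α J b f) ≤ C * (∏ j ∈ J, ENNReal.ofReal (N j)) * m := by
  have hs0' : 0 < s := one_div_pos.1 hs0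
  have hq0 : 0 < q := by linarith
  have hp0 : 0 < p := by linarith
  have hn' : (0 : ℝ) < n := by exact_mod_cast hn
  have hps : p < s := by
    have : 0 < α / n := by positivity
    exact (one_div_lt_one_div hs0' hp0).1 (by linarith)
  have ht0 : 0 < t := by
    have : 0 < s / t := by rw [← hst]; positivity
    exact (div_pos_iff_of_pos_left hs0').1 this
  have ht1 : 1 < t := by
    rw [div_eq_div_iff hq0.ne' ht0.ne'] at hst
    have : p * q < p * t := by rw [hst]; gcongr
    exact hq.trans (lt_of_mul_lt_mul_left this hp0.le)
  have ht := Real.HolderConjugate.conjExponent ht1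
  set t' := t.conjExponent
  have ht'1 : 1 < t' := ht.symm.lt
  obtain ⟨L, hL⟩ := exists_nat_gt (max (max s 1) (max (q / (q - 1)) (t' / (t' - 1))))
  simp only [max_lt_iff] at hL
  obtain ⟨⟨hLs, hL1⟩, hLq, hLt⟩ := hL
  have hLr := Real.HolderConjugate.conjExponent hL1
  have hLne : L ≠ 0 := by rintro rfl; norm_num at hL1
  have hrlt : ∀ c : ℝ, 1 < c → c / (c - 1) < L → (L : ℝ).conjExponent < c := by
    intro c hc h
    rw [div_lt_iff₀ (by linarith)] at h
    rw [Real.conjExponent, div_lt_iff₀ (by linarith)]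
    linarith
  set r := (L : ℝ).conjExponent
  have hr0 : 0 < r := hLr.symm.pos
  have hrq := hrlt q hq hLq
  have hrt := hrlt t' ht'1 hLt
  obtain ⟨C₁, hC₁, h₁⟩ := exists_weight_le n L hLne J
  obtain ⟨C₂, hC₂, h₂⟩ := exists_bilinear_le n hαn hLr
  obtain ⟨C₃, hC₃, h₃⟩ := exists_lintegral_small_radius_le hn hα hq0 hqp hs0' hs hst ht hr0 hrq hrt
  obtain ⟨C₄, hC₄, h₄⟩ := exists_lintegral_large_radius_le (p := p) (α := α) (q := q) hn hs0' hs ht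
    hLr hrq hrt hLs
  have hU : ENNReal.ofReal (unitVol n) ^ (-(1 / t - 1 / s)) ≠ ⊤ :=
    ENNReal.rpow_ne_top_of_ne_zero (by simpa using unitVol_pos n) ofReal_ne_top
  refine ⟨C₂ * C₁ * (C₃ + C₄) * ENNReal.ofReal (unitVol n) ^ (-(1 / t - 1 / s)), by finiteness,
    fun b N hb f hf m hm0 hm hfm => ?_⟩
  have hbm : ∀ j ∈ J, Measurable (b j) := fun j hj => (hb j hj).1
  have hK : C₁ * ∏ j ∈ J, ENNReal.ofReal (N j) ≠ ⊤ :=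
    ENNReal.mul_ne_top hC₁ (ENNReal.prod_ne_top fun _ _ => ofReal_ne_top)
  rw [morreyE_le_iff]
  intro x₀ r₀ hr₀
  refine (rpow_lintegral_le_of_forall_lintegral_mul_le ht (measurable_posOp hbm hf)
    measurableSet_ball measure_ball_lt_top.ne (D := C₂ * (C₁ * ∏ j ∈ J, ENNReal.ofReal (N j)) *
      ((C₃ + C₄) * (m * ENNReal.ofReal r₀ ^ (n * (1 / t - 1 / s))))) ?_).trans (le_of_eq ?_)
  · intro φ hφ hsupp
    calc ∫⁻ x, φ x * posOp n α J b f x ≤ C₂ * (C₁ * ∏ j ∈ J, ENNReal.ofReal (N j)) *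
          ∫⁻ ρ in Set.Ioi (0 : ℝ), ∫⁻ z, ENNReal.ofReal ρ ^ (α - 1 - 2 * n / r) *
            (ballNorm r φ z ρ * ballNorm r f z ρ) :=
          h₂ (fun x y => ∏ j ∈ J, ‖b j x - b j y‖ₑ) _ (measurable_prod_enorm_sub hbm) hK
            (h₁ b N hb) φ f hφ hf
      _ ≤ C₂ * (C₁ * ∏ j ∈ J, ENNReal.ofReal (N j)) *
          (C₃ * (m * ENNReal.ofReal r₀ ^ (n * (1 / t - 1 / s))) * (∫⁻ x, φ x ^ t') ^ (1 / t') +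
          C₄ * (m * ENNReal.ofReal r₀ ^ (n * (1 / t - 1 / s))) * (∫⁻ x, φ x ^ t') ^ (1 / t')) := by
          gcongr
          rw [← Set.Ioc_union_Ioi_eq_Ioi hr₀.le]
          exact (lintegral_union_le _ _ _).trans (add_le_add
            (h₃ φ f hφ hf m hm0 hm hfm x₀ r₀ hr₀ hsupp) (h₄ φ f hφ hf m hfm x₀ r₀ hr₀ hsupp))
      _ = _ := by ring
  · rw [volume_ball_rpow x₀ hr₀]
    have : ENNReal.ofReal (unitVol n) ^ (-(1 / t - 1 / s)) *
        ENNReal.ofReal (unitVol n) ^ (1 / t - 1 / s) = 1 := by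
      rw [← ENNReal.rpow_add _ _ (by simpa using unitVol_pos n) ofReal_ne_top]
      simp
    calc _ = C₂ * C₁ * (C₃ + C₄) * (ENNReal.ofReal (unitVol n) ^ (-(1 / t - 1 / s)) *
        ENNReal.ofReal (unitVol n) ^ (1 / t - 1 / s)) * (∏ j ∈ J, ENNReal.ofReal (N j)) * m *
        ENNReal.ofReal r₀ ^ (n * (1 / t - 1 / s)) := by rw [this]; ring
      _ = _ := by ring

/-! ### Elementary properties of Morrey norms -/

lemma morreyNorm_eq_morreyE {n : ℕ} {p q : ℝ} (hq : 0 ≤ q) (f : Eucl n → ℝ) :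
    morreyNorm n p q f = morreyE n p q fun x => ‖f x‖ₑ := by
  have : ∀ x, ENNReal.ofReal (|f x| ^ q) = ‖f x‖ₑ ^ q := fun x => by
    rw [← ENNReal.ofReal_rpow_of_nonneg (abs_nonneg _) hq, Real.enorm_eq_ofReal_abs]
  simp only [morreyNorm, morreyE, this]

lemma morreyE_mono_ae {n : ℕ} {p q : ℝ} (hq : 0 < q) {f g : Eucl n → ℝ≥0∞}
    (h : ∀ᵐ x, f x ≤ g x) : morreyE n p q f ≤ morreyE n p q g := by
  refine iSup₂_mono fun x r => iSup_mono fun _ => ?_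
  refine mul_le_mul_right (ENNReal.rpow_le_rpow (lintegral_mono_ae (ae_restrict_of_ae ?_))
    (by positivity)) _
  filter_upwards [h] with y hy
  gcongr

lemma morreyE_add_le {n : ℕ} {p q : ℝ} (hq : 1 ≤ q) {f g : Eucl n → ℝ≥0∞} (hf : Measurable f)
    (hg : Measurable g) :
    morreyE n p q (fun x => f x + g x) ≤ morreyE n p q f + morreyE n p q g := by
  rw [morreyE_le_iff]
  intro x ρ hρ
  calc ballNorm q (fun x => f x + g x) x ρ ≤ ballNorm q f x ρ + ballNorm q g x ρ :=
        ENNReal.lintegral_Lp_add_le hf.aemeasurable hg.aemeasurable hq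
    _ ≤ _ := by
        rw [mul_add]
        exact add_le_add (ballNorm_le_of_morreyE_le le_rfl x hρ)
          (ballNorm_le_of_morreyE_le le_rfl x hρ)

lemma morreyE_const_mul {n : ℕ} {p q : ℝ} (hq : 0 < q) (c : ℝ≥0∞) {f : Eucl n → ℝ≥0∞}
    (hf : Measurable f) : morreyE n p q (fun x => c * f x) ≤ c * morreyE n p q f := by
  rw [morreyE_le_iff]
  intro x ρ hρ
  calc ballNorm q (fun x => c * f x) x ρ = c * ballNorm q f x ρ := by
        unfold ballNorm
        simp_rw [ENNReal.mul_rpow_of_nonneg _ _ hq.le]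
        rw [lintegral_const_mul _ (hf.pow_const q), ENNReal.mul_rpow_of_nonneg _ _ (by positivity),
          ← ENNReal.rpow_mul, mul_one_div_cancel hq.ne', ENNReal.rpow_one]
    _ ≤ _ := by
        rw [mul_left_comm]
        gcongr
        exact ballNorm_le_of_morreyE_le le_rfl x hρ

lemma morreyE_sum_le {ι : Type*} {n : ℕ} {p q : ℝ} (hq : 1 ≤ q) (J : Finset ι)
    {f : ι → Eucl n → ℝ≥0∞} (hf : ∀ i ∈ J, Measurable (f i)) :
    morreyE n p q (fun x => ∑ i ∈ J, f i x) ≤ ∑ i ∈ J, morreyE n p q (f i) := by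
  classical
  induction J using Finset.induction_on with
  | empty =>
    simp only [Finset.sum_empty, nonpos_iff_eq_zero]
    have hq0 : 0 < q := by linarith
    simp [morreyE, ENNReal.zero_rpow_of_pos hq0, hq0]
  | insert i J hi ih =>
    simp only [Finset.sum_insert hi]
    refine (morreyE_add_le hq (hf i (Finset.mem_insert_self _ _))
      (Finset.measurable_fun_sum _ fun j hj => hf j (Finset.mem_insert_of_mem hj))).trans ?_
    gcongr
    exact ih fun j hj => hf j (Finset.mem_insert_of_mem hj)

/-- On functions supported in a fixed ball, Morrey norms increase with the exponents. -/
lemma morreyE_indicator_ball_le {n : ℕ} {p₁ q₁ p₂ q₂ : ℝ} (hq₁ : 0 < q₁) (hqp₁ : q₁ ≤ p₁)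
    (hq : q₁ ≤ q₂) (hp : p₁ ≤ p₂) {g : Eucl n → ℝ≥0∞} (hg : Measurable g)
    (x₀ : Eucl n) {ρ : ℝ} (hρ : 0 < ρ) :
    morreyE n p₁ q₁ ((ball x₀ ρ).indicator g) ≤
      volume (ball x₀ ρ) ^ (1 / p₁ - 1 / p₂) * morreyE n p₂ q₂ g := by
  have hp₁ : 0 < p₁ := hq₁.trans_le hqp₁
  have h1 : 0 ≤ 1 / p₁ - 1 / p₂ := sub_nonneg.2 (one_div_le_one_div_of_le hp₁ hp)
  have h2 : 0 ≤ 1 / q₁ - 1 / p₁ := sub_nonneg.2 (one_div_le_one_div_of_le hq₁ hqp₁)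
  set m := morreyE n p₂ q₂ g
  have key : ∀ z, ∀ r > 0, ballNorm q₁ g z r ≤
      volume (ball z r) ^ (1 / q₁ - 1 / p₁) * (volume (ball z r) ^ (1 / p₁ - 1 / p₂) * m) := by
    intro z r hr
    calc ballNorm q₁ g z r ≤ volume (ball z r) ^ (1 / q₁ - 1 / q₂) *
          (volume (ball z r) ^ (1 / q₂ - 1 / p₂) * m) :=
          (ballNorm_le_of_le hq₁ hq hg z r).trans
            (mul_le_mul_right (ballNorm_le_of_morreyE_le le_rfl z hr) _)
      _ = _ := by
          rw [← mul_assoc, ← mul_assoc, ← ENNReal.rpow_add _ _ (volume_ball_ne_zero z hr)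
            measure_ball_lt_top.ne, ← ENNReal.rpow_add _ _ (volume_ball_ne_zero z hr)
            measure_ball_lt_top.ne]
          congr 2
          ring
  have hvol : ∀ (z w : Eucl n) {r R : ℝ}, 0 < r → r ≤ R → volume (ball z r) ≤ volume (ball w R) := by
    intro z w r R hr hrR
    rw [volume_ball_eq z hr, volume_ball_eq w (hr.trans_le hrR)]
    have := unitVol_pos n
    gcongr
  rw [morreyE_le_iff]
  intro z r hr
  rcases le_total r ρ with hrρ | hrρ
  · calc ballNorm q₁ ((ball x₀ ρ).indicator g) z r ≤ ballNorm q₁ g z r := by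
          unfold ballNorm
          gcongr with y
          exact Set.indicator_le_self _ _ _
      _ ≤ _ := key z r hr
      _ ≤ _ := mul_le_mul_right (mul_le_mul_left (ENNReal.rpow_le_rpow (hvol z x₀ hr hrρ) h1) _) _
  · calc ballNorm q₁ ((ball x₀ ρ).indicator g) z r ≤ ballNorm q₁ g x₀ ρ := by
          refine ENNReal.rpow_le_rpow ?_ (by positivity)
          rw [← lintegral_indicator measurableSet_ball (f := fun y => g y ^ q₁)]
          refine (setLIntegral_le_lintegral _ _).trans (lintegral_mono fun y => ?_)
          by_cases hy : y ∈ ball x₀ ρ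
          · rw [Set.indicator_of_mem hy, Set.indicator_of_mem hy]
          · rw [Set.indicator_of_notMem hy, ENNReal.zero_rpow_of_pos hq₁]
            exact zero_le
      _ ≤ _ := key x₀ ρ hρ
      _ ≤ _ := mul_le_mul_left (ENNReal.rpow_le_rpow (hvol x₀ z hρ hrρ) h2) _

lemma ae_lt_top_of_morreyE {n : ℕ} {p q : ℝ} (hq : 0 < q) {g : Eucl n → ℝ≥0∞} (hg : Measurable g)
    (h : morreyE n p q g ≠ ⊤) : ∀ᵐ x, g x < ⊤ := by
  have hk : ∀ k : ℕ, ∀ᵐ x ∂(volume.restrict (ball (0 : Eucl n) (k + 1))), g x < ⊤ := by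
    intro k
    have hk0 : (0 : ℝ) < k + 1 := by positivity
    have h1 : ballNorm q g 0 (k + 1) < ⊤ :=
      (ballNorm_le_of_morreyE_le le_rfl 0 hk0).trans_lt (ENNReal.mul_lt_top
        (ENNReal.rpow_ne_top_of_ne_zero (volume_ball_ne_zero _ hk0) measure_ball_lt_top.ne).lt_top
        h.lt_top)
    rw [ballNorm, ENNReal.rpow_lt_top_iff_of_pos (by positivity)] at h1
    filter_upwards [ae_lt_top (hg.pow_const q) h1.ne] with x hx
    rwa [ENNReal.rpow_lt_top_iff_of_pos hq] at hx
  have hU : (⋃ k : ℕ, ball (0 : Eucl n) (k + 1)) = Set.univ := by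
    refine Set.eq_univ_of_forall fun x => Set.mem_iUnion.2 ?_
    obtain ⟨k, hk⟩ := exists_nat_gt ‖x‖
    exact ⟨k, by rw [mem_ball_zero_iff]; linarith⟩
  rw [← Measure.restrict_univ (μ := (volume : Measure (Eucl n))), ← hU]
  exact (ae_restrict_iUnion_iff _ _).2 hk

/-! ### Approximation of the kernel by kernels of finite rank -/

lemma exists_simpleFunc_dist_lt {n : ℕ} (R : ℝ) {η : ℝ} (hη : 0 < η) :
    ∃ π : SimpleFunc (Eucl n) (Eucl n), ∀ x ∈ ball (0 : Eucl n) R, dist (π x) x < η := by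
  let e := TopologicalSpace.denseSeq (Eucl n)
  have hcov : closedBall (0 : Eucl n) R ⊆ ⋃ k : ℕ, ball (e k) η := fun x _ => by
    obtain ⟨k, hk⟩ := (TopologicalSpace.denseRange_denseSeq (Eucl n)).exists_dist_lt x hη
    exact Set.mem_iUnion.2 ⟨k, hk⟩
  obtain ⟨I, hI⟩ := (isCompact_closedBall (0 : Eucl n) R).elim_finite_subcover _
    (fun k => isOpen_ball) hcov
  refine ⟨SimpleFunc.nearestPt e (I.sup id), fun x hx => ?_⟩
  obtain ⟨k, hk, hxk⟩ := Set.mem_iUnion₂.1 (hI (ball_subset_closedBall hx))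
  have h := SimpleFunc.edist_nearestPt_le e x (Finset.le_sup (f := id) hk : id k ≤ I.sup id)
  rw [edist_dist, edist_dist, ENNReal.ofReal_le_ofReal_iff dist_nonneg] at h
  rw [mem_ball, dist_comm] at hxk
  exact h.trans_lt hxk

/-- Outside the diagonal and near infinity the commutator kernel of a test function is small;
elsewhere it is approximated by finite sums of products. -/
lemma exists_finite_rank_kernel {n : ℕ} {α θ : ℝ} (hαn : α < n) (hθ : 0 < θ) {φ : Eucl n → ℝ}
    (hφ : IsCcSmooth n φ) : ∃ ρ : ℝ, 0 < ρ ∧ ∀ ε : ℝ, 0 < ε → ∃ (R K : ℝ) (U : Finset (Eucl n))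
      (g h : Eucl n → Eucl n → ℝ), 0 < R ∧ 0 ≤ K ∧ (∀ u, Measurable (g u) ∧ Measurable (h u)) ∧
      (∀ u x, |g u x| ≤ K ∧ |h u x| ≤ K) ∧ (∀ u, ∀ x ∉ ball (0 : Eucl n) R, g u x = 0 ∧ h u x = 0) ∧
      ∀ x y, x ≠ y → |(φ x - φ y) * dist x y ^ (α - n) - ∑ u ∈ U, g u x * h u y| ≤
        ε * (dist x y ^ (α - n) + (ball (0 : Eucl n) ρ).indicator 1 x * dist x y ^ (α + θ - n) +
          (ball (0 : Eucl n) ρ).indicator 1 y * dist x y ^ (α + θ - n)) := by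
  obtain ⟨hsm, hcs⟩ := hφ
  obtain ⟨Λ, hΛ⟩ := hsm.lipschitzWith_of_hasCompactSupport hcs (by simp)
  have hcont : Continuous φ := hsm.continuous
  obtain ⟨B, hB⟩ := hcs.exists_bound_of_continuous hcont
  have hB0 : 0 ≤ B := (norm_nonneg _).trans (hB 0)
  obtain ⟨ρ₀, hρ₀⟩ := hcs.isCompact.isBounded.subset_ball (0 : Eucl n)
  set ρ := max ρ₀ 1
  have hρ : 0 < ρ := by positivity
  have hsupp : ∀ x ∉ ball (0 : Eucl n) ρ, φ x = 0 := fun x hx =>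
    image_eq_zero_of_notMem_tsupport fun h =>
      hx (ball_subset_ball (le_max_left _ _) (hρ₀ h))
  refine ⟨ρ, hρ, fun ε hε => ?_⟩
  obtain ⟨T, hT0, hT⟩ : ∃ T : ℝ, 0 < T ∧ 2 * B * T ^ (-θ) ≤ ε := by
    have h1 : Tendsto (fun T : ℝ => 2 * B * T ^ (-θ)) atTop (𝓝 (2 * B * 0)) :=
      (tendsto_rpow_neg_atTop hθ).const_mul _
    rw [mul_zero] at h1
    obtain ⟨T, hT⟩ := ((eventually_gt_atTop (0 : ℝ)).and (h1.eventually_le_const hε)).exists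
    exact ⟨T, hT⟩
  set R := ρ + T
  have hR : 0 < R := by positivity
  obtain ⟨δ, hδ0, hδ⟩ : ∃ δ : ℝ, 0 < δ ∧ Λ * δ ≤ ε / 2 := by
    refine ⟨ε / 2 / (Λ + 1), by positivity, ?_⟩
    rw [mul_div_assoc', div_le_iff₀ (by positivity)]
    nlinarith [Λ.2, NNReal.coe_nonneg Λ]
  have hαn' : α - n < 0 := by linarith
  set κ : Eucl n → Eucl n → ℝ := fun x y => (φ x - φ y) * (max (dist x y) δ) ^ (α - n)
  have hκc : Continuous fun z : Eucl n × Eucl n => κ z.1 z.2 := by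
    refine ((hcont.comp continuous_fst).sub (hcont.comp continuous_snd)).mul
      ((continuous_dist.max continuous_const).rpow_const fun z => Or.inl ?_)
    exact (hδ0.trans_le (le_max_right _ _)).ne'
  have hφd : ∀ x y, |φ x - φ y| ≤ 2 * B := fun x y => by
    have := norm_sub_le (φ x) (φ y)
    rw [Real.norm_eq_abs] at this
    linarith [hB x, hB y]
  have hκb : ∀ x y, |κ x y| ≤ 2 * B * δ ^ (α - n) := fun x y => by
    have h1 : (max (dist x y) δ) ^ (α - n) ≤ δ ^ (α - n) :=
      Real.rpow_le_rpow_of_nonpos hδ0 (le_max_right _ _) hαn'.le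
    rw [abs_mul, abs_of_nonneg (by positivity : 0 ≤ (max (dist x y) δ) ^ (α - n))]
    exact mul_le_mul (hφd x y) h1 (by positivity) (by positivity)
  set ε₂ := ε / 2 * (2 * R) ^ (α - n)
  have hε₂ : 0 < ε₂ := by positivity
  have huc := ((isCompact_closedBall (0 : Eucl n) (R + 1)).prod
    (isCompact_closedBall (0 : Eucl n) (R + 1))).uniformContinuousOn_of_continuous hκc.continuousOn
  obtain ⟨η, hη0, hη⟩ := Metric.uniformContinuousOn_iff.1 huc ε₂ hε₂
  obtain ⟨π, hπ⟩ := exists_simpleFunc_dist_lt (n := n) R (lt_min hη0 one_pos)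
  refine ⟨R, max 1 (2 * B * δ ^ (α - n)), π.range,
    fun u => (ball 0 R ∩ π ⁻¹' {u}).indicator 1, fun u => (ball 0 R).indicator (κ u), hR,
    by positivity, fun u => ⟨?_, ?_⟩, fun u x => ⟨?_, ?_⟩, fun u x hx => ⟨?_, ?_⟩, ?_⟩
  · exact measurable_one.indicator (measurableSet_ball.inter (π.measurableSet_fiber u))
  · exact Measurable.indicator (hκc.comp (Continuous.prodMk_right u)).measurable measurableSet_ball
  · refine le_trans ?_ (le_max_left _ _)
    beta_reduce
    by_cases hx : x ∈ ball 0 R ∩ π ⁻¹' {u}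
    · rw [Set.indicator_of_mem hx]; simp
    · rw [Set.indicator_of_notMem hx]; simp
  · refine le_trans ?_ (le_max_right _ _)
    beta_reduce
    by_cases hx : x ∈ ball 0 R
    · rw [Set.indicator_of_mem hx]; exact hκb u x
    · rw [Set.indicator_of_notMem hx, abs_zero]; positivity
  · exact Set.indicator_of_notMem (fun h => hx h.1) _
  · exact Set.indicator_of_notMem hx _
  intro x y hxy
  have hd : 0 < dist x y := dist_pos.2 hxy
  have hind : ∀ z : Eucl n, 0 ≤ (ball (0 : Eucl n) ρ).indicator (1 : Eucl n → ℝ) z := fun z =>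
    Set.indicator_nonneg (fun _ _ => zero_le_one) z
  have hpx := mul_nonneg (hind x) (Real.rpow_nonneg hd.le (α + θ - n))
  have hpy := mul_nonneg (hind y) (Real.rpow_nonneg hd.le (α + θ - n))
  have hp0 : 0 < dist x y ^ (α - n) := Real.rpow_pos_of_pos hd _
  by_cases hin : x ∈ ball (0 : Eucl n) R ∧ y ∈ ball (0 : Eucl n) R
  · obtain ⟨hx, hy⟩ := hin
    have hsum : ∑ u ∈ π.range, (ball 0 R ∩ π ⁻¹' {u}).indicator (1 : Eucl n → ℝ) x *
        (ball 0 R).indicator (κ u) y = κ (π x) y := by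
      rw [Finset.sum_eq_single (π x)]
      · rw [Set.indicator_of_mem (show x ∈ ball 0 R ∩ π ⁻¹' {π x} from ⟨hx, rfl⟩),
           Set.indicator_of_mem hy]; simp
      · intro u _ hu
        rw [Set.indicator_of_notMem (fun h => hu h.2.symm), zero_mul]
      · intro h
        exact absurd (π.mem_range_self x) h
    rw [hsum]
    have h1 : |(φ x - φ y) * dist x y ^ (α - n) - κ x y| ≤ ε / 2 * dist x y ^ (α - n) := by
      rcases le_total δ (dist x y) with h | h
      · simp only [κ, max_eq_left h, sub_self, abs_zero]; positivity
      · simp only [κ, max_eq_right h]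
        have h2 : δ ^ (α - n) ≤ dist x y ^ (α - n) := Real.rpow_le_rpow_of_nonpos hd h hαn'.le
        have h3 : 0 ≤ δ ^ (α - n) := by positivity
        have h4 : |φ x - φ y| ≤ Λ * dist x y := by
          rw [← Real.dist_eq]; exact hΛ.dist_le_mul x y
        rw [← mul_sub, abs_mul, abs_of_nonneg (sub_nonneg.2 h2)]
        refine mul_le_mul (h4.trans (le_trans ?_ hδ)) (by linarith) (by linarith) (by positivity)
        gcongr
    have h2 : |κ x y - κ (π x) y| ≤ ε / 2 * dist x y ^ (α - n) := by
      have hx' := hπ x hx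
      have hR1 : R ≤ R + 1 := by linarith
      have hπx : π x ∈ closedBall (0 : Eucl n) (R + 1) := by
        rw [mem_closedBall]
        have := dist_triangle (π x) x 0
        have h6 := hx'.trans_le (min_le_right _ _)
        rw [mem_ball] at hx
        linarith
      have h3 := hη (x, y) ⟨closedBall_subset_closedBall hR1 (ball_subset_closedBall hx),
        closedBall_subset_closedBall hR1 (ball_subset_closedBall hy)⟩ (π x, y)
        ⟨hπx, closedBall_subset_closedBall hR1 (ball_subset_closedBall hy)⟩ (by
          rw [Prod.dist_eq, dist_self, dist_comm]
          exact max_lt (hx'.trans_le (min_le_left _ _)) hη0)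
      rw [Real.dist_eq] at h3
      refine h3.le.trans ?_
      have h4 : dist x y ≤ 2 * R := by
        have := dist_triangle_right x y 0
        rw [mem_ball] at hx hy
        linarith
      have := Real.rpow_le_rpow_of_nonpos hd h4 hαn'.le
      simp only [ε₂]
      gcongr
    have h3 := abs_sub_le ((φ x - φ y) * dist x y ^ (α - n)) (κ x y) (κ (π x) y)
    nlinarith
  · have hsum : ∑ u ∈ π.range, (ball 0 R ∩ π ⁻¹' {u}).indicator (1 : Eucl n → ℝ) x *
        (ball 0 R).indicator (κ u) y = 0 := by
      refine Finset.sum_eq_zero fun u _ => ?_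
      rw [not_and_or] at hin
      rcases hin with h | h
      · rw [Set.indicator_of_notMem (fun h' => h h'.1), zero_mul]
      · rw [Set.indicator_of_notMem h, mul_zero]
    rw [hsum, sub_zero]
    have hfar : T ≤ dist x y → |(φ x - φ y) * dist x y ^ (α - n)| ≤
        ε * dist x y ^ (α + θ - n) := by
      intro h
      have h1 : dist x y ^ (α - n) = dist x y ^ (-θ) * dist x y ^ (α + θ - n) := by
        rw [← Real.rpow_add hd]; congr 1; ring
      have h2 := Real.rpow_le_rpow_of_nonpos hT0 h (neg_nonpos.2 hθ.le)
      have h3 : 0 < dist x y ^ (α + θ - n) := Real.rpow_pos_of_pos hd _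
      rw [abs_mul, abs_of_pos hp0, h1, ← mul_assoc]
      refine mul_le_mul_of_nonneg_right ?_ h3.le
      exact (mul_le_mul (hφd x y) h2 (by positivity) (by positivity)).trans hT
    have hdist : ∀ z w : Eucl n, z ∈ ball (0 : Eucl n) ρ → w ∉ ball (0 : Eucl n) R →
        T ≤ dist z w := by
      intro z w hz hw
      rw [mem_ball] at hz hw
      have := dist_triangle_left w 0 z
      simp only [R] at hw
      linarith
    by_cases hx : x ∈ ball (0 : Eucl n) ρ
    · have hy : y ∉ ball (0 : Eucl n) R := fun h =>
        hin ⟨ball_subset_ball (by simp only [R]; linarith) hx, h⟩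
      refine (hfar (hdist x y hx hy)).trans ?_
      rw [Set.indicator_of_mem hx, Pi.one_apply, one_mul]
      gcongr
      linarith
    · by_cases hy : y ∈ ball (0 : Eucl n) ρ
      · have hx' : x ∉ ball (0 : Eucl n) R := fun h =>
          hin ⟨h, ball_subset_ball (by simp only [R]; linarith) hy⟩
        refine (hfar (by rw [dist_comm]; exact hdist y x hy hx')).trans ?_
        rw [Set.indicator_of_mem hy, Pi.one_apply, one_mul]
        gcongr
        linarith
      · rw [hsupp x hx, hsupp y hy]
        simp only [sub_self, zero_mul, abs_zero]
        positivity

/-! ### Finite rank operators -/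

lemma exists_mul_ofReal_le {D ε : ℝ≥0∞} (hD : D ≠ ⊤) (hε : ε ≠ 0) :
    ∃ η : ℝ, 0 < η ∧ D * ENNReal.ofReal η ≤ ε := by
  have h1 : Tendsto (fun η : ℝ => D * ENNReal.ofReal η) (𝓝[>] 0) (𝓝 (D * ENNReal.ofReal 0)) :=
    ENNReal.Tendsto.const_mul (ENNReal.tendsto_ofReal (tendsto_id.mono_left nhdsWithin_le_nhds))
      (Or.inr hD)
  rw [ENNReal.ofReal_zero, mul_zero] at h1
  obtain ⟨η, h, hη⟩ := ((h1.eventually_le_const (pos_iff_ne_zero.2 hε)).and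
    self_mem_nhdsWithin).exists
  exact ⟨η, hη, h⟩

lemma HasOscLE.memLp {n : ℕ} {a : Eucl n → ℝ} {N : ℝ} (hN : 0 < N) (ha : HasOscLE n a N)
    (hm : Measurable a) {R : ℝ} (hR : 0 < R) {r : ℝ≥0∞} (hr : r ≠ ⊤) :
    MemLp a r (volume.restrict (ball 0 R)) := by
  have : IsFiniteMeasure (volume.restrict (ball (0 : Eucl n) R)) :=
    ⟨by simpa using measure_ball_lt_top⟩
  obtain ⟨L, hL⟩ := ENNReal.exists_nat_gt hr
  have hL0 : L ≠ 0 := by rintro rfl; simp at hL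
  obtain ⟨C, _, hC⟩ := exists_lintegral_osc_pow_le n L hL0
  have h1 : MemLp (fun y => a y - ballAvg n a 0 R) L (volume.restrict (ball 0 R)) := by
    refine ⟨(hm.sub_const _).aestronglyMeasurable, ?_⟩
    rw [eLpNorm_lt_top_iff_lintegral_rpow_enorm_lt_top (by simpa using hL0) (by simp)]
    simp only [ENNReal.toReal_natCast, ENNReal.rpow_natCast]
    exact (hC a N hN ha 0 R hR).trans_lt (ENNReal.mul_lt_top ofReal_lt_top measure_ball_lt_top)
  have h2 : MemLp a L (volume.restrict (ball 0 R)) := by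
    convert h1.add (memLp_const (ballAvg n a 0 R)) using 1
    ext y
    simp
  exact h2.mono_exponent hL.le

lemma memLp_prod_of_forall {ι Ω : Type*} [MeasurableSpace Ω] {μ : Measure Ω} [IsFiniteMeasure μ]
    {b : ι → Ω → ℝ} {A : Finset ι} (h : ∀ j ∈ A, ∀ r : ℝ≥0∞, r ≠ ⊤ → MemLp (b j) r μ)
    {r : ℝ≥0∞} (hr : r ≠ ⊤) : MemLp (fun y => ∏ j ∈ A, b j y) r μ := by
  have h1 := MemLp.prod' (s := A) (f := b) (p := fun _ => (A.card : ℝ≥0∞) * r) (μ := μ)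
    fun j hj => h j hj _ (by finiteness)
  refine h1.mono_exponent ?_
  rcases eq_or_ne (A.card : ℝ≥0∞) 0 with hA | hA
  · have : A = ∅ := by simpa using hA
    simp [this]
  · have : (A.card : ℝ≥0∞) * (A.card * r)⁻¹ = r⁻¹ := by
      rw [ENNReal.mul_inv (Or.inl hA) (Or.inl (by simp)), ← mul_assoc,
        ENNReal.mul_inv_cancel hA (by simp), one_mul]
    rw [Finset.sum_const, nsmul_eq_mul, this, inv_inv]

lemma morreyE_ne_top_of_support {n : ℕ} {s t : ℝ} (ht : 0 < t) (hts : t ≤ s)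
    {W : Eucl n → ℝ≥0∞} (hW : Measurable W) {R : ℝ} (hR : 0 < R)
    (hsupp : ∀ x ∉ ball (0 : Eucl n) R, W x = 0) (h : ∫⁻ y in ball (0 : Eucl n) R, W y ^ s ≠ ⊤) :
    morreyE n s t W ≠ ⊤ := by
  have hs : 0 < s := ht.trans_le hts
  have hind : (ball (0 : Eucl n) R).indicator W = W := by
    rw [Set.indicator_eq_self]
    intro x hx
    by_contra hx'
    exact hx (hsupp x hx')
  have h1 := morreyE_indicator_ball_le ht hts hts le_rfl hW (0 : Eucl n) hR
  rw [hind] at h1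
  refine ne_top_of_le_ne_top ?_ h1
  rw [sub_self, ENNReal.rpow_zero, one_mul]
  have h2 : morreyE n s s W ≤ (∫⁻ y in ball (0 : Eucl n) R, W y ^ s) ^ (1 / s) := by
    rw [morreyE_le_iff]
    intro x r hr
    rw [sub_self, ENNReal.rpow_zero, one_mul]
    refine ENNReal.rpow_le_rpow ((setLIntegral_le_lintegral _ _).trans (le_of_eq ?_))
      (by positivity)
    rw [← lintegral_indicator measurableSet_ball]
    congr 1
    ext y
    by_cases hy : y ∈ ball (0 : Eucl n) R
    · rw [Set.indicator_of_mem hy]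
    · rw [Set.indicator_of_notMem hy, hsupp y hy, ENNReal.zero_rpow_of_pos hs]
  exact ne_top_of_le_ne_top (ENNReal.rpow_ne_top_of_nonneg (by positivity) h) h2

lemma exists_finset_net {κ : Type*} [Fintype κ] {n : ℕ} {s t : ℝ} (ht : 1 ≤ t)
    (G : κ → Eucl n → ℝ) (hG : ∀ i, Measurable (G i))
    (hGM : ∀ i, morreyE n s t (fun x => ‖G i x‖ₑ) ≠ ⊤) (K : ℝ) {ε : ℝ≥0∞} (hε : ε ≠ 0) :
    ∃ F : Finset (Eucl n → ℝ), ∀ c : κ → ℝ, (∀ i, |c i| ≤ K) → ∃ g ∈ F, Measurable g ∧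
      morreyE n s t (fun x => ‖∑ i, c i * G i x - g x‖ₑ) ≤ ε := by
  classical
  obtain ⟨η, hη, hηε⟩ := exists_mul_ofReal_le (D := ∑ i, morreyE n s t (fun x => ‖G i x‖ₑ))
    (ENNReal.sum_ne_top.2 fun i _ => hGM i) hε
  obtain ⟨T, -, hT, hcov⟩ := finite_cover_balls_of_compact
    (isCompact_closedBall (0 : κ → ℝ) (max K 0)) hη
  refine ⟨hT.toFinset.image fun c x => ∑ i, c i * G i x, fun c hc => ?_⟩
  have hc' : c ∈ closedBall (0 : κ → ℝ) (max K 0) := by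
    rw [mem_closedBall_zero_iff, pi_norm_le_iff_of_nonneg (by positivity)]
    exact fun i => (hc i).trans (le_max_left _ _)
  obtain ⟨d, hd, hcd⟩ := Set.mem_iUnion₂.1 (hcov hc')
  refine ⟨_, Finset.mem_image_of_mem _ (hT.mem_toFinset.2 hd),
    Finset.measurable_fun_sum _ fun i _ => (hG i).const_mul _, ?_⟩
  have h1 : ∀ i, ‖c i - d i‖ₑ ≤ ENNReal.ofReal η := fun i => by
    rw [← ofReal_norm]
    refine ENNReal.ofReal_le_ofReal ?_
    rw [← dist_eq_norm]
    exact (dist_le_pi_dist c d i).trans (mem_ball.1 hcd).le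
  calc morreyE n s t (fun x => ‖∑ i, c i * G i x - ∑ i, d i * G i x‖ₑ)
      ≤ morreyE n s t (fun x => ∑ i, ENNReal.ofReal η * ‖G i x‖ₑ) := by
        refine morreyE_mono_ae (by linarith) (Eventually.of_forall fun x => ?_)
        rw [← Finset.sum_sub_distrib]
        refine (enorm_sum_le _ _).trans (Finset.sum_le_sum fun i _ => ?_)
        rw [← sub_mul, enorm_mul]
        gcongr
        exact h1 i
    _ ≤ ∑ i, morreyE n s t (fun x => ENNReal.ofReal η * ‖G i x‖ₑ) :=
        morreyE_sum_le ht _ fun i _ => (hG i).enorm.const_mul _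
    _ ≤ ∑ i, ENNReal.ofReal η * morreyE n s t (fun x => ‖G i x‖ₑ) :=
        Finset.sum_le_sum fun i _ => morreyE_const_mul (by linarith) _ (hG i).enorm
    _ ≤ ε := by rwa [← Finset.mul_sum, mul_comm]

/-- Operators whose kernel is a finite sum of products times a product of BMO differences
send bounded sets to totally bounded sets. -/
lemma exists_net_of_finite_rank {ι : Type*} [DecidableEq ι] {n : ℕ} {p q s t : ℝ} (hq : 1 < q)
    (ht : 1 ≤ t) (hts : t ≤ s) (J : Finset ι) (a : ι → Eucl n → ℝ) (N : ι → ℝ)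
    (ha : ∀ j ∈ J, Measurable (a j) ∧ 0 < N j ∧ HasOscLE n (a j) (N j)) {R K : ℝ} (hR : 0 < R)
    (U : Finset (Eucl n)) (g h : Eucl n → Eucl n → ℝ)
    (hm : ∀ u, Measurable (g u) ∧ Measurable (h u)) (hb : ∀ u x, |g u x| ≤ K ∧ |h u x| ≤ K)
    (hsupp : ∀ u, ∀ x ∉ ball (0 : Eucl n) R, g u x = 0 ∧ h u x = 0) {m : ℝ≥0∞} (hm' : m ≠ ⊤)
    {ε : ℝ≥0∞} (hε : ε ≠ 0) : ∃ F : Finset (Eucl n → ℝ), ∀ f : Eucl n → ℝ, Measurable f →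
      morreyE n p q (fun x => ‖f x‖ₑ) ≤ m →
      (∀ x, Integrable fun y => (∑ u ∈ U, g u x * h u y) * (∏ j ∈ J, (a j x - a j y)) * f y) ∧
      ∃ G ∈ F, Measurable (fun x =>
        (∫ y, (∑ u ∈ U, g u x * h u y) * (∏ j ∈ J, (a j x - a j y)) * f y) - G x) ∧
        morreyE n s t (fun x => ‖(∫ y, (∑ u ∈ U, g u x * h u y) *
          (∏ j ∈ J, (a j x - a j y)) * f y) - G x‖ₑ) ≤ ε := by
  have hs : 0 < s := by linarith
  have : IsFiniteMeasure (volume.restrict (ball (0 : Eucl n) R)) :=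
    ⟨by simpa using measure_ball_lt_top⟩
  have hLp : ∀ j ∈ J, ∀ r : ℝ≥0∞, r ≠ ⊤ → MemLp (a j) r (volume.restrict (ball 0 R)) :=
    fun j hj r hr => (ha j hj).2.2.memLp (ha j hj).2.1 (ha j hj).1 hR hr
  have hq' := Real.HolderConjugate.conjExponent hq
  set q' := q.conjExponent
  have hq'0 : 0 < q' := hq'.symm.pos
  let P : Finset ι → Eucl n → ℝ := fun A y => ∏ j ∈ J \ A, (- a j y)
  have hPm : ∀ A, Measurable (P A) := fun A => Finset.measurable_fun_prod _ fun j hj =>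
    (ha j (Finset.sdiff_subset hj)).1.neg
  have hP : ∀ A, (∫⁻ y in ball (0 : Eucl n) R, ‖P A y‖ₑ ^ q') ^ (1 / q') ≠ ⊤ := fun A => by
    have h1 : MemLp (P A) (ENNReal.ofReal q') (volume.restrict (ball 0 R)) :=
      memLp_prod_of_forall (fun j hj r hr => (hLp j (Finset.sdiff_subset hj) r hr).neg)
        ofReal_ne_top
    have h2 := (eLpNorm_lt_top_iff_lintegral_rpow_enorm_lt_top (by simpa using hq'0)
      ofReal_ne_top).1 h1.2
    rw [ENNReal.toReal_ofReal hq'0.le] at h2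
    exact ENNReal.rpow_ne_top_of_nonneg (by positivity) h2.ne
  let Q : Finset ι → ℝ≥0∞ := fun A => ENNReal.ofReal K *
    ((∫⁻ y in ball (0 : Eucl n) R, ‖P A y‖ₑ ^ q') ^ (1 / q') *
      (volume (ball (0 : Eucl n) R) ^ (1 / q - 1 / p) * m))
  have hQ : ∀ A, Q A ≠ ⊤ := fun A => ENNReal.mul_ne_top ofReal_ne_top (ENNReal.mul_ne_top (hP A)
    (ENNReal.mul_ne_top (ENNReal.rpow_ne_top_of_ne_zero (volume_ball_ne_zero _ hR)
      measure_ball_lt_top.ne) hm'))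
  have hbound : ∀ f : Eucl n → ℝ, Measurable f → morreyE n p q (fun x => ‖f x‖ₑ) ≤ m →
      ∀ u A, ∫⁻ y, ‖h u y * P A y * f y‖ₑ ≤ Q A := by
    intro f hf hfm u A
    calc ∫⁻ y, ‖h u y * P A y * f y‖ₑ
        ≤ ∫⁻ y in ball (0 : Eucl n) R, ENNReal.ofReal K * (‖P A y‖ₑ * ‖f y‖ₑ) := by
          rw [← lintegral_indicator measurableSet_ball]
          refine lintegral_mono fun y => ?_
          by_cases hy : y ∈ ball (0 : Eucl n) R
          · rw [Set.indicator_of_mem hy, enorm_mul, enorm_mul, mul_assoc]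
            gcongr
            rw [Real.enorm_eq_ofReal_abs]
            exact ENNReal.ofReal_le_ofReal (hb u y).2
          · rw [Set.indicator_of_notMem hy, (hsupp u y hy).2]
            simp
      _ = ENNReal.ofReal K * ∫⁻ y in ball (0 : Eucl n) R, ‖P A y‖ₑ * ‖f y‖ₑ :=
          lintegral_const_mul' _ _ ofReal_ne_top
      _ ≤ ENNReal.ofReal K * ((∫⁻ y in ball (0 : Eucl n) R, ‖P A y‖ₑ ^ q') ^ (1 / q') *
          ballNorm q (fun y => ‖f y‖ₑ) 0 R) := by
          gcongr
          exact ENNReal.lintegral_mul_le_Lp_mul_Lq _ hq'.symm (hPm A).enorm.aemeasurable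
            hf.enorm.aemeasurable
      _ ≤ Q A := by
          simp only [Q]
          gcongr
          exact ballNorm_le_of_morreyE_le hfm 0 hR
  let κ := U × J.powerset
  let G : κ → Eucl n → ℝ := fun i x => g i.1 x * ∏ j ∈ i.2.1, a j x
  have hGm : ∀ i, Measurable (G i) := fun i => (hm _).1.mul
    (Finset.measurable_fun_prod _ fun j hj => (ha j (Finset.mem_powerset.1 i.2.2 hj)).1)
  have hGM : ∀ i, morreyE n s t (fun x => ‖G i x‖ₑ) ≠ ⊤ := fun i => by
    refine morreyE_ne_top_of_support (by linarith) hts (hGm i).enorm hR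
      (fun x hx => by simp [G, (hsupp i.1 x hx).1]) ?_
    have h1 : MemLp (fun x => ∏ j ∈ i.2.1, a j x) (ENNReal.ofReal s) (volume.restrict (ball 0 R)) :=
      memLp_prod_of_forall (fun j hj r hr => hLp j (Finset.mem_powerset.1 i.2.2 hj) r hr)
        ofReal_ne_top
    have h2 : MemLp (G i) (ENNReal.ofReal s) (volume.restrict (ball 0 R)) :=
      h1.of_le_mul (c := K) (hGm i).aestronglyMeasurable (Eventually.of_forall fun x => by
        rw [norm_mul]
        exact mul_le_mul_of_nonneg_right (hb _ x).1 (norm_nonneg _))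
    have h3 := (eLpNorm_lt_top_iff_lintegral_rpow_enorm_lt_top (by simpa using hs)
      ofReal_ne_top).1 h2.2
    rw [ENNReal.toReal_ofReal hs.le] at h3
    exact h3.ne
  obtain ⟨F, hF⟩ := exists_finset_net ht G hGm hGM (∑ A ∈ J.powerset, (Q A).toReal) hε
  refine ⟨F, fun f hf hfm => ?_⟩
  have hintegrable : ∀ u A, Integrable (fun y => h u y * P A y * f y) := fun u A =>
    ⟨(((hm u).2.mul (hPm A)).mul hf).aestronglyMeasurable,
      (hbound f hf hfm u A).trans_lt (hQ A).lt_top⟩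
  let c : κ → ℝ := fun i => ∫ y, h i.1 y * P i.2 y * f y
  have hc : ∀ i, |c i| ≤ ∑ A ∈ J.powerset, (Q A).toReal := fun i => by
    have h1 : |c i| ≤ (Q i.2).toReal := by
      rw [← Real.norm_eq_abs, ← toReal_enorm]
      exact ENNReal.toReal_mono (hQ _)
        ((enorm_integral_le_lintegral_enorm _).trans (hbound f hf hfm _ _))
    exact h1.trans (Finset.single_le_sum (f := fun A => (Q A).toReal)
      (fun A _ => ENNReal.toReal_nonneg) i.2.2)
  have hexp : ∀ x, (fun y => (∑ u ∈ U, g u x * h u y) * (∏ j ∈ J, (a j x - a j y)) * f y) =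
      fun y => ∑ i : κ, G i x * (h i.1 y * P i.2 y * f y) := by
    intro x
    ext y
    have h1 : ∀ Φ : Eucl n → Finset ι → ℝ,
        ∑ i : κ, Φ i.1 i.2 = ∑ u ∈ U, ∑ A ∈ J.powerset, Φ u A := fun Φ => by
      simp only [κ]
      rw [Fintype.sum_prod_type, ← Finset.sum_coe_sort U]
      exact Finset.sum_congr rfl fun u _ => Finset.sum_coe_sort J.powerset (Φ u)
    rw [h1 fun u A => g u x * (∏ j ∈ A, a j x) * (h u y * P A y * f y)]
    simp_rw [sub_eq_add_neg, Finset.prod_add, Finset.sum_mul_sum, Finset.sum_mul]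
    refine Finset.sum_congr rfl fun u _ => Finset.sum_congr rfl fun A _ => ?_
    simp only [P]
    ring
  have hintegrable' : ∀ x, ∀ i ∈ (Finset.univ : Finset κ),
      Integrable fun y => G i x * (h i.1 y * P i.2 y * f y) := fun x i _ => (hintegrable _ _).const_mul _
  have hT : ∀ x, ∫ y, (∑ u ∈ U, g u x * h u y) * (∏ j ∈ J, (a j x - a j y)) * f y =
      ∑ i, c i * G i x := by
    intro x
    rw [hexp x, integral_finsetSum _ (hintegrable' x)]
    refine Finset.sum_congr rfl fun i _ => ?_
    rw [integral_const_mul, mul_comm]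
  simp_rw [hT]
  obtain ⟨g', hg', hgmeas, hg'ε⟩ := hF c hc
  refine ⟨fun x => ?_, g', hg', ?_, hg'ε⟩
  · rw [hexp x]
    exact integrable_finsetSum _ (hintegrable' x)
  · exact (Finset.measurable_fun_sum _ fun i _ => (hGm i).const_mul _).sub hgmeas

/-! ### Compactness for measurable symbols -/

lemma enorm_finset_prod {ι : Type*} [DecidableEq ι] (J : Finset ι) (g : ι → ℝ) :
    ‖∏ j ∈ J, g j‖ₑ = ∏ j ∈ J, ‖g j‖ₑ := by
  induction J using Finset.induction_on with
  | empty => simp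
  | insert i J hi ih => rw [Finset.prod_insert hi, Finset.prod_insert hi, enorm_mul, ih]

lemma enorm_commutator_sub_le {ι : Type*} [DecidableEq ι] {n : ℕ} {α θ : ℝ} {J : Finset ι} {i₀ : ι}
    (hi₀ : i₀ ∉ J) {a : ι → Eucl n → ℝ} (ha : ∀ j ∈ insert i₀ J, Measurable (a j))
    {φ : Eucl n → ℝ} {f : Eucl n → ℝ} (hf : Measurable f) {x : Eucl n}
    (hx : volume {x} = 0) {k : Eucl n → ℝ} {ε ρ : ℝ} (hε : 0 ≤ ε)
    (hk : ∀ y, x ≠ y → |(φ x - φ y) * dist x y ^ (α - n) - k y| ≤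
      ε * (dist x y ^ (α - n) + (ball (0 : Eucl n) ρ).indicator 1 x * dist x y ^ (α + θ - n) +
          (ball (0 : Eucl n) ρ).indicator 1 y * dist x y ^ (α + θ - n)))
    (hfin : posOp n α (insert i₀ J) a (fun y => ‖f y‖ₑ) x < ⊤)
    (hintegrable : Integrable fun y => k y * (∏ j ∈ J, (a j x - a j y)) * f y) :
    ‖(∫ y, (∏ j ∈ insert i₀ J, (a j x - a j y)) * f y * dist x y ^ (α - n)) -
        ∫ y, k y * (∏ j ∈ J, (a j x - a j y)) * f y‖ₑ ≤
      posOp n α (insert i₀ J) (Function.update a i₀ fun z => a i₀ z - φ z) (fun y => ‖f y‖ₑ) x +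
      ENNReal.ofReal ε * (posOp n α J a (fun y => ‖f y‖ₑ) x +
        (ball (0 : Eucl n) ρ).indicator (posOp n (α + θ) J a fun y => ‖f y‖ₑ) x +
        posOp n (α + θ) J a ((ball (0 : Eucl n) ρ).indicator fun y => ‖f y‖ₑ) x) := by
  have hJ : ∀ j ∈ J, Measurable (a j) := fun j hj => ha j (Finset.mem_insert_of_mem hj)
  have hPm : Measurable fun y => ∏ j ∈ J, ‖a j x - a j y‖ₑ :=
    Finset.measurable_fun_prod _ fun j hj => ((hJ j hj).const_sub _).enorm
  have hdm : ∀ c : ℝ, Measurable fun y : Eucl n => ENNReal.ofReal (dist x y ^ c) := fun c =>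
    ENNReal.measurable_ofReal.comp ((measurable_const.dist measurable_id).pow_const c)
  have hd0 : ∀ (c : ℝ) (y : Eucl n), 0 ≤ dist x y ^ c := fun c y => Real.rpow_nonneg dist_nonneg _
  have hint₁ : Integrable fun y =>
      (∏ j ∈ insert i₀ J, (a j x - a j y)) * f y * dist x y ^ (α - n) := by
    refine ⟨?_, ?_⟩
    · refine Measurable.aestronglyMeasurable ?_
      exact ((Finset.measurable_fun_prod _ fun j hj => (ha j hj).const_sub _).mul hf).mul
        ((measurable_const.dist measurable_id).pow_const _)
    · refine lt_of_le_of_lt (lintegral_mono fun y => ?_) hfin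
      rw [enorm_mul, enorm_mul, enorm_finset_prod, Real.enorm_of_nonneg (hd0 _ y)]
  rw [← integral_sub hint₁ hintegrable]
  refine (enorm_integral_le_lintegral_enorm _).trans ?_
  have hT : ∀ (c : ℝ) (F : Eucl n → ℝ≥0∞), Measurable F → Measurable fun y =>
      (∏ j ∈ J, ‖a j x - a j y‖ₑ) * F y * ENNReal.ofReal (dist x y ^ c) := fun c F hF =>
    (hPm.mul hF).mul (hdm c)
  have hfe := hf.enorm
  set B := ball (0 : Eucl n) ρ
  have hfB : Measurable (B.indicator fun y => ‖f y‖ₑ) := hfe.indicator measurableSet_ball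
  calc _ ≤ ∫⁻ y, ((∏ j ∈ insert i₀ J, ‖Function.update a i₀ (fun z => a i₀ z - φ z) j x -
          Function.update a i₀ (fun z => a i₀ z - φ z) j y‖ₑ) * ‖f y‖ₑ *
          ENNReal.ofReal (dist x y ^ (α - n)) +
        ENNReal.ofReal ε * (((∏ j ∈ J, ‖a j x - a j y‖ₑ) * ‖f y‖ₑ *
            ENNReal.ofReal (dist x y ^ (α - n)) +
          B.indicator 1 x * ((∏ j ∈ J, ‖a j x - a j y‖ₑ) * ‖f y‖ₑ *
            ENNReal.ofReal (dist x y ^ (α + θ - n)))) +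
          (∏ j ∈ J, ‖a j x - a j y‖ₑ) * B.indicator (fun y => ‖f y‖ₑ) y *
            ENNReal.ofReal (dist x y ^ (α + θ - n)))) := by
        refine lintegral_mono_ae ?_
        have hne : ∀ᵐ y, y ≠ x := by
          rw [ae_iff]
          simpa using hx
        filter_upwards [hne] with y hy
        have hprod : ∏ j ∈ J, (Function.update a i₀ (fun z => a i₀ z - φ z) j x -
            Function.update a i₀ (fun z => a i₀ z - φ z) j y) = ∏ j ∈ J, (a j x - a j y) :=
          Finset.prod_congr rfl fun j hj => by
            rw [Function.update_of_ne (ne_of_mem_of_not_mem hj hi₀)]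
        rw [← enorm_finset_prod, ← enorm_finset_prod, Finset.prod_insert hi₀, Finset.prod_insert hi₀, hprod,
          Function.update_self]
        have h1 : (a i₀ x - a i₀ y) * (∏ j ∈ J, (a j x - a j y)) * f y * dist x y ^ (α - n) -
            k y * (∏ j ∈ J, (a j x - a j y)) * f y =
            (a i₀ x - φ x - (a i₀ y - φ y)) * (∏ j ∈ J, (a j x - a j y)) * f y *
              dist x y ^ (α - n) +
            ((φ x - φ y) * dist x y ^ (α - n) - k y) * ((∏ j ∈ J, (a j x - a j y)) * f y) := by
          ring
        have hi : ∀ z, B.indicator (1 : Eucl n → ℝ≥0∞) z =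
            ENNReal.ofReal (B.indicator (1 : Eucl n → ℝ) z) := fun z => by
          by_cases hz : z ∈ B
          · simp [hz]
          · simp [hz]
        have hi0 : ∀ z, 0 ≤ B.indicator (1 : Eucl n → ℝ) z := fun z =>
          Set.indicator_nonneg (fun _ _ => zero_le_one) z
        have h2 : ‖(φ x - φ y) * dist x y ^ (α - n) - k y‖ₑ ≤ ENNReal.ofReal ε *
            (ENNReal.ofReal (dist x y ^ (α - n)) +
              B.indicator 1 x * ENNReal.ofReal (dist x y ^ (α + θ - n)) +
              B.indicator 1 y * ENNReal.ofReal (dist x y ^ (α + θ - n))) := by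
          rw [hi, hi, ← ENNReal.ofReal_mul (hi0 _), ← ENNReal.ofReal_mul (hi0 _),
            ← ENNReal.ofReal_add (hd0 _ _) (mul_nonneg (hi0 _) (hd0 _ _)),
            ← ENNReal.ofReal_add (add_nonneg (hd0 _ _) (mul_nonneg (hi0 _) (hd0 _ _)))
              (mul_nonneg (hi0 _) (hd0 _ _)), ← ENNReal.ofReal_mul hε, Real.enorm_eq_ofReal_abs]
          exact ENNReal.ofReal_le_ofReal (hk y hy.symm)
        have h3 : B.indicator (fun y => ‖f y‖ₑ) y = B.indicator 1 y * ‖f y‖ₑ := by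
          by_cases hz : y ∈ B
          · simp [hz]
          · simp [hz]
        rw [h1, h3]
        refine (enorm_add_le _ _).trans (add_le_add (le_of_eq ?_) ?_)
        · rw [enorm_mul, enorm_mul, Real.enorm_of_nonneg (hd0 _ y)]
        · rw [enorm_mul, enorm_mul]
          refine (mul_le_mul_left h2 _).trans (le_of_eq ?_)
          ring
    _ = _ := by
        have hm₀ : Measurable fun y => (∏ j ∈ J, ‖a j x - a j y‖ₑ) * ‖f y‖ₑ *
            ENNReal.ofReal (dist x y ^ (α - n)) := hT _ _ hfe
        have hm₁ : Measurable fun y => (∏ j ∈ J, ‖a j x - a j y‖ₑ) * ‖f y‖ₑ *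
            ENNReal.ofReal (dist x y ^ (α + θ - n)) := hT _ _ hfe
        have hm₂ := hT (α + θ - n) _ hfB
        have hm₃ : Measurable fun y => ENNReal.ofReal ε * (((∏ j ∈ J, ‖a j x - a j y‖ₑ) * ‖f y‖ₑ *
            ENNReal.ofReal (dist x y ^ (α - n)) +
          B.indicator 1 x * ((∏ j ∈ J, ‖a j x - a j y‖ₑ) * ‖f y‖ₑ *
            ENNReal.ofReal (dist x y ^ (α + θ - n)))) +
          (∏ j ∈ J, ‖a j x - a j y‖ₑ) * B.indicator (fun y => ‖f y‖ₑ) y *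
            ENNReal.ofReal (dist x y ^ (α + θ - n))) :=
          ((hm₀.add (hm₁.const_mul _)).add hm₂).const_mul _
        rw [lintegral_add_right _ hm₃,
          lintegral_const_mul' _ _ ofReal_ne_top, lintegral_add_right _ hm₂,
          lintegral_add_left hm₀, lintegral_const_mul _ hm₁]
        have : B.indicator (posOp n (α + θ) J a fun y => ‖f y‖ₑ) x =
            B.indicator 1 x * posOp n (α + θ) J a (fun y => ‖f y‖ₑ) x := by
          by_cases hz : x ∈ B
          · simp [hz]
          · simp [hz]
        rw [this]
        rfl

theorem exists_net_commutator {ι : Type*} [DecidableEq ι] {n : ℕ} (hn : 0 < n) {α p q s t : ℝ}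
    (hα : 0 < α) (hαn : α < n) (hq : 1 < q) (hqp : q ≤ p) (hs : 1 / s = 1 / p - α / n)
    (hs0 : 0 < 1 / s) (hst : p / q = s / t) {J : Finset ι} {i₀ : ι} (hi₀ : i₀ ∉ J)
    (a : ι → Eucl n → ℝ) (N : ι → ℝ)
    (ha : ∀ j ∈ insert i₀ J, Measurable (a j) ∧ 0 < N j ∧ HasOscLE n (a j) (N j))
    (hV : ∀ δ : ℝ, 0 < δ → ∃ φ, IsCcSmooth n φ ∧ HasOscLE n (fun x => a i₀ x - φ x) δ)
    {m : ℝ≥0∞} (hm0 : m ≠ 0) (hm : m ≠ ⊤) {ε : ℝ≥0∞} (hε : ε ≠ 0) :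
    ∃ F : Finset (Eucl n → ℝ), ∀ f : Eucl n → ℝ, Measurable f →
      morreyE n p q (fun x => ‖f x‖ₑ) ≤ m → ∃ G ∈ F, morreyE n s t (fun x =>
        ‖(∫ y, (∏ j ∈ insert i₀ J, (a j x - a j y)) * f y * dist x y ^ (α - n)) - G x‖ₑ) ≤ ε := by
  have hs0' : 0 < s := one_div_pos.1 hs0
  have hq0 : 0 < q := by linarith
  have hp0 : 0 < p := by linarith
  have hn' : (0 : ℝ) < n := by exact_mod_cast hn
  have hps : p < s := by
    have : 0 < α / n := by positivity
    exact (one_div_lt_one_div hs0' hp0).1 (by linarith)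
  have ht0 : 0 < t := by
    have : 0 < s / t := by rw [← hst]; positivity
    exact (div_pos_iff_of_pos_left hs0').1 this
  have hpt : p * t = s * q := by rwa [div_eq_div_iff hq0.ne' ht0.ne'] at hst
  have hqt : q < t := by
    have : p * q < p * t := by rw [hpt]; gcongr
    exact lt_of_mul_lt_mul_left this hp0.le
  have hts : t ≤ s := by
    have : p * t ≤ p * s := by rw [hpt, mul_comm]; gcongr
    exact le_of_mul_le_mul_left this hp0
  have hJa : ∀ j ∈ J, Measurable (a j) ∧ 0 < N j ∧ HasOscLE n (a j) (N j) :=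
    fun j hj => ha j (Finset.mem_insert_of_mem hj)
  -- exponents for the improved order of integration
  obtain ⟨θ, hθ, hθ₁, hθ₂, hθ₃⟩ : ∃ θ : ℝ, 0 < θ ∧ α + θ < n ∧ 0 < 1 / s - θ / n ∧
      1 < q / (1 + θ * p / n) := by
    have hq1 : 0 < q - 1 := by linarith
    have hαn' : 0 < n - α := by linarith
    set M := min (n - α) (min (n / s) ((q - 1) * n / p)) with hM
    have hM0 : 0 < M := by positivity
    have h1 : M ≤ n - α := min_le_left _ _
    have h2 : M ≤ n / s := (min_le_right _ _).trans (min_le_left _ _)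
    have h3 : M ≤ (q - 1) * n / p := (min_le_right _ _).trans (min_le_right _ _)
    refine ⟨M / 2, by positivity, by linarith, ?_, ?_⟩
    · have : M / 2 < n / s := by linarith
      rw [sub_pos, div_lt_iff₀ hn', one_div_mul_eq_div]
      exact this
    · rw [one_lt_div (by positivity)]
      have : M / 2 < (q - 1) * n / p := by linarith
      rw [lt_div_iff₀ hp0] at this
      have h4 : M / 2 * p / n < q - 1 := by rwa [div_lt_iff₀ hn']
      linarith
  set s₁ := 1 / (1 / s - θ / n) with hs₁
  set t₁ := s₁ * q / p with ht₁
  set p₁ := p / (1 + θ * p / n) with hp₁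
  set q₁ := q / (1 + θ * p / n) with hq₁
  have hden : 1 ≤ 1 + θ * p / n := by
    have : 0 < θ * p / n := by positivity
    linarith
  have hs₁0 : 0 < s₁ := by positivity
  have hss₁ : s ≤ s₁ := by
    rw [hs₁, le_div_iff₀ hθ₂, mul_sub, mul_one_div_cancel hs0'.ne']
    have : 0 ≤ s * (θ / n) := by positivity
    linarith
  have htt : t = s * q / p := by rw [eq_div_iff hp0.ne', mul_comm, hpt]
  have htt₁ : t ≤ t₁ := by rw [htt, ht₁]; gcongr
  have hp₁0 : 0 < p₁ := by positivity
  have hqp₁ : q₁ ≤ p₁ := by rw [hq₁, hp₁]; gcongr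
  have hp₁p : p₁ ≤ p := div_le_self hp0.le hden
  have hq₁q : q₁ ≤ q := div_le_self hq0.le hden
  obtain ⟨C₁, hC₁, h₁⟩ := exists_morreyE_posOp_le hn hα hαn hq hqp hs hs0 hst (insert i₀ J)
  obtain ⟨C₂, hC₂, h₂⟩ := exists_morreyE_posOp_le hn hα hαn hq hqp hs hs0 hst J
  obtain ⟨C₃, hC₃, h₃⟩ := exists_morreyE_posOp_le (s := s₁) (t := t₁) hn (by linarith) hθ₁ hq hqp
    (by rw [hs₁, one_div_one_div, hs, add_div]; ring) (by positivity)
    (by rw [ht₁]; field_simp) J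
  obtain ⟨C₄, hC₄, h₄⟩ := exists_morreyE_posOp_le (p := p₁) (q := q₁) (s := s) (t := t) hn
    (by linarith) hθ₁ hθ₃ hqp₁ (by rw [hs, hp₁]; field_simp; ring) hs0
    (by rw [← hst, hp₁, hq₁]; field_simp) J
  set P := ∏ j ∈ J, ENNReal.ofReal (N j)
  have hP : P ≠ ⊤ := ENNReal.prod_ne_top fun _ _ => ofReal_ne_top
  have hε3 : ε / 3 ≠ 0 := by simpa using hε
  -- choice of the test function and of the finite rank kernel
  obtain ⟨δ, hδ0, hδ⟩ := exists_mul_ofReal_le (D := C₁ * P * m) (by finiteness) hε3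
  obtain ⟨φ, hφ, hφδ⟩ := hV δ hδ0
  obtain ⟨ρ, hρ, hker⟩ := exists_finite_rank_kernel hαn hθ hφ
  have hvol : ∀ c : ℝ, volume (ball (0 : Eucl n) ρ) ^ c ≠ ⊤ := fun c =>
    ENNReal.rpow_ne_top_of_ne_zero (volume_ball_ne_zero _ hρ) measure_ball_lt_top.ne
  set m₁ := volume (ball (0 : Eucl n) ρ) ^ (1 / p₁ - 1 / p) * m + 1
  have hm₁ : m₁ ≠ ⊤ := ENNReal.add_ne_top.2 ⟨ENNReal.mul_ne_top (hvol _) hm, by simp⟩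
  set D := C₂ * P * m + volume (ball (0 : Eucl n) ρ) ^ (1 / s - 1 / s₁) * (C₃ * P * m) +
    C₄ * P * m₁
  have hD : D ≠ ⊤ := by
    have := hvol (1 / s - 1 / s₁)
    finiteness
  obtain ⟨η, hη0, hη⟩ := exists_mul_ofReal_le hD hε3
  obtain ⟨R, K, U, g, h, hR, hK, hgm, hgb, hgs, hgk⟩ := hker η hη0
  obtain ⟨F, hF⟩ := exists_net_of_finite_rank (p := p) hq (by linarith : 1 ≤ t) hts J a N hJa hR U g h
    hgm hgb hgs hm hε3
  refine ⟨F, fun f hf hfm => ?_⟩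
  obtain ⟨hintegrable, G, hGF, hGm, hGε⟩ := hF f hf hfm
  refine ⟨G, hGF, ?_⟩
  have hfe := hf.enorm
  set B := ball (0 : Eucl n) ρ
  set b := Function.update a i₀ fun z => a i₀ z - φ z
  have hφm : Measurable φ := hφ.1.continuous.measurable
  have hb : ∀ j ∈ insert i₀ J, Measurable (b j) ∧ 0 < Function.update N i₀ δ j ∧
      HasOscLE n (b j) (Function.update N i₀ δ j) := by
    intro j hj
    rcases eq_or_ne j i₀ with rfl | hji
    · simp only [b, Function.update_self]
      exact ⟨(ha _ hj).1.sub hφm, hδ0, hφδ⟩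
    · simp only [b, Function.update_of_ne hji]
      exact ha j hj
  have hJm : ∀ j ∈ J, Measurable (a j) := fun j hj => (hJa j hj).1
  set E₁ := posOp n α (insert i₀ J) b fun y => ‖f y‖ₑ
  set E₂ := posOp n α J a fun y => ‖f y‖ₑ
  set E₃ := posOp n (α + θ) J a fun y => ‖f y‖ₑ
  set E₄ := posOp n (α + θ) J a (B.indicator fun y => ‖f y‖ₑ)
  have hE₁m : Measurable E₁ := measurable_posOp (fun j hj => (hb j hj).1) hfe
  have hE₂m : Measurable E₂ := measurable_posOp hJm hfe
  have hE₃m : Measurable E₃ := measurable_posOp hJm hfe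
  have hfB : Measurable (B.indicator fun y => ‖f y‖ₑ) := hfe.indicator measurableSet_ball
  have hE₄m : Measurable E₄ := measurable_posOp hJm hfB
  have hE₁ : morreyE n s t E₁ ≤ ε / 3 := by
    refine (h₁ b _ hb _ hfe m hm0 hm hfm).trans (le_trans (le_of_eq ?_) hδ)
    rw [Finset.prod_insert hi₀, Function.update_self]
    have : ∏ j ∈ J, ENNReal.ofReal (Function.update N i₀ δ j) = P :=
      Finset.prod_congr rfl fun j hj => by rw [Function.update_of_ne (ne_of_mem_of_not_mem hj hi₀)]
    rw [this]
    ring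
  have hE₂ : morreyE n s t E₂ ≤ C₂ * P * m := h₂ a N hJa _ hfe m hm0 hm hfm
  have hE₃ : morreyE n s t (B.indicator E₃) ≤
      volume B ^ (1 / s - 1 / s₁) * (C₃ * P * m) :=
    (morreyE_indicator_ball_le ht0 hts htt₁ hss₁ hE₃m 0 hρ).trans
      (mul_le_mul_right (h₃ a N hJa _ hfe m hm0 hm hfm) _)
  have hE₄ : morreyE n s t E₄ ≤ C₄ * P * m₁ := by
    refine h₄ a N hJa _ hfB m₁ (by simp [m₁]) hm₁ ?_
    refine (morreyE_indicator_ball_le (by linarith) hqp₁ hq₁q hp₁p hfe 0 hρ).trans ?_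
    exact le_trans (by gcongr) le_self_add
  have hsum : morreyE n s t (fun x => E₂ x + B.indicator E₃ x + E₄ x) ≤ D := by
    have hE₃m' := hE₃m.indicator (measurableSet_ball (x := (0 : Eucl n)) (ε := ρ))
    refine (morreyE_add_le (by linarith) (hE₂m.add hE₃m') hE₄m).trans (add_le_add ?_ hE₄)
    exact (morreyE_add_le (by linarith) hE₂m hE₃m').trans (add_le_add hE₂ hE₃)
  have hfin : ∀ᵐ x, posOp n α (insert i₀ J) a (fun y => ‖f y‖ₑ) x < ⊤ := by
    refine ae_lt_top_of_morreyE ht0 (measurable_posOp (fun j hj => (ha j hj).1) hfe)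
      (ne_top_of_le_ne_top ?_ (h₁ a N ha _ hfe m hm0 hm hfm))
    exact ENNReal.mul_ne_top (ENNReal.mul_ne_top hC₁
      (ENNReal.prod_ne_top fun _ _ => ofReal_ne_top)) hm
  have : Nonempty (Fin n) := ⟨⟨0, hn⟩⟩
  have hsum' : Measurable fun x => E₂ x + B.indicator E₃ x + E₄ x :=
    (hE₂m.add (hE₃m.indicator measurableSet_ball)).add hE₄m
  calc _ ≤ morreyE n s t (fun x => E₁ x + ENNReal.ofReal η * (E₂ x + B.indicator E₃ x + E₄ x) +
        ‖(∫ y, (∑ u ∈ U, g u x * h u y) * (∏ j ∈ J, (a j x - a j y)) * f y) - G x‖ₑ) := by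
        refine morreyE_mono_ae ht0 ?_
        filter_upwards [hfin] with x hx
        have h5 := enorm_commutator_sub_le hi₀ (fun j hj => (ha j hj).1) hf
          (measure_singleton x) hη0.le (hgk x) hx (hintegrable x)
        rw [← sub_add_sub_cancel _ (∫ y, (∑ u ∈ U, g u x * h u y) *
          (∏ j ∈ J, (a j x - a j y)) * f y)]
        exact (enorm_add_le _ _).trans (add_le_add h5 le_rfl)
    _ ≤ ε / 3 + ε / 3 + ε / 3 := by
        refine (morreyE_add_le (by linarith) (hE₁m.add (hsum'.const_mul _)) hGm.enorm).trans
          (add_le_add ?_ hGε)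
        refine (morreyE_add_le (by linarith) hE₁m (hsum'.const_mul _)).trans (add_le_add hE₁ ?_)
        refine (morreyE_const_mul ht0 _ hsum').trans (le_trans ?_ hη)
        rw [mul_comm]
        gcongr
    _ = ε := ENNReal.add_thirds ε

lemma HasOscLE.congr_ae {n : ℕ} {a b : Eucl n → ℝ} {N : ℝ} (ha : HasOscLE n a N)
    (h : a =ᵐ[volume] b) : HasOscLE n b N := by
  have havg : ∀ x r, ballAvg n b x r = ballAvg n a x r := fun x r =>
    average_congr (ae_restrict_of_ae (h.mono fun _ hy => hy.symm))
  refine ⟨fun x => ?_, fun x r hr => le_trans (le_of_eq ?_) (ha.2 x r hr)⟩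
  · obtain ⟨U, hU, hi⟩ := ha.1 x
    exact ⟨U, hU, hi.congr_fun_ae (ae_restrict_of_ae h)⟩
  · refine lintegral_congr_ae (ae_restrict_of_ae ?_)
    filter_upwards [h] with y hy
    rw [havg, hy]

/-- Sawano–Shirai: the multilinear commutator with `a₁ ∈ VMO` and
`a₂,…,a_l ∈ BMO` is compact from `M^p_q` to `M^s_t`: the image of every bounded
subset of `M^p_q` is totally bounded in the `M^s_t` norm. -/
theorem compact_mlCommutator_morrey
    (n l : ℕ) (hn : 1 ≤ n) (hl : 0 < l) (α p q s t : ℝ)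
    (hα : 0 < α) (hαn : α < n) (hq : 1 < q) (hqp : q ≤ p)
    (hs : 1 / s = 1 / p - α / n) (hs0 : 0 < 1 / s) (hst : p / q = s / t)
    (a : Fin l → Eucl n → ℝ)
    (hBMO : ∀ j : Fin l, MemBMO n (a j))
    (hVMO : ∀ j : Fin l, (j : ℕ) = 0 → MemVMO n (a j)) :
    ∀ S : Set (Eucl n → ℝ), (∀ f ∈ S, MemMorrey n p q f) →
      (∃ M : ℝ, ∀ f ∈ S, morreyNorm n p q f ≤ ENNReal.ofReal M) →
      ∀ ε : ℝ, 0 < ε → ∃ F : Finset (Eucl n → ℝ), ∀ f ∈ S,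
        ∃ g ∈ F, morreyNorm n s t (fun x => mlCommutator n l α a f x - g x)
          < ENNReal.ofReal ε := by
  rintro S hS ⟨M, hM⟩ ε hε
  have ht0 : 0 < t := by
    have : 0 < s / t := by rw [← hst]; exact div_pos (by linarith) (by linarith)
    exact (div_pos_iff_of_pos_left (one_div_pos.1 hs0)).1 this
  set b : Fin l → Eucl n → ℝ := fun j => (hBMO j).1.aestronglyMeasurable.mk (a j)
  have hab : ∀ j, a j =ᵐ[volume] b j := fun j => (hBMO j).1.aestronglyMeasurable.ae_eq_mk
  have hbm : ∀ j, Measurable (b j) := fun j =>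
    (hBMO j).1.aestronglyMeasurable.stronglyMeasurable_mk.measurable
  set i₀ : Fin l := ⟨0, hl⟩
  have huniv : insert i₀ (Finset.univ.erase i₀) = Finset.univ :=
    Finset.insert_erase (Finset.mem_univ i₀)
  obtain ⟨F, hF⟩ := exists_net_commutator hn hα hαn hq hqp hs hs0 hst
    (Finset.notMem_erase i₀ Finset.univ) b (fun j => (bmoNorm n (a j)).toReal + 1)
    (fun j _ => ⟨hbm j, by positivity, (HasOscLE.of_bmoNorm_le (hBMO j).1
      ((ENNReal.ofReal_toReal (hBMO j).2.ne).symm.le.trans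
        (ENNReal.ofReal_le_ofReal (by linarith)))).congr_ae (hab j)⟩)
    (fun δ hδ => by
      obtain ⟨φ, hφ, hφδ⟩ := (hVMO i₀ rfl).2 δ hδ
      refine ⟨φ, hφ, (HasOscLE.of_bmoNorm_le
        ((hBMO i₀).1.sub hφ.1.continuous.locallyIntegrable) hφδ.le).congr_ae ?_⟩
      filter_upwards [hab i₀] with x hx
      simp only [hx, Pi.sub_apply])
    (m := ENNReal.ofReal (max M 1)) (by simp) ENNReal.ofReal_ne_top
    (ε := ENNReal.ofReal (ε / 2)) (by simpa using hε)
  refine ⟨F, fun f hf => ?_⟩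
  obtain ⟨G, hG, hfG⟩ := hF f (hS f hf).1 (by
    rw [← morreyNorm_eq_morreyE (by linarith)]
    exact (hM f hf).trans (ENNReal.ofReal_le_ofReal (le_max_left _ _)))
  refine ⟨G, hG, lt_of_le_of_lt ?_ ((ENNReal.ofReal_lt_ofReal_iff hε).2 (half_lt_self hε))⟩
  rw [morreyNorm_eq_morreyE ht0.le]
  refine le_trans (morreyE_mono_ae ht0 ?_) hfG
  filter_upwards [ae_all_iff.2 hab] with x hx
  have : mlCommutator n l α a f x = ∫ y, (∏ j ∈ insert i₀ (Finset.univ.erase i₀),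
      (b j x - b j y)) * f y * dist x y ^ (α - (n : ℝ)) := by
    rw [huniv]
    refine integral_congr_ae ?_
    filter_upwards [ae_all_iff.2 hab] with y hy
    simp only [hx, hy]
  rw [this]
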